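/- arXiv:0906.5185 — 4 statements merged into one kernel-verified Lean document; each statement's English description precedes it below -/
import Mathlib

section
/- For every u, v ∈ C and every F ∈ V_1, one has ι(P^B(u,v) F) = P(u,v) ∘ ι(F) in End_C(C[z,λ]). (That is, under the identification ι of V_1 with the Cherednik algebra H_N, the action of the universal Bethe polynomial of the Gaudin model corresponds to left multiplication by the universal central polynomial P^Z.) -/
open MvPolynomial

noncomputable section

abbrev Rzl (N : ℕ) := MvPolynomial (Fin N ⊕ Fin N) ℂ

def permHat (N : ℕ) (σ : Equiv.Perm (Fin N)) : Rzl N ≃ₐ[ℂ] Rzl N :=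
  renameEquiv ℂ (Equiv.sumCongr σ σ)

/-- The automorphism `σ̂` as an endomorphism of `ℂ[z,λ]`. -/
def permOp (N : ℕ) (σ : Equiv.Perm (Fin N)) : Module.End ℂ (Rzl N) :=
  (permHat N σ).toLinearMap

/-- The automorphism `s_ij^z` exchanging `z_i ↔ z_j` only. -/
def sZ (N : ℕ) (i j : Fin N) : Rzl N ≃ₐ[ℂ] Rzl N :=
  renameEquiv ℂ (Equiv.sumCongr (Equiv.swap i j) (Equiv.refl (Fin N)))

/-- The automorphism `s_ij^λ` exchanging `λ_i ↔ λ_j` only. -/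
def sL (N : ℕ) (i j : Fin N) : Rzl N ≃ₐ[ℂ] Rzl N :=
  renameEquiv ℂ (Equiv.sumCongr (Equiv.refl (Fin N)) (Equiv.swap i j))

/-- Multiplication by a polynomial, as an endomorphism of `ℂ[z,λ]`. -/
def mulP (N : ℕ) (p : Rzl N) : Module.End ℂ (Rzl N) := LinearMap.mulLeft ℂ p

/-- Product of the endomorphisms `f i`, `i ∈ T`, taken in increasing order of `i`
(the order is irrelevant when the factors pairwise commute). -/
def ordProd {N : ℕ} (T : Finset (Fin N)) (f : Fin N → Module.End ℂ (Rzl N)) :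
    Module.End ℂ (Rzl N) :=
  ((T.sort (· ≤ ·)).map f).prod

/-- The universal central polynomial evaluated at `(u,v)`:
`P(u,v) = (−1)^N Σ_σ sgn(σ) (Σ_{T ⊆ Fix σ} (−1)^{|T|} (Π_{i∈T}(v−λ_i))·(Π_{i∈T}(u−K_i))) ∘ σ̂`. -/
def Puv {N : ℕ} (K : Fin N → Module.End ℂ (Rzl N)) (u v : ℂ) : Module.End ℂ (Rzl N) :=
  ((-1 : ℤ) ^ N) • ∑ σ : Equiv.Perm (Fin N), (Equiv.Perm.sign σ : ℤ) •
    ((∑ T ∈ (Finset.univ.filter fun i => σ i = i).powerset,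
        ((-1 : ℤ) ^ T.card) •
          (mulP N (∏ i ∈ T, ((C v : Rzl N) - X (Sum.inr i))) *
            ordProd T (fun i => u • (1 : Module.End ℂ (Rzl N)) - K i))) * permOp N σ)

set_option synthInstance.maxHeartbeats 1000000 in

/-- The free `ℂ[z,λ]`-module `V_1` with basis `{ε_τ : τ ∈ S_N}`, realized as
functions `S_N → ℂ[z,λ]` (the value at `τ` is the coefficient of `ε_τ`). -/
abbrev V1 (N : ℕ) := Equiv.Perm (Fin N) → Rzl N

/-- Componentwise multiplication operator on `V_1`. -/
def mulDiag {N : ℕ} (g : Equiv.Perm (Fin N) → Rzl N) : Module.End ℂ (V1 N) where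
  toFun F := fun τ => g τ * F τ
  map_add' F G := by funext τ; simp [mul_add]
  map_smul' c F := by funext τ; simp [Pi.smul_apply, mul_smul_comm]

/-- The shift `ε_τ ↦ ε_{στ}` on `V_1`. -/
def shiftOp {N : ℕ} (σ : Equiv.Perm (Fin N)) : Module.End ℂ (V1 N) :=
  LinearMap.funLeft ℂ (Rzl N) (fun ρ => σ⁻¹ * ρ)

/-- The action `P^B(u,v)` on `V_1` of the universal Bethe polynomial of the
`gl_N` Gaudin model:
`P^B(u,v)(r ε_τ) = (−1)^N Σ_σ sgn σ (Π_{i,σ(i)=i}(1−(u−z_{τ⁻¹(i)})(v−λ_i))) r ε_{στ}`. -/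
def PB (N : ℕ) (u v : ℂ) : Module.End ℂ (V1 N) :=
  ((-1 : ℤ) ^ N) • ∑ σ : Equiv.Perm (Fin N), (Equiv.Perm.sign σ : ℤ) •
    (shiftOp σ * mulDiag (fun τ => ∏ i ∈ Finset.univ.filter (fun i => σ i = i),
        (1 - ((C u : Rzl N) - X (Sum.inl (τ⁻¹ i))) * ((C v : Rzl N) - X (Sum.inr i)))))

/-- The linear map `ι : V_1 → End_ℂ(ℂ[z,λ])`,
`ι(λ^α z^β ε_τ) = (mult. by λ^α) ∘ τ̂ ∘ K^β`. -/
def iota {N : ℕ} (K : Fin N → Module.End ℂ (Rzl N)) (F : V1 N) :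
    Module.End ℂ (Rzl N) :=
  ∑ τ : Equiv.Perm (Fin N), ∑ d ∈ (F τ).support,
    (MvPolynomial.coeff d (F τ)) •
      (mulP N (∏ i : Fin N, (X (Sum.inr i) : Rzl N) ^ d (Sum.inr i)) * permOp N τ *
        ((List.finRange N).map (fun i => K i ^ d (Sum.inl i))).prod)

/-- The product of `f i`, `i ∈ T`, in increasing order of `i`. -/
def sortedProd {N : ℕ} {A : Type*} [Ring A] (f : Fin N → A) (T : Finset (Fin N)) : A :=
  ((T.sort (· ≤ ·)).map f).prod

lemma sortedProd_empty {N : ℕ} {A : Type*} [Ring A] (f : Fin N → A) :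
    sortedProd f ∅ = 1 := by
  simp [sortedProd]

lemma sortedProd_insert {N : ℕ} {A : Type*} [Ring A] {f : Fin N → A}
    (hf : ∀ i j, Commute (f i) (f j)) {i : Fin N} {T : Finset (Fin N)} (hi : i ∉ T) :
    sortedProd f (insert i T) = f i * sortedProd f T := by
  have hp : ((insert i T).sort (· ≤ ·)).Perm (i :: T.sort (· ≤ ·)) := by
    rw [← Multiset.coe_eq_coe, ← Multiset.cons_coe]
    simp [Finset.insert_val, Multiset.ndinsert_of_notMem, hi]
  have h := (hp.map f).prod_eq' (by
    rw [List.pairwise_map]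
    exact List.pairwise_of_forall fun x y => hf x y)
  simpa [sortedProd] using h

/-- The relations between the generators `a i`, `b i` and the group elements `w σ` of the
rational Cherednik algebra of type `A` at `t = 0`, up to sign and shift of generators. -/
structure IsCherednik {N : ℕ} {A : Type*} [Ring A] (a b : Fin N → A)
    (w : Equiv.Perm (Fin N) →* A) : Prop where
  a_comm : ∀ i j, Commute (a i) (a j)
  b_comm : ∀ i j, Commute (b i) (b j)
  w_a : ∀ σ i, w σ * a i = a (σ i) * w σ
  w_b : ∀ σ i, w σ * b i = b (σ i) * w σ
  a_b_of_ne : ∀ i k, i ≠ k → a i * b k = b k * a i - w (Equiv.swap i k)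
  a_b_self : ∀ k, a k * b k = b k * a k + ∑ j ∈ Finset.univ.erase k, w (Equiv.swap k j)

namespace IsCherednik

variable {N : ℕ} {A : Type*} [Ring A] {a b : Fin N → A} {w : Equiv.Perm (Fin N) →* A}

lemma w_mul_sortedProd (h : IsCherednik a b w) (σ : Equiv.Perm (Fin N)) (T : Finset (Fin N)) :
    w σ * sortedProd a T = sortedProd a (T.map σ.toEmbedding) * w σ := by
  induction T using Finset.induction_on with
  | empty => simp [sortedProd_empty]
  | insert i T hi ih =>
    rw [Finset.map_insert, sortedProd_insert h.a_comm hi, sortedProd_insert h.a_comm (by simpa),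
      ← mul_assoc, h.w_a, mul_assoc, ih, ← mul_assoc]
    rfl

lemma w_mul_sortedProd_of_fixed (h : IsCherednik a b w) {σ : Equiv.Perm (Fin N)}
    {T : Finset (Fin N)} (hT : ∀ i ∈ T, σ i = i) :
    w σ * sortedProd a T = sortedProd a T * w σ := by
  rw [h.w_mul_sortedProd]
  congr 2
  refine Finset.eq_of_subset_of_card_le (fun x hx => ?_) (by simp)
  obtain ⟨y, hy, rfl⟩ := Finset.mem_map.1 hx
  simpa [hT y hy] using hy

lemma w_swap_mul_sortedProd_of_notMem (h : IsCherednik a b w) {i k : Fin N}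
    {T : Finset (Fin N)} (hi : i ∉ T) (hk : k ∉ T) :
    w (Equiv.swap i k) * sortedProd a T = sortedProd a T * w (Equiv.swap i k) :=
  h.w_mul_sortedProd_of_fixed fun _ hx =>
    Equiv.swap_apply_of_ne_of_ne (ne_of_mem_of_not_mem hx hi) (ne_of_mem_of_not_mem hx hk)

lemma w_swap_mul_sortedProd_of_mem (h : IsCherednik a b w) {k j : Fin N}
    {T : Finset (Fin N)} (hk : k ∉ T) (hj : j ∈ T) :
    w (Equiv.swap k j) * sortedProd a T =
      sortedProd a (insert k (T.erase j)) * w (Equiv.swap k j) := by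
  obtain ⟨S, hS, rfl⟩ : ∃ S, j ∉ S ∧ insert j S = T :=
    ⟨T.erase j, by simp, Finset.insert_erase hj⟩
  have hkS : k ∉ S := fun e => hk (Finset.mem_insert_of_mem e)
  rw [Finset.erase_insert hS, sortedProd_insert h.a_comm hS, sortedProd_insert h.a_comm hkS,
    ← mul_assoc, h.w_a, Equiv.swap_apply_right, mul_assoc,
    h.w_swap_mul_sortedProd_of_notMem hkS hS, mul_assoc]

lemma sortedProd_mul_b_of_notMem (h : IsCherednik a b w) {k : Fin N} {T : Finset (Fin N)}
    (hk : k ∉ T) :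
    sortedProd a T * b k = b k * sortedProd a T -
      ∑ i ∈ T, sortedProd a (T.erase i) * w (Equiv.swap i k) := by
  induction T using Finset.induction_on with
  | empty => simp [sortedProd_empty]
  | insert j T hj ih =>
    have hkT : k ∉ T := fun e => hk (Finset.mem_insert_of_mem e)
    have hjk : j ≠ k := fun e => hk (e ▸ Finset.mem_insert_self j T)
    have hsum : ∑ i ∈ T, sortedProd a ((insert j T).erase i) * w (Equiv.swap i k) =
        a j * ∑ i ∈ T, sortedProd a (T.erase i) * w (Equiv.swap i k) := by
      rw [Finset.mul_sum]
      refine Finset.sum_congr rfl fun i hi => ?_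
      rw [Finset.erase_insert_of_ne (ne_of_mem_of_not_mem hi hj).symm,
        sortedProd_insert h.a_comm (fun e => hj (Finset.mem_of_mem_erase e)), mul_assoc]
    rw [Finset.sum_insert hj, Finset.erase_insert hj, hsum, sortedProd_insert h.a_comm hj,
      mul_assoc, ih hkT, mul_sub, ← mul_assoc, h.a_b_of_ne j k hjk, sub_mul,
      h.w_swap_mul_sortedProd_of_notMem hj hkT, mul_assoc]
    abel

lemma sortedProd_mul_b_of_mem (h : IsCherednik a b w) {k : Fin N} {T : Finset (Fin N)}
    (hk : k ∈ T) :
    sortedProd a T * b k = b k * sortedProd a T +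
      ∑ j ∈ Tᶜ, sortedProd a (T.erase k) * w (Equiv.swap k j) := by
  obtain ⟨S, hS, rfl⟩ : ∃ S, k ∉ S ∧ insert k S = T :=
    ⟨T.erase k, by simp, Finset.insert_erase hk⟩
  have hsplit : Finset.univ.erase k = S ∪ (insert k S)ᶜ := by
    ext x
    by_cases hx : x = k
    · simp [hx, hS]
    · simp [hx, em]
  have hdisj : Disjoint S (insert k S)ᶜ :=
    Finset.disjoint_left.2 fun x hx => by simp [hx]
  have hin : ∑ j ∈ S, w (Equiv.swap k j) * sortedProd a S =
      a k * ∑ i ∈ S, sortedProd a (S.erase i) * w (Equiv.swap i k) := by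
    rw [Finset.mul_sum]
    refine Finset.sum_congr rfl fun j hj => ?_
    rw [h.w_swap_mul_sortedProd_of_mem hS hj,
      sortedProd_insert h.a_comm (fun e => hS (Finset.mem_of_mem_erase e)), mul_assoc,
      Equiv.swap_comm]
  have hout : ∑ j ∈ (insert k S)ᶜ, w (Equiv.swap k j) * sortedProd a S =
      ∑ j ∈ (insert k S)ᶜ, sortedProd a S * w (Equiv.swap k j) := by
    refine Finset.sum_congr rfl fun j hj => ?_
    exact h.w_swap_mul_sortedProd_of_notMem hS
      (fun e => Finset.mem_compl.1 hj (Finset.mem_insert_of_mem e))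
  rw [Finset.erase_insert hS, sortedProd_insert h.a_comm hS, mul_assoc,
    h.sortedProd_mul_b_of_notMem hS, mul_sub, ← mul_assoc, h.a_b_self, hsplit,
    Finset.sum_union hdisj, add_mul, add_mul, Finset.sum_mul, Finset.sum_mul, hin, hout, mul_assoc]
  abel

/-- The pairs `(σ, T)` such that `σ` fixes every element of `T`. -/
def fixedPairs (N : ℕ) : Finset (Equiv.Perm (Fin N) × Finset (Fin N)) :=
  Finset.univ.filter fun q => ∀ i ∈ q.2, q.1 i = i

/-- A sum over `fixedPairs N` as an iterated sum. -/
lemma sum_fixedPairs {M : Type*} [AddCommMonoid M]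
    (f : Equiv.Perm (Fin N) × Finset (Fin N) → M) :
    ∑ q ∈ fixedPairs N, f q =
      ∑ σ : Equiv.Perm (Fin N), ∑ T ∈ (Finset.univ.filter fun i => σ i = i).powerset, f (σ, T) := by
  refine Finset.sum_finset_product' _ _ _ (f := fun σ T => f (σ, T)) fun q => ?_
  simp [fixedPairs, Finset.subset_iff]

/-- The summand of the universal central element indexed by `(σ, T)`. -/
def centralTerm (a b : Fin N → A) (w : Equiv.Perm (Fin N) →* A)
    (q : Equiv.Perm (Fin N) × Finset (Fin N)) : A :=
  ((Equiv.Perm.sign q.1 : ℤ) * (-1) ^ q.2.card) •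
    (sortedProd b q.2 * sortedProd a q.2 * w q.1)

/-- The pairs in `fixedPairs N` whose permutation moves `k`. -/
def movingPairs (k : Fin N) : Finset (Equiv.Perm (Fin N) × Finset (Fin N)) :=
  (fixedPairs N).filter fun q => q.1 k ≠ k

lemma sum_erase_of_notMem (h : IsCherednik a b w) (k : Fin N) :
    ∑ q ∈ (fixedPairs N).filter (fun q => k ∉ q.2), ∑ i ∈ q.2,
      ((Equiv.Perm.sign q.1 : ℤ) * (-1) ^ q.2.card) •
        (sortedProd b q.2 * sortedProd a (q.2.erase i) * w (Equiv.swap i (q.1 k)) * w q.1) =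
    ∑ q ∈ movingPairs k, b (q.1 k) * centralTerm a b w q := by
  rw [Finset.sum_sigma']
  refine Finset.sum_bij' (fun x _ => (Equiv.swap x.2 (x.1.1 k) * x.1.1, x.1.2.erase x.2))
    (fun q _ => ⟨(Equiv.swap (q.1 k) (q.1 (q.1 k)) * q.1, insert (q.1 k) q.2), q.1 k⟩)
    ?_ ?_ ?_ ?_ ?_
  · rintro ⟨⟨σ, T⟩, i⟩ hx
    simp only [fixedPairs, movingPairs, Finset.mem_sigma, Finset.mem_filter, Finset.mem_univ,
      true_and] at hx ⊢
    obtain ⟨⟨hT, hk⟩, hi⟩ := hx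
    refine ⟨fun j hj => ?_, ?_⟩
    · obtain ⟨hji, hj⟩ := Finset.mem_erase.1 hj
      have : j ≠ σ k := fun e => hk (by
        have := hT j hj
        rw [e] at this
        rw [← σ.injective this, ← e]; exact hj)
      simp [hT j hj, Equiv.swap_apply_of_ne_of_ne hji this]
    · simp only [Equiv.Perm.mul_apply, Equiv.swap_apply_right]
      exact fun e => hk (e ▸ hi)
  · rintro ⟨ρ, S⟩ hq
    simp only [fixedPairs, movingPairs, Finset.mem_sigma, Finset.mem_filter, Finset.mem_univ,
      true_and] at hq ⊢
    obtain ⟨hS, hk⟩ := hq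
    refine ⟨⟨fun j hj => ?_, fun hkS => ?_⟩, Finset.mem_insert_self _ _⟩
    · rcases Finset.mem_insert.1 hj with rfl | hj
      · simp
      · have h1 : j ≠ ρ k := fun e => hk (ρ.injective (e ▸ hS j hj))
        have h2 : j ≠ ρ (ρ k) := fun e => h1 (ρ.injective ((hS j hj).trans e))
        simp [hS j hj, Equiv.swap_apply_of_ne_of_ne h1 h2]
    · rcases Finset.mem_insert.1 hkS with e | e
      · exact hk e.symm
      · exact hk (hS k e)
  · rintro ⟨⟨σ, T⟩, i⟩ hx
    simp only [fixedPairs, Finset.mem_sigma, Finset.mem_filter, Finset.mem_univ,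
      true_and] at hx
    obtain ⟨⟨hT, hk⟩, hi⟩ := hx
    simp [hT i hi, Finset.insert_erase hi, ← mul_assoc]
  · rintro ⟨ρ, S⟩ hq
    simp only [fixedPairs, movingPairs, Finset.mem_filter, Finset.mem_univ, true_and] at hq
    obtain ⟨hS, hk⟩ := hq
    have h1 : ρ k ∉ S := fun e => hk (ρ.injective (hS _ e))
    simp [Finset.erase_insert h1, ← mul_assoc]
  · rintro ⟨⟨σ, T⟩, i⟩ hx
    simp only [fixedPairs, Finset.mem_sigma, Finset.mem_filter, Finset.mem_univ,
      true_and] at hx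
    obtain ⟨⟨hT, hk⟩, hi⟩ := hx
    obtain ⟨S, hS, rfl⟩ : ∃ S, i ∉ S ∧ insert i S = T :=
      ⟨T.erase i, by simp, Finset.insert_erase hi⟩
    have hne : i ≠ σ k := fun e => hk (by
      have := hT i hi
      rw [e] at this
      rw [← σ.injective this, ← e]; exact hi)
    simp only [centralTerm, Finset.erase_insert hS, Equiv.Perm.mul_apply, Equiv.swap_apply_right,
      Finset.card_insert_of_notMem hS, sortedProd_insert h.b_comm hS, map_mul,
      Equiv.Perm.sign_swap hne, mul_smul_comm, mul_assoc, Units.val_mul]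
    congr 1
    simp [pow_succ]

lemma sum_erase_of_mem (h : IsCherednik a b w) (k : Fin N) :
    ∑ q ∈ (fixedPairs N).filter (fun q => k ∈ q.2), ∑ j ∈ q.2ᶜ,
      ((Equiv.Perm.sign q.1 : ℤ) * (-1) ^ q.2.card) •
        (sortedProd b q.2 * sortedProd a (q.2.erase k) * w (Equiv.swap k j) * w q.1) =
    ∑ q ∈ movingPairs k, b k * centralTerm a b w q := by
  rw [Finset.sum_sigma']
  refine Finset.sum_bij' (fun x _ => (Equiv.swap k x.2 * x.1.1, x.1.2.erase k))
    (fun q _ => ⟨(Equiv.swap k (q.1 k) * q.1, insert k q.2), q.1 k⟩)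
    ?_ ?_ ?_ ?_ ?_
  · rintro ⟨⟨σ, T⟩, i⟩ hx
    simp only [fixedPairs, movingPairs, Finset.mem_sigma, Finset.mem_filter, Finset.mem_univ,
      true_and, Finset.mem_compl] at hx ⊢
    obtain ⟨⟨hT, hk⟩, hi⟩ := hx
    refine ⟨fun j hj => ?_, ?_⟩
    · obtain ⟨hjk, hj⟩ := Finset.mem_erase.1 hj
      simp [hT j hj, Equiv.swap_apply_of_ne_of_ne hjk (ne_of_mem_of_not_mem hj hi)]
    · simp only [Equiv.Perm.mul_apply, hT k hk, Equiv.swap_apply_left]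
      exact fun e => hi (e ▸ hk)
  · rintro ⟨ρ, S⟩ hq
    simp only [fixedPairs, movingPairs, Finset.mem_sigma, Finset.mem_filter, Finset.mem_univ,
      true_and, Finset.mem_compl, Finset.mem_insert] at hq ⊢
    obtain ⟨hS, hk⟩ := hq
    have h1 : ρ k ∉ S := fun e => hk (ρ.injective (hS _ e))
    refine ⟨⟨fun j hj => ?_, by simp⟩, by simp [hk, h1]⟩
    rcases hj with rfl | hj
    · simp
    · have h2 : j ≠ k := fun e => hk (e ▸ hS j hj)
      simp [hS j hj, Equiv.swap_apply_of_ne_of_ne h2 (ne_of_mem_of_not_mem hj h1)]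
  · rintro ⟨⟨σ, T⟩, i⟩ hx
    simp only [fixedPairs, Finset.mem_sigma, Finset.mem_filter, Finset.mem_univ,
      true_and] at hx
    obtain ⟨⟨hT, hk⟩, hi⟩ := hx
    simp [hT k hk, Finset.insert_erase hk, ← mul_assoc]
  · rintro ⟨ρ, S⟩ hq
    simp only [fixedPairs, movingPairs, Finset.mem_filter, Finset.mem_univ, true_and] at hq
    obtain ⟨hS, hk⟩ := hq
    have h1 : k ∉ S := fun e => hk (hS _ e)
    simp [Finset.erase_insert h1, ← mul_assoc]
  · rintro ⟨⟨σ, T⟩, i⟩ hx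
    simp only [fixedPairs, Finset.mem_sigma, Finset.mem_filter, Finset.mem_univ,
      true_and, Finset.mem_compl] at hx
    obtain ⟨⟨hT, hk⟩, hi⟩ := hx
    obtain ⟨S, hS, rfl⟩ : ∃ S, k ∉ S ∧ insert k S = T :=
      ⟨T.erase k, by simp, Finset.insert_erase hk⟩
    have hne : k ≠ i := fun e => hi (e ▸ hk)
    simp only [centralTerm, Finset.erase_insert hS,
      Finset.card_insert_of_notMem hS, sortedProd_insert h.b_comm hS, map_mul,
      Equiv.Perm.sign_swap hne, mul_smul_comm, mul_assoc, Units.val_mul]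
    congr 1
    simp [pow_succ]

lemma commute_sortedProd_b (h : IsCherednik a b w) (k : Fin N) (T : Finset (Fin N)) :
    Commute (b k) (sortedProd b T) :=
  Commute.list_prod_right _ _ fun x hx => by
    obtain ⟨i, -, rfl⟩ := List.mem_map.1 hx
    exact h.b_comm k i

/-- The universal central element commutes with the generators `b k`. -/
theorem commute_sum_centralTerm (h : IsCherednik a b w) (k : Fin N) :
    Commute (∑ q ∈ fixedPairs N, centralTerm a b w q) (b k) := by
  have key : ∀ q ∈ fixedPairs N, centralTerm a b w q * b k =
      b (q.1 k) * centralTerm a b w q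
      - (if k ∉ q.2 then ∑ i ∈ q.2, ((Equiv.Perm.sign q.1 : ℤ) * (-1) ^ q.2.card) •
        (sortedProd b q.2 * sortedProd a (q.2.erase i) * w (Equiv.swap i (q.1 k)) * w q.1) else 0)
      + (if k ∈ q.2 then ∑ j ∈ q.2ᶜ, ((Equiv.Perm.sign q.1 : ℤ) * (-1) ^ q.2.card) •
        (sortedProd b q.2 * sortedProd a (q.2.erase k) * w (Equiv.swap k j) * w q.1) else 0) := by
    rintro ⟨σ, T⟩ hq
    simp only [fixedPairs, Finset.mem_filter, Finset.mem_univ, true_and] at hq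
    have hb := (h.commute_sortedProd_b (σ k) T).eq
    by_cases hk : k ∈ T
    · simp only [hk, not_true_eq_false, if_true, if_false, sub_zero, centralTerm]
      rw [smul_mul_assoc, mul_smul_comm, ← Finset.smul_sum, ← smul_add]
      congr 1
      rw [mul_assoc, h.w_b, ← mul_assoc, hq k hk, mul_assoc (sortedProd b T),
        h.sortedProd_mul_b_of_mem hk, mul_add, ← mul_assoc, ← (h.commute_sortedProd_b k T).eq,
        add_mul, Finset.mul_sum, Finset.sum_mul]
      simp only [mul_assoc]
    · have hk' : σ k ∉ T := fun e => hk (σ.injective (hq _ e) ▸ e)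
      simp only [hk, not_false_eq_true, if_true, if_false, add_zero, centralTerm]
      rw [smul_mul_assoc, mul_smul_comm, ← Finset.smul_sum, ← smul_sub]
      congr 1
      rw [mul_assoc, h.w_b, ← mul_assoc, mul_assoc (sortedProd b T),
        h.sortedProd_mul_b_of_notMem hk', mul_sub, ← mul_assoc, ← hb,
        sub_mul, Finset.mul_sum, Finset.sum_mul]
      simp only [mul_assoc]
  have hmove : ∑ q ∈ fixedPairs N, (b (q.1 k) - b k) * centralTerm a b w q =
      ∑ q ∈ movingPairs k, (b (q.1 k) - b k) * centralTerm a b w q := by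
    rw [movingPairs, Finset.sum_filter]
    refine Finset.sum_congr rfl fun q _ => ?_
    by_cases hq : q.1 k = k <;> simp [hq]
  rw [Commute, SemiconjBy, Finset.sum_mul, Finset.sum_congr rfl key, Finset.sum_add_distrib,
    Finset.sum_sub_distrib, ← Finset.sum_filter, ← Finset.sum_filter, h.sum_erase_of_notMem,
    h.sum_erase_of_mem, Finset.mul_sum]
  simp only [sub_mul, Finset.sum_sub_distrib] at hmove
  rw [sub_add, ← hmove]
  abel

end IsCherednik
section Operators

variable {N : ℕ}

lemma mulP_apply (p q : Rzl N) : mulP N p q = p * q := rfl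

lemma mulP_mul (p q : Rzl N) : mulP N (p * q) = mulP N p * mulP N q := by
  refine LinearMap.ext fun r => ?_
  simp [mulP_apply, mul_assoc]

lemma commute_mulP (p q : Rzl N) : Commute (mulP N p) (mulP N q) := by
  rw [Commute, SemiconjBy, ← mulP_mul, ← mulP_mul, mul_comm]

lemma mulP_one : mulP N 1 = 1 :=
  LinearMap.ext fun p => one_mul p

lemma permHat_apply (σ : Equiv.Perm (Fin N)) (p : Rzl N) :
    permHat N σ p = rename (Sum.map σ σ) p := rfl

lemma sZ_apply (i j : Fin N) (p : Rzl N) :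
    sZ N i j p = rename (Sum.map (Equiv.swap i j) id) p := rfl

lemma sL_apply (i j : Fin N) (p : Rzl N) :
    sL N i j p = rename (Sum.map id (Equiv.swap i j)) p := rfl

/-- `permOp` as a group homomorphism. -/
def permOpHom (N : ℕ) : Equiv.Perm (Fin N) →* Module.End ℂ (Rzl N) where
  toFun := permOp N
  map_one' := by
    refine LinearMap.ext fun p => ?_
    change rename (Sum.map id id) p = p
    simp
  map_mul' σ τ := by
    refine LinearMap.ext fun p => ?_
    change rename (Sum.map (σ * τ) (σ * τ)) p =
      rename (Sum.map σ σ) (rename (Sum.map τ τ) p)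
    rw [rename_rename, Sum.map_comp_map]
    rfl

lemma permOpHom_apply_apply (σ : Equiv.Perm (Fin N)) (p : Rzl N) :
    permOpHom N σ p = permHat N σ p := rfl

lemma permHat_sZ (σ : Equiv.Perm (Fin N)) (i j : Fin N) (p : Rzl N) :
    permHat N σ (sZ N i j p) = sZ N (σ i) (σ j) (permHat N σ p) := by
  have h : ⇑σ ∘ Equiv.swap i j = Equiv.swap (σ i) (σ j) ∘ σ :=
    congrArg DFunLike.coe (Equiv.mul_swap_eq_swap_mul σ i j)
  simp only [permHat_apply, sZ_apply, rename_rename, Sum.map_comp_map, h]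
  rfl

lemma permHat_sL (σ : Equiv.Perm (Fin N)) (i j : Fin N) (p : Rzl N) :
    permHat N σ (sL N i j p) = sL N (σ i) (σ j) (permHat N σ p) := by
  have h : ⇑σ ∘ Equiv.swap i j = Equiv.swap (σ i) (σ j) ∘ σ :=
    congrArg DFunLike.coe (Equiv.mul_swap_eq_swap_mul σ i j)
  simp only [permHat_apply, sL_apply, rename_rename, Sum.map_comp_map, h]
  rfl

lemma sZ_sL (i j : Fin N) (p : Rzl N) :
    sZ N i j (sL N i j p) = permHat N (Equiv.swap i j) p := by
  simp only [permHat_apply, sL_apply, sZ_apply, rename_rename, Sum.map_comp_map]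
  rfl

lemma sL_X (i j k : Fin N) :
    sL N i j (X (Sum.inr k)) = X (Sum.inr (Equiv.swap i j k)) := by
  simp [sL_apply]

lemma sZ_X (i j k : Fin N) : sZ N i j (X (Sum.inr k)) = X (Sum.inr k) := by
  simp [sZ_apply]

lemma X_inr_sub_ne_zero {i j : Fin N} (h : i ≠ j) :
    (X (Sum.inr i) - X (Sum.inr j) : Rzl N) ≠ 0 :=
  sub_ne_zero.2 fun e => h (Sum.inr_injective (X_injective e))

end Operators

/-- The family `D` consists of the divided differences `∂_ij` in the variables `λ`. -/
def IsDividedDiff {N : ℕ} (D : Fin N → Fin N → Rzl N → Rzl N) : Prop :=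
  ∀ i j : Fin N, i ≠ j → ∀ p : Rzl N,
    (X (Sum.inr i) - X (Sum.inr j)) * D i j p = p - sL N i j p

namespace IsDividedDiff

variable {N : ℕ} {D : Fin N → Fin N → Rzl N → Rzl N}

lemma eq_of_mul_eq (hD : IsDividedDiff D) {i j : Fin N} (hij : i ≠ j) {p q : Rzl N}
    (h : (X (Sum.inr i) - X (Sum.inr j)) * q = p - sL N i j p) : D i j p = q :=
  mul_left_cancel₀ (X_inr_sub_ne_zero hij) ((hD i j hij p).trans h.symm)

lemma X_mul_of_ne (hD : IsDividedDiff D) {i j k : Fin N} (hij : i ≠ j) (hi : k ≠ i)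
    (hj : k ≠ j) (p : Rzl N) :
    D i j (X (Sum.inr k) * p) = X (Sum.inr k) * D i j p := by
  refine hD.eq_of_mul_eq hij ?_
  rw [map_mul, sL_X, Equiv.swap_apply_of_ne_of_ne hi hj]
  linear_combination X (Sum.inr k) * hD i j hij p

lemma X_mul_left (hD : IsDividedDiff D) {i j : Fin N} (hij : i ≠ j) (p : Rzl N) :
    D i j (X (Sum.inr i) * p) = X (Sum.inr i) * D i j p + sL N i j p := by
  refine hD.eq_of_mul_eq hij ?_
  rw [map_mul, sL_X, Equiv.swap_apply_left]
  linear_combination X (Sum.inr i) * hD i j hij p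

lemma X_mul_right (hD : IsDividedDiff D) {i j : Fin N} (hij : i ≠ j) (p : Rzl N) :
    D i j (X (Sum.inr j) * p) = X (Sum.inr j) * D i j p - sL N i j p := by
  refine hD.eq_of_mul_eq hij ?_
  rw [map_mul, sL_X, Equiv.swap_apply_right]
  linear_combination X (Sum.inr j) * hD i j hij p

lemma permHat_apply (hD : IsDividedDiff D) (σ : Equiv.Perm (Fin N)) {i j : Fin N} (hij : i ≠ j)
    (p : Rzl N) : permHat N σ (D i j p) = D (σ i) (σ j) (permHat N σ p) := by
  refine (hD.eq_of_mul_eq (σ.injective.ne hij) ?_).symm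
  rw [← permHat_sL, ← map_sub, ← hD i j hij, map_mul]
  simp [_root_.permHat_apply]

lemma rename_inl (hD : IsDividedDiff D) {i j : Fin N} (hij : i ≠ j)
    (q : MvPolynomial (Fin N) ℂ) : D i j (rename Sum.inl q) = 0 := by
  refine hD.eq_of_mul_eq hij ?_
  rw [sL_apply, rename_rename, mul_zero]
  exact (sub_self _).symm

end IsDividedDiff

section Dunkl

variable {N : ℕ} {D : Fin N → Fin N → Rzl N → Rzl N} {K : Fin N → Module.End ℂ (Rzl N)}

lemma permOpHom_mul_K (hD : IsDividedDiff D)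
    (hK : ∀ i p, K i p = X (Sum.inl i) * p + ∑ j ∈ Finset.univ.erase i, sZ N i j (D i j p))
    (σ : Equiv.Perm (Fin N)) (i : Fin N) :
    permOpHom N σ * K i = K (σ i) * permOpHom N σ := by
  refine LinearMap.ext fun p => ?_
  rw [Module.End.mul_apply, Module.End.mul_apply, hK, hK, permOpHom_apply_apply,
    permOpHom_apply_apply, map_add, map_mul, map_sum]
  congr 1
  · simp [permHat_apply]
  · refine Finset.sum_bij' (fun j _ => σ j) (fun j _ => σ⁻¹ j) (by simp) ?_ (by simp) (by simp) ?_
    · intro j hj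
      refine Finset.mem_erase.2 ⟨fun e => Finset.ne_of_mem_erase hj ?_, Finset.mem_univ _⟩
      simp [← e]
    · intro j hj
      rw [permHat_sZ, hD.permHat_apply σ (Finset.ne_of_mem_erase hj).symm]

lemma permOpHom_mul_mulP_X (σ : Equiv.Perm (Fin N)) (i : Fin N) :
    permOpHom N σ * mulP N (X (Sum.inr i)) = mulP N (X (Sum.inr (σ i))) * permOpHom N σ := by
  refine LinearMap.ext fun p => ?_
  simp [mulP_apply, permOpHom_apply_apply, permHat_apply]

lemma K_mul_mulP_X_of_ne (hD : IsDividedDiff D)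
    (hK : ∀ i p, K i p = X (Sum.inl i) * p + ∑ j ∈ Finset.univ.erase i, sZ N i j (D i j p))
    (i k : Fin N) (hik : i ≠ k) :
    K i * mulP N (X (Sum.inr k)) = mulP N (X (Sum.inr k)) * K i - permOpHom N (Equiv.swap i k) := by
  refine LinearMap.ext fun p => ?_
  have hk : k ∈ Finset.univ.erase i := by simp [hik.symm]
  have hrest : ∑ j ∈ (Finset.univ.erase i).erase k, sZ N i j (D i j (X (Sum.inr k) * p)) =
      X (Sum.inr k) * ∑ j ∈ (Finset.univ.erase i).erase k, sZ N i j (D i j p) := by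
    rw [Finset.mul_sum]
    refine Finset.sum_congr rfl fun j hj => ?_
    simp only [Finset.mem_erase, Finset.mem_univ, and_true] at hj
    rw [hD.X_mul_of_ne hj.2.symm hik.symm hj.1.symm, map_mul, sZ_X]
  rw [Module.End.mul_apply, LinearMap.sub_apply, Module.End.mul_apply, mulP_apply, mulP_apply, hK,
    hK, permOpHom_apply_apply, ← Finset.add_sum_erase _ _ hk, ← Finset.add_sum_erase _ _ hk, hrest,
    hD.X_mul_right hik, map_sub, map_mul, sZ_X, sZ_sL]
  ring

lemma K_mul_mulP_X_self (hD : IsDividedDiff D)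
    (hK : ∀ i p, K i p = X (Sum.inl i) * p + ∑ j ∈ Finset.univ.erase i, sZ N i j (D i j p))
    (k : Fin N) :
    K k * mulP N (X (Sum.inr k)) = mulP N (X (Sum.inr k)) * K k +
      ∑ j ∈ Finset.univ.erase k, permOpHom N (Equiv.swap k j) := by
  refine LinearMap.ext fun p => ?_
  have hsum : ∑ j ∈ Finset.univ.erase k, sZ N k j (D k j (X (Sum.inr k) * p)) =
      X (Sum.inr k) * ∑ j ∈ Finset.univ.erase k, sZ N k j (D k j p) +
        ∑ j ∈ Finset.univ.erase k, permHat N (Equiv.swap k j) p := by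
    rw [Finset.mul_sum, ← Finset.sum_add_distrib]
    refine Finset.sum_congr rfl fun j hj => ?_
    rw [hD.X_mul_left (Finset.ne_of_mem_erase hj).symm, map_add, map_mul, sZ_X, sZ_sL]
  rw [Module.End.mul_apply, LinearMap.add_apply, Module.End.mul_apply, mulP_apply, mulP_apply, hK,
    hK, LinearMap.sum_apply, hsum]
  simp only [permOpHom_apply_apply]
  ring

lemma K_rename_inl (hD : IsDividedDiff D)
    (hK : ∀ i p, K i p = X (Sum.inl i) * p + ∑ j ∈ Finset.univ.erase i, sZ N i j (D i j p))
    (i : Fin N) (q : MvPolynomial (Fin N) ℂ) :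
    K i (rename Sum.inl q) = rename Sum.inl (X i * q) := by
  rw [hK, Finset.sum_eq_zero, add_zero, map_mul, rename_X]
  intro j hj
  rw [hD.rename_inl (Finset.ne_of_mem_erase hj).symm, map_zero]

/-- An operator commuting with multiplication by all `λ_m` and vanishing on `ℂ[z]` is zero. -/
lemma eq_zero_of_commute_of_rename_inl {Z : Module.End ℂ (Rzl N)}
    (hZ : ∀ m, Commute Z (mulP N (X (Sum.inr m))))
    (h0 : ∀ q : MvPolynomial (Fin N) ℂ, Z (rename Sum.inl q) = 0) : Z = 0 := by
  have key : ∀ (p : Rzl N) (q : MvPolynomial (Fin N) ℂ), Z (p * rename Sum.inl q) = 0 := by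
    intro p
    induction p using MvPolynomial.induction_on with
    | C c => intro q; rw [← smul_eq_C_mul, map_smul, h0, smul_zero]
    | add p₁ p₂ h₁ h₂ => intro q; rw [add_mul, map_add, h₁, h₂, add_zero]
    | mul_X p n hp =>
      intro q
      rcases n with n | n
      · have := hp (X n * q)
        rwa [map_mul (rename _), rename_X, ← mul_assoc] at this
      · have := LinearMap.congr_fun (hZ n).eq (p * rename Sum.inl q)
        rw [Module.End.mul_apply, Module.End.mul_apply, hp, map_zero, mulP_apply] at this
        rwa [mul_comm p, mul_assoc]
  refine LinearMap.ext fun p => ?_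
  simpa using key p 1

lemma commute_K (hD : IsDividedDiff D)
    (hK : ∀ i p, K i p = X (Sum.inl i) * p + ∑ j ∈ Finset.univ.erase i, sZ N i j (D i j p))
    (i j : Fin N) : Commute (K i) (K j) := by
  rcases eq_or_ne i j with rfl | hij
  · exact Commute.refl _
  have hne := K_mul_mulP_X_of_ne hD hK
  have hself := K_mul_mulP_X_self hD hK
  have hw := permOpHom_mul_K hD hK
  have hmid : ∀ i j : Fin N, i ≠ j → K j * ∑ l ∈ Finset.univ.erase i, permOpHom N (Equiv.swap i l) =
      (∑ l ∈ Finset.univ.erase i, permOpHom N (Equiv.swap i l)) * K j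
        + (K j - K i) * permOpHom N (Equiv.swap i j) := by
    intro i j hij
    have hj : j ∈ Finset.univ.erase i := by simp [hij.symm]
    have hrest : K j * ∑ l ∈ (Finset.univ.erase i).erase j, permOpHom N (Equiv.swap i l) =
        (∑ l ∈ (Finset.univ.erase i).erase j, permOpHom N (Equiv.swap i l)) * K j := by
      rw [Finset.mul_sum, Finset.sum_mul]
      refine Finset.sum_congr rfl fun l hl => ?_
      simp only [Finset.mem_erase, Finset.mem_univ, and_true] at hl
      rw [hw, Equiv.swap_apply_of_ne_of_ne hij.symm hl.1.symm]
    rw [← Finset.add_sum_erase _ _ hj, mul_add, add_mul, hrest, hw, Equiv.swap_apply_right,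
      sub_mul]
    abel
  have hdiag : ∀ i j : Fin N, i ≠ j →
      Commute (K i * K j - K j * K i) (mulP N (X (Sum.inr i))) := by
    intro i j hij
    have e₁ := hself i
    have e₂ := hne j i hij.symm
    have e₃ := hmid i j hij
    have e₄ := hw (Equiv.swap i j) i
    rw [Equiv.swap_apply_left] at e₄
    rw [Equiv.swap_comm] at e₂
    generalize ∑ l ∈ Finset.univ.erase i, permOpHom N (Equiv.swap i l) = S at *
    generalize mulP N (X (Sum.inr i)) = x at *
    generalize permOpHom N (Equiv.swap i j) = s at *
    have c₁ : K i * K j * x = x * K i * K j + S * K j - K i * s := by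
      rw [mul_assoc, e₂, mul_sub, ← mul_assoc, e₁, add_mul]
    have c₂ : K j * K i * x = x * K j * K i - s * K i + (S * K j + (K j - K i) * s) := by
      rw [mul_assoc, e₁, mul_add, ← mul_assoc, e₂, sub_mul, e₃]
    rw [Commute, SemiconjBy, sub_mul, c₁, c₂, e₄]
    simp only [sub_mul, mul_sub, mul_assoc]
    abel
  refine sub_eq_zero.1 (eq_zero_of_commute_of_rename_inl (fun m => ?_) fun q => ?_)
  · rcases eq_or_ne m i with rfl | hi
    · exact hdiag m j hij
    rcases eq_or_ne m j with rfl | hj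
    · rw [← neg_sub]
      exact (hdiag m i hij.symm).neg_left
    have e₁ := hne i m hi.symm
    have e₂ := hne j m hj.symm
    have e₃ := hw (Equiv.swap i m) j
    have e₄ := hw (Equiv.swap j m) i
    rw [Equiv.swap_apply_of_ne_of_ne hij.symm hj.symm] at e₃
    rw [Equiv.swap_apply_of_ne_of_ne hij hi.symm] at e₄
    rw [Commute, SemiconjBy, sub_mul, mul_assoc, e₂, mul_sub, ← mul_assoc, e₁, sub_mul, e₃,
      mul_assoc (K j), e₁, mul_sub, ← mul_assoc (K j), e₂, sub_mul, e₄]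
    simp only [mul_sub, mul_assoc]
    abel
  · simp only [LinearMap.sub_apply, Module.End.mul_apply, K_rename_inl hD hK]
    rw [mul_left_comm, sub_self]

lemma isCherednik_K (hD : IsDividedDiff D)
    (hK : ∀ i p, K i p = X (Sum.inl i) * p + ∑ j ∈ Finset.univ.erase i, sZ N i j (D i j p)) :
    IsCherednik K (fun i => mulP N (X (Sum.inr i))) (permOpHom N) where
  a_comm := commute_K hD hK
  b_comm _ _ := commute_mulP _ _
  w_a := permOpHom_mul_K hD hK
  w_b := permOpHom_mul_mulP_X
  a_b_of_ne := K_mul_mulP_X_of_ne hD hK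
  a_b_self := K_mul_mulP_X_self hD hK

end Dunkl

lemma IsCherednik.shift {N : ℕ} {A : Type*} [Ring A] [Algebra ℂ A] {a b : Fin N → A}
    {w : Equiv.Perm (Fin N) →* A} (h : IsCherednik a b w) (u v : ℂ) :
    IsCherednik (fun i => u • (1 : A) - a i) (fun i => v • (1 : A) - b i) w where
  a_comm i j := by
    have := (h.a_comm i j).eq
    simp only [Commute, SemiconjBy, sub_mul, mul_sub, smul_mul_assoc, mul_smul_comm, one_mul,
      mul_one, this, smul_sub]
    abel
  b_comm i j := by
    have := (h.b_comm i j).eq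
    simp only [Commute, SemiconjBy, sub_mul, mul_sub, smul_mul_assoc, mul_smul_comm, one_mul,
      mul_one, this, smul_sub]
    abel
  w_a σ i := by
    simp only [sub_mul, mul_sub, smul_mul_assoc, mul_smul_comm, one_mul, mul_one, h.w_a]
  w_b σ i := by
    simp only [sub_mul, mul_sub, smul_mul_assoc, mul_smul_comm, one_mul, mul_one, h.w_b]
  a_b_of_ne i k hik := by
    simp only [sub_mul, mul_sub, smul_mul_assoc, mul_smul_comm, one_mul, mul_one,
      h.a_b_of_ne i k hik, smul_sub, smul_smul, mul_comm v u]
    abel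
  a_b_self k := by
    simp only [sub_mul, mul_sub, smul_mul_assoc, mul_smul_comm, one_mul, mul_one, h.a_b_self,
      smul_sub, smul_smul, mul_comm v u]
    abel

section Iota

variable {N : ℕ} {K : Fin N → Module.End ℂ (Rzl N)}

/-- The product `K^β` for the multi-index `β = d ∘ Sum.inl`. -/
def powK (K : Fin N → Module.End ℂ (Rzl N)) (d : Fin N ⊕ Fin N →₀ ℕ) : Module.End ℂ (Rzl N) :=
  ((List.finRange N).map fun i => K i ^ d (Sum.inl i)).prod

/-- The monomial `λ^α` for the multi-index `α = d ∘ Sum.inr`. -/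
def powL (d : Fin N ⊕ Fin N →₀ ℕ) : Rzl N :=
  ∏ i : Fin N, X (Sum.inr i) ^ d (Sum.inr i)

/-- The restriction of `iota` to the `τ`-component of `V1 N`, as a linear map. -/
def iotaComponent (K : Fin N → Module.End ℂ (Rzl N)) (τ : Equiv.Perm (Fin N)) :
    Rzl N →ₗ[ℂ] Module.End ℂ (Rzl N) :=
  (basisMonomials (Fin N ⊕ Fin N) ℂ).constr ℂ fun d => mulP N (powL d) * permOpHom N τ * powK K d

lemma iotaComponent_monomial (τ : Equiv.Perm (Fin N)) (d : Fin N ⊕ Fin N →₀ ℕ) (c : ℂ) :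
    iotaComponent K τ (monomial d c) = c • (mulP N (powL d) * permOpHom N τ * powK K d) := by
  have h : (monomial d c : Rzl N) = c • basisMonomials (Fin N ⊕ Fin N) ℂ d := by
    simp [smul_monomial]
  rw [h, map_smul, iotaComponent, Module.Basis.constr_basis]

lemma iota_eq_sum (F : V1 N) : iota K F = ∑ τ, iotaComponent K τ (F τ) := by
  refine Finset.sum_congr rfl fun τ _ => ?_
  conv_rhs => rw [(F τ).as_sum, map_sum]
  simp only [iotaComponent_monomial]
  rfl

lemma powL_single_inl_add (i : Fin N) (d : Fin N ⊕ Fin N →₀ ℕ) :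
    powL (Finsupp.single (Sum.inl i) 1 + d) = powL d := by
  simp [powL]

lemma powL_single_inr_add (i : Fin N) (d : Fin N ⊕ Fin N →₀ ℕ) :
    powL (Finsupp.single (Sum.inr i) 1 + d) = X (Sum.inr i) * powL d := by
  have h : ∀ j, (Finsupp.single (Sum.inr i : Fin N ⊕ Fin N) 1) (Sum.inr j) =
      if i = j then 1 else 0 := fun j => by
    rw [Finsupp.single_apply]
    simp
  simp only [powL, Finsupp.add_apply, pow_add, Finset.prod_mul_distrib, h, pow_ite, pow_one,
    pow_zero]
  simp

lemma powK_single_inr_add (i : Fin N) (d : Fin N ⊕ Fin N →₀ ℕ) :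
    powK K (Finsupp.single (Sum.inr i) 1 + d) = powK K d := by
  simp [powK]

lemma powK_single_inl_add (hK : ∀ i j, Commute (K i) (K j)) (i : Fin N)
    (d : Fin N ⊕ Fin N →₀ ℕ) :
    powK K (Finsupp.single (Sum.inl i) 1 + d) = powK K d * K i := by
  have h : ∀ l : List (Fin N), l.Nodup →
      (l.map fun j => K j ^ (Finsupp.single (Sum.inl i : Fin N ⊕ Fin N) 1 + d : Fin N ⊕ Fin N →₀ ℕ) (Sum.inl j)).prod =
        (l.map fun j => K j ^ d (Sum.inl j)).prod * if i ∈ l then K i else 1 := by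
    intro l hl
    induction l with
    | nil => simp
    | cons j l ih =>
      rw [List.nodup_cons] at hl
      rw [List.map_cons, List.prod_cons, List.map_cons, List.prod_cons, ih hl.2]
      rcases eq_or_ne i j with rfl | hij
      · have hc : Commute (K i) (l.map fun j => K j ^ d (Sum.inl j)).prod :=
          Commute.list_prod_right _ _ fun x hx => by
            obtain ⟨j, -, rfl⟩ := List.mem_map.1 hx
            exact (hK i j).pow_right _
        simp [hl.1, add_comm 1, pow_succ, mul_assoc, hc.eq]
      · have hs : (Finsupp.single (Sum.inl i : Fin N ⊕ Fin N) 1) (Sum.inl j) = 0 :=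
          Finsupp.single_eq_of_ne (by simpa using hij.symm)
        simp [hs, hij, mul_assoc]
  simpa [powK] using h _ (List.nodup_finRange N)

lemma iotaComponent_X_inr_mul (τ : Equiv.Perm (Fin N)) (i : Fin N) (p : Rzl N) :
    iotaComponent K τ (X (Sum.inr i) * p) = mulP N (X (Sum.inr i)) * iotaComponent K τ p := by
  induction p using MvPolynomial.induction_on' with
  | monomial d c =>
    rw [X, monomial_mul, one_mul, iotaComponent_monomial, iotaComponent_monomial,
      powL_single_inr_add, powK_single_inr_add, mulP_mul, mul_smul_comm]
    simp only [mul_assoc, X]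
  | add p q hp hq => rw [mul_add, map_add, map_add, hp, hq, mul_add]

lemma iotaComponent_X_inl_mul (hK : ∀ i j, Commute (K i) (K j)) (τ : Equiv.Perm (Fin N))
    (i : Fin N) (p : Rzl N) :
    iotaComponent K τ (X (Sum.inl i) * p) = iotaComponent K τ p * K i := by
  induction p using MvPolynomial.induction_on' with
  | monomial d c =>
    rw [X, monomial_mul, one_mul, iotaComponent_monomial, iotaComponent_monomial,
      powL_single_inl_add, powK_single_inl_add hK, smul_mul_assoc]
    simp only [mul_assoc]
  | add p q hp hq => rw [mul_add, map_add, map_add, hp, hq, add_mul]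

lemma mulP_C_sub_X (v : ℂ) (i : Fin N) :
    mulP N (C v - X (Sum.inr i)) = v • (1 : Module.End ℂ (Rzl N)) - mulP N (X (Sum.inr i)) := by
  refine LinearMap.ext fun p => ?_
  simp [mulP_apply, sub_mul, smul_eq_C_mul]

lemma mulP_prod_C_sub_X (v : ℂ) (T : Finset (Fin N)) :
    mulP N (∏ i ∈ T, (C v - X (Sum.inr i))) =
      sortedProd (fun i => v • (1 : Module.End ℂ (Rzl N)) - mulP N (X (Sum.inr i))) T := by
  have hb : ∀ i j, Commute (v • (1 : Module.End ℂ (Rzl N)) - mulP N (X (Sum.inr i)))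
      (v • (1 : Module.End ℂ (Rzl N)) - mulP N (X (Sum.inr j))) := fun i j => by
    rw [← mulP_C_sub_X, ← mulP_C_sub_X]
    exact commute_mulP _ _
  induction T using Finset.induction_on with
  | empty =>
    rw [sortedProd_empty, Finset.prod_empty, mulP_one]
  | insert i T hi ih =>
    rw [Finset.prod_insert hi, mulP_mul, ih, sortedProd_insert hb hi, mulP_C_sub_X]

/-- The Bethe algebra factors act through `iotaComponent` by left multiplication with
`v - λ_i` and right multiplication with `u - K_j`. -/
lemma iotaComponent_prod_mul (u v : ℂ)
    (ha : ∀ i j, Commute (K i) (K j))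
    (h : IsCherednik (fun i => u • (1 : Module.End ℂ (Rzl N)) - K i)
      (fun i => v • (1 : Module.End ℂ (Rzl N)) - mulP N (X (Sum.inr i))) (permOpHom N))
    (ρ π : Equiv.Perm (Fin N)) (T : Finset (Fin N)) (p : Rzl N) :
    iotaComponent K ρ ((∏ i ∈ T, ((C u - X (Sum.inl (π i))) * (C v - X (Sum.inr i)))) * p) =
      sortedProd (fun i => v • (1 : Module.End ℂ (Rzl N)) - mulP N (X (Sum.inr i))) T *
        iotaComponent K ρ p *
        sortedProd (fun i => u • (1 : Module.End ℂ (Rzl N)) - K i) (T.map π.toEmbedding) := by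
  have hz : ∀ (i : Fin N) (q : Rzl N), iotaComponent K ρ ((C u - X (Sum.inl i)) * q) =
      iotaComponent K ρ q * (u • (1 : Module.End ℂ (Rzl N)) - K i) := fun i q => by
    rw [sub_mul, map_sub, iotaComponent_X_inl_mul ha, ← smul_eq_C_mul, map_smul, mul_sub,
      mul_smul_comm, mul_one]
  have hl : ∀ (i : Fin N) (q : Rzl N), iotaComponent K ρ ((C v - X (Sum.inr i)) * q) =
      (v • (1 : Module.End ℂ (Rzl N)) - mulP N (X (Sum.inr i))) * iotaComponent K ρ q :=
    fun i q => by
    rw [sub_mul, map_sub, iotaComponent_X_inr_mul, ← smul_eq_C_mul, map_smul, sub_mul,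
      smul_mul_assoc, one_mul]
  induction T using Finset.induction_on with
  | empty => simp [sortedProd_empty]
  | insert i T hi ih =>
    have hc : Commute (u • (1 : Module.End ℂ (Rzl N)) - K (π i))
        (sortedProd (fun i => u • (1 : Module.End ℂ (Rzl N)) - K i) (T.map π.toEmbedding)) :=
      Commute.list_prod_right _ _ fun x hx => by
        obtain ⟨j, -, rfl⟩ := List.mem_map.1 hx
        exact h.a_comm _ _
    rw [Finset.prod_insert hi, mul_assoc, mul_assoc, hz, hl, ih, sortedProd_insert h.b_comm hi,
      Finset.map_insert, sortedProd_insert h.a_comm (by simpa), Equiv.coe_toEmbedding, hc.eq]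
    simp only [mul_assoc]

lemma Puv_eq (u v : ℂ) :
    Puv K u v = ((-1 : ℤ) ^ N) • ∑ q ∈ IsCherednik.fixedPairs N, IsCherednik.centralTerm
      (fun i => u • (1 : Module.End ℂ (Rzl N)) - K i)
      (fun i => v • (1 : Module.End ℂ (Rzl N)) - mulP N (X (Sum.inr i))) (permOpHom N) q := by
  rw [Puv, IsCherednik.sum_fixedPairs]
  congr 1
  refine Finset.sum_congr rfl fun σ _ => ?_
  rw [Finset.sum_mul, Finset.smul_sum]
  refine Finset.sum_congr rfl fun T _ => ?_
  rw [IsCherednik.centralTerm, mulP_prod_C_sub_X, smul_mul_assoc, smul_smul]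
  rfl

/-- The universal central element commutes with multiplication by monomials in `λ`. -/
lemma commute_Puv_mulP_powL
    (h : ∀ u v : ℂ, IsCherednik (fun i => u • (1 : Module.End ℂ (Rzl N)) - K i)
      (fun i => v • (1 : Module.End ℂ (Rzl N)) - mulP N (X (Sum.inr i))) (permOpHom N))
    (u v : ℂ) (d : Fin N ⊕ Fin N →₀ ℕ) : Commute (Puv K u v) (mulP N (powL d)) := by
  have hX : ∀ i, Commute (Puv K u v) (mulP N (X (Sum.inr i))) := fun i => by
    have h₁ := ((h u v).commute_sum_centralTerm i).smul_left ((-1 : ℤ) ^ N)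
    rw [← Puv_eq] at h₁
    have h₂ := ((Commute.one_right (Puv K u v)).smul_right v).sub_right h₁
    rwa [sub_sub_cancel] at h₂
  refine Finset.prod_induction _ (fun p => Commute (Puv K u v) (mulP N p))
    (fun p q hp hq => by rw [mulP_mul]; exact hp.mul_right hq)
    (by rw [mulP_one]; exact Commute.one_right _) fun i _ => ?_
  induction d (Sum.inr i) with
  | zero => rw [pow_zero, mulP_one]; exact Commute.one_right _
  | succ n ih => rw [pow_succ, mulP_mul]; exact ih.mul_right (hX i)

lemma sum_iotaComponent_eq
    (ha : ∀ i j, Commute (K i) (K j))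
    (h : ∀ u v : ℂ, IsCherednik (fun i => u • (1 : Module.End ℂ (Rzl N)) - K i)
      (fun i => v • (1 : Module.End ℂ (Rzl N)) - mulP N (X (Sum.inr i))) (permOpHom N))
    (u v : ℂ) (τ : Equiv.Perm (Fin N)) (p : Rzl N) :
    ((-1 : ℤ) ^ N) • ∑ σ : Equiv.Perm (Fin N), (Equiv.Perm.sign σ : ℤ) •
      iotaComponent K (σ * τ) ((∏ i ∈ Finset.univ.filter (fun i => σ i = i),
        (1 - ((C u : Rzl N) - X (Sum.inl (τ⁻¹ i))) * ((C v : Rzl N) - X (Sum.inr i)))) * p) =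
    Puv K u v * iotaComponent K τ p := by
  induction p using MvPolynomial.induction_on' with
  | add p q hp hq =>
    rw [map_add, mul_add, ← hp, ← hq, ← smul_add, ← Finset.sum_add_distrib]
    simp only [mul_add, map_add, smul_add]
  | monomial d c =>
    have hcomm := (commute_Puv_mulP_powL h u v d).eq
    rw [iotaComponent_monomial, mul_smul_comm, mul_assoc (mulP N (powL d)), ← mul_assoc (Puv K u v),
      hcomm, Puv_eq, IsCherednik.sum_fixedPairs, mul_smul_comm, smul_mul_assoc, smul_comm c]
    congr 1
    rw [Finset.mul_sum, Finset.sum_mul, Finset.smul_sum]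
    refine Finset.sum_congr rfl fun σ _ => ?_
    simp only [sub_eq_add_neg (1 : Rzl N)]
    rw [Finset.prod_one_add, Finset.sum_mul, map_sum, Finset.mul_sum, Finset.sum_mul,
      Finset.smul_sum, Finset.smul_sum]
    refine Finset.sum_congr rfl fun T hT => ?_
    have hfix : ∀ i ∈ T, σ i = i := fun i hi => by
      simpa using Finset.mem_powerset.1 hT hi
    have hneg : (∏ i ∈ T, -(((C u : Rzl N) - X (Sum.inl (τ⁻¹ i))) *
        ((C v : Rzl N) - X (Sum.inr i)))) * monomial d c =
        ((-1 : ℤ) ^ T.card) • ((∏ i ∈ T, (((C u : Rzl N) - X (Sum.inl (τ⁻¹ i))) *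
        ((C v : Rzl N) - X (Sum.inr i)))) * monomial d c) := by
      rw [Finset.prod_neg, zsmul_eq_mul]
      push_cast
      ring
    have hpow : Commute (powK K d) (sortedProd (fun i => u • (1 : Module.End ℂ (Rzl N)) - K i)
        (T.map (τ⁻¹ : Equiv.Perm (Fin N)).toEmbedding)) := by
      refine Commute.list_prod_left _ _ fun x hx => Commute.list_prod_right _ _ fun y hy => ?_
      obtain ⟨i, -, rfl⟩ := List.mem_map.1 hx
      obtain ⟨j, -, rfl⟩ := List.mem_map.1 hy
      exact (((Commute.one_right (K i)).smul_right u).sub_right (ha i j)).pow_left _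
    have hτ : permOpHom N τ * sortedProd (fun i => u • (1 : Module.End ℂ (Rzl N)) - K i)
        (T.map (τ⁻¹ : Equiv.Perm (Fin N)).toEmbedding) =
        sortedProd (fun i => u • (1 : Module.End ℂ (Rzl N)) - K i) T * permOpHom N τ := by
      rw [(h u v).w_mul_sortedProd, Finset.map_map]
      congr 2
      ext x
      simp
    have hσ := (h u v).w_mul_sortedProd_of_fixed hfix
    have hbL : Commute (mulP N (powL d))
        (sortedProd (fun i => v • (1 : Module.End ℂ (Rzl N)) - mulP N (X (Sum.inr i))) T) := by
      rw [← mulP_prod_C_sub_X]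
      exact commute_mulP _ _
    rw [hneg, map_zsmul, iotaComponent_prod_mul u v ha (h u v), iotaComponent_monomial, smul_smul,
      IsCherednik.centralTerm, mul_smul_comm, smul_mul_assoc, mul_smul_comm, smul_mul_assoc,
      smul_comm c]
    congr 2
    simp only [mul_assoc, map_mul]
    rw [hpow.eq, ← mul_assoc (permOpHom N τ), hτ, mul_assoc, ← mul_assoc (permOpHom N σ), hσ]
    simp only [mul_assoc]
    rw [hbL.left_comm]

lemma PB_apply (u v : ℂ) (F : V1 N) (ρ : Equiv.Perm (Fin N)) :
    PB N u v F ρ = ((-1 : ℤ) ^ N) • ∑ σ : Equiv.Perm (Fin N), (Equiv.Perm.sign σ : ℤ) •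
      ((∏ i ∈ Finset.univ.filter (fun i => σ i = i),
        (1 - ((C u : Rzl N) - X (Sum.inl ((σ⁻¹ * ρ)⁻¹ i))) * ((C v : Rzl N) - X (Sum.inr i)))) *
        F (σ⁻¹ * ρ)) := by
  rw [PB, LinearMap.smul_apply, Pi.smul_apply, LinearMap.sum_apply, Finset.sum_apply]
  rfl

lemma iota_PB (u v : ℂ) (F : V1 N) :
    iota K (PB N u v F) = ∑ τ, ((-1 : ℤ) ^ N) • ∑ σ : Equiv.Perm (Fin N),
      (Equiv.Perm.sign σ : ℤ) • iotaComponent K (σ * τ)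
        ((∏ i ∈ Finset.univ.filter (fun i => σ i = i),
          (1 - ((C u : Rzl N) - X (Sum.inl (τ⁻¹ i))) * ((C v : Rzl N) - X (Sum.inr i)))) *
          F τ) := by
  simp only [iota_eq_sum, PB_apply, map_zsmul, map_sum, ← Finset.smul_sum]
  refine congrArg _ ?_
  rw [Finset.sum_comm]
  conv_rhs => rw [Finset.sum_comm]
  refine Finset.sum_congr rfl fun σ _ => ?_
  rw [← Equiv.sum_comp (Equiv.mulLeft σ)]
  simp only [Equiv.coe_mulLeft, inv_mul_cancel_left]

end Iota

set_option synthInstance.maxHeartbeats 1000000 in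
/-- Under the identification `ι : V_1 ≅ H_N`, the action of the universal Bethe
polynomial corresponds to left multiplication by the universal central polynomial:
`ι(P^B(u,v) F) = P(u,v) ∘ ι(F)`. -/
theorem stmt8 (N : ℕ) (hN : 0 < N)
    (D : Fin N → Fin N → Rzl N → Rzl N)
    (hD : ∀ i j : Fin N, i ≠ j → ∀ p : Rzl N,
      (X (Sum.inr i) - X (Sum.inr j)) * D i j p = p - sL N i j p)
    (K : Fin N → Module.End ℂ (Rzl N))
    (hK : ∀ (i : Fin N) (p : Rzl N),
      K i p = X (Sum.inl i) * p + ∑ j ∈ Finset.univ.erase i, sZ N i j (D i j p)) :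
    ∀ (u v : ℂ) (F : V1 N), iota K (PB N u v F) = Puv K u v * iota K F := by
  intro u v F
  have hC := isCherednik_K hD hK
  rw [iota_PB, iota_eq_sum, Finset.mul_sum]
  exact Finset.sum_congr rfl fun τ _ => sum_iotaComponent_eq hC.a_comm hC.shift u v τ (F τ)
end
end

section
/- For every invariant polynomial function f on pairs of N×N complex matrices, the restriction of f to X_N lies in the C-subalgebra of the algebra of C-valued functions on X_N generated by the restrictions of the trace functions t_{a,b} : (Z,Λ) ↦ tr(Λ^a Z^b), a, b ∈ Z_{≥0}. In other words, every invariant polynomial function agrees on X_N with a polynomial expression in finitely many of the functions t_{a,b}. -/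
noncomputable section

abbrev Mat (N : ℕ) := Matrix (Fin N) (Fin N) ℂ

/-- `X_N = {(Z,Λ) : rank (1 + ZΛ − ΛZ) = 1}`; the Calogero–Moser space `C_N` is its
quotient by simultaneous conjugation. -/
def XN (N : ℕ) : Set (Mat N × Mat N) :=
  {p | (1 + p.1 * p.2 - p.2 * p.1).rank = 1}

/-- `f` is an invariant polynomial function on pairs of `N×N` matrices: it is
polynomial in the `2N²` matrix entries and invariant under simultaneous conjugation. -/
def IsInvPoly (N : ℕ) (f : Mat N × Mat N → ℂ) : Prop :=
  (∃ q : MvPolynomial ((Fin N × Fin N) ⊕ (Fin N × Fin N)) ℂ,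
      ∀ Z Λ : Mat N, f (Z, Λ) =
        MvPolynomial.eval (Sum.elim (fun ij => Z ij.1 ij.2) (fun ij => Λ ij.1 ij.2)) q) ∧
  ∀ (g : (Mat N)ˣ) (Z Λ : Mat N),
    f ((g : Mat N) * Z * ((g⁻¹ : (Mat N)ˣ) : Mat N),
       (g : Mat N) * Λ * ((g⁻¹ : (Mat N)ˣ) : Mat N)) = f (Z, Λ)

theorem sum_single_comp_perm {ι κ : Type*} [Fintype κ] (i : κ → ι) (σ : Equiv.Perm κ) :
    ∑ k, Finsupp.single (i (σ k)) 1 = ∑ k, Finsupp.single (i k) 1 :=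
  Equiv.sum_comp σ fun k => Finsupp.single (i k) (1 : ℕ)

theorem exists_perm_of_sum_single_eq {ι κ : Type*} [Fintype κ] {i j : κ → ι}
    (h : ∑ k, Finsupp.single (i k) 1 = ∑ k, Finsupp.single (j k) (1 : ℕ)) :
    ∃ σ : Equiv.Perm κ, i = j ∘ σ := by
  classical
  have e : ∀ c, Nonempty ({k // i k = c} ≃ {k // j k = c}) := fun c => by
    refine ⟨Fintype.equivOfCardEq ?_⟩
    have := DFunLike.congr_fun h c
    simpa [Finsupp.finsetSum_apply, Finsupp.single_apply, Fintype.card_subtype] using this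
  exact ⟨Equiv.ofFiberEquiv fun c => (e c).some,
    funext fun k => (Equiv.ofFiberEquiv_map _ k).symm⟩

theorem eval_monomial_sum_single {ι κ : Type*} [Fintype κ] (i : κ → ι) (x : ι → ℂ) (r : ℂ) :
    MvPolynomial.eval x (MvPolynomial.monomial (∑ k, Finsupp.single (i k) 1) r) =
      r * ∏ k, x (i k) := by
  rw [MvPolynomial.eval_monomial]
  congr 1
  rw [← Finsupp.prod_finsetSum_index (by simp) (by intros; rw [pow_add])]
  simp

/-- If `∑ i, L i * ∏ k, x (i k)` vanishes for all `x`, then `L` is orthogonal to all symmetric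
tensors: these are spanned by the pure powers. -/
theorem sum_mul_symm_eq_zero {ι κ : Type*} [Fintype ι] [Fintype κ] [DecidableEq κ]
    {L S : (κ → ι) → ℂ} (hS : ∀ (σ : Equiv.Perm κ) i, S (i ∘ σ) = S i)
    (hL : ∀ x : ι → ℂ, ∑ i, L i * ∏ k, x (i k) = 0) : ∑ i, L i * S i = 0 := by
  classical
  let m : (κ → ι) → ι →₀ ℕ := fun i => ∑ k, Finsupp.single (i k) 1
  have hp : ∑ i, MvPolynomial.monomial (m i) (L i) = 0 := by
    refine MvPolynomial.funext fun x => ?_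
    simpa [m, eval_monomial_sum_single] using hL x
  rw [← Finset.sum_fiberwise_of_maps_to (s := Finset.univ) (t := Finset.univ.image m) (g := m)
    (fun i _ => Finset.mem_image_of_mem _ (Finset.mem_univ i))]
  refine Finset.sum_eq_zero fun μ hμ => ?_
  obtain ⟨j, -, rfl⟩ := Finset.mem_image.1 hμ
  have hc := congr_arg (MvPolynomial.coeff (m j)) hp
  simp only [MvPolynomial.coeff_sum, MvPolynomial.coeff_monomial, MvPolynomial.coeff_zero,
    ← Finset.sum_filter] at hc
  calc _ = ∑ i with m i = m j, L i * S j := Finset.sum_congr rfl fun i hi => by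
          obtain ⟨σ, rfl⟩ := exists_perm_of_sum_single_eq (Finset.mem_filter.1 hi).2
          rw [hS]
    _ = 0 := by rw [← Finset.sum_mul, hc, zero_mul]

theorem symm_eq_zero {ι κ : Type*} [Fintype ι] [Fintype κ] [DecidableEq κ]
    {S : (κ → ι) → ℂ} (hS : ∀ (σ : Equiv.Perm κ) i, S (i ∘ σ) = S i)
    (hL : ∀ x : ι → ℂ, ∑ i, S i * ∏ k, x (i k) = 0) (i : κ → ι) : S i = 0 := by
  have h := sum_mul_symm_eq_zero (S := fun i => star (S i)) (fun σ i => by rw [hS]) hL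
  simp only [Complex.star_def, Complex.mul_conj, ← Complex.ofReal_sum, Complex.ofReal_eq_zero] at h
  rw [Finset.sum_eq_zero_iff_of_nonneg fun i _ => Complex.normSq_nonneg _] at h
  simpa using h i (Finset.mem_univ i)

theorem exists_symm_of_isHomogeneous {ι : Type*} [Fintype ι] {d : ℕ} {q : MvPolynomial ι ℂ}
    (hq : q.IsHomogeneous d) : ∃ S : (Fin d → ι) → ℂ,
      (∀ (σ : Equiv.Perm (Fin d)) i, S (i ∘ σ) = S i) ∧
      ∀ x, MvPolynomial.eval x q = ∑ i, S i * ∏ k, x (i k) := by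
  classical
  let m : (Fin d → ι) → ι →₀ ℕ := fun i => ∑ k, Finsupp.single (i k) 1
  have hm : ∀ (σ : Equiv.Perm (Fin d)) i, m (i ∘ σ) = m i := fun σ i =>
    sum_single_comp_perm i σ
  refine ⟨fun i => q.coeff (m i) / (Finset.univ.filter fun j => m j = m i).card,
    fun σ i => by simp only [hm], fun x => ?_⟩
  have h1 : ∀ i : Fin d → ι, ∏ k, x (i k) = (m i).prod fun s e => x s ^ e := fun i => by
    rw [← one_mul (∏ k, x (i k)), ← eval_monomial_sum_single, MvPolynomial.eval_monomial, one_mul]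
  have h2 : ∀ μ ∈ q.support, ∃ i, m i = μ := fun μ hμ => by
    have hd : Multiset.card (Finsupp.toMultiset μ) = d := by
      rw [Finsupp.card_toMultiset]
      have := hq (MvPolynomial.mem_support_iff.1 hμ)
      simpa [Finsupp.weight_apply, Finsupp.sum] using this
    obtain ⟨l, hl⟩ := Quot.exists_rep (Finsupp.toMultiset μ)
    have hl' : l.length = d := by rw [← hd, ← hl]; rfl
    subst hl'
    refine ⟨l.get, Multiset.toFinsupp.symm.injective ?_⟩
    simp only [m, Multiset.toFinsupp_symm_apply, map_sum, Finsupp.toMultiset_single, one_smul, ← hl]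
    rw [Finset.sum_eq_multiset_sum, ← Multiset.sum_map_singleton (Quot.mk _ l)]
    congr 1
    rw [← Function.comp_def (fun a => ({a} : Multiset ι)) l.get, ← Multiset.map_map,
      Fin.univ_val_map, List.ofFn_get]
    rfl
  rw [MvPolynomial.eval_eq]
  simp only [h1]
  rw [← Finset.sum_subset (Finset.subset_univ (Finset.univ.filter fun i => m i ∈ q.support))
    fun i _ hi => by
      have : q.coeff (m i) = 0 := by simpa using hi
      simp [this],
    ← Finset.sum_fiberwise_of_maps_to (t := q.support) (g := m) (by simp)]
  refine Finset.sum_congr rfl fun μ hμ => ?_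
  obtain ⟨j, rfl⟩ := h2 μ hμ
  rw [Finset.filter_filter, Finset.sum_congr (g := fun _ => q.coeff (m j) /
    (Finset.univ.filter fun i => m i = m j).card * (m j).prod fun s e => x s ^ e) rfl
    fun i hi => by rw [(Finset.mem_filter.1 hi).2.2], Finset.sum_const]
  have h3 : (Finset.univ.filter fun i => m i ∈ q.support ∧ m i = m j) =
      Finset.univ.filter fun i => m i = m j :=
    Finset.filter_congr fun i _ => ⟨fun h => h.2, fun h => ⟨h ▸ hμ, h⟩⟩
  have h4 : ((Finset.univ.filter fun i => m i = m j).card : ℂ) ≠ 0 :=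
    Nat.cast_ne_zero.2 (Finset.card_ne_zero.2 ⟨j, by simp⟩)
  rw [h3, nsmul_eq_mul, ← mul_assoc, mul_div_cancel₀ _ h4]
  rfl

/-- The Kronecker product of a family of matrices indexed by `κ`. -/
def tens {κ n R : Type*} [Fintype κ] [CommRing R] (X : κ → Matrix n n R) :
    Matrix (κ → n) (κ → n) R :=
  Matrix.of fun a b => ∏ k, X k (a k) (b k)

theorem tens_mul {κ n R : Type*} [Fintype κ] [DecidableEq κ] [Fintype n] [CommRing R]
    (X Y : κ → Matrix n n R) : tens (fun k => X k * Y k) = tens X * tens Y := by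
  ext a b
  simp only [tens, Matrix.of_apply, Matrix.mul_apply, Finset.prod_univ_sum,
    Fintype.piFinset_univ, Finset.prod_mul_distrib]

theorem tens_one {κ n R : Type*} [Fintype κ] [DecidableEq n] [CommRing R] :
    tens (fun _ : κ => (1 : Matrix n n R)) = 1 := by
  ext a b
  by_cases h : a = b
  · subst h
    simp [tens]
  · obtain ⟨k, hk⟩ := Function.ne_iff.1 h
    rw [Matrix.one_apply_ne h]
    exact Finset.prod_eq_zero (Finset.mem_univ k) (Matrix.one_apply_ne hk)

theorem tens_comp_perm {κ n R : Type*} [Fintype κ] [CommRing R] (X : Matrix n n R)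
    (σ : Equiv.Perm κ) (a b : κ → n) :
    tens (fun _ => X) (a ∘ σ) (b ∘ σ) = tens (fun _ => X) a b :=
  Equiv.prod_comp σ fun k => X (a k) (b k)

/-- The permutation representation on tensors. -/
def permRep (κ n : Type*) : Representation ℂ (Equiv.Perm κ) ((κ → n) → ℂ) where
  toFun σ := LinearMap.funLeft ℂ ℂ fun a => a ∘ σ
  map_one' := rfl
  map_mul' _ _ := rfl

theorem permRep_apply {κ n : Type*} (σ : Equiv.Perm κ) (v : (κ → n) → ℂ) (a : κ → n) :
    permRep κ n σ v a = v (a ∘ σ) := rfl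

/-- A symmetric matrix on tensors commutes with every matrix commuting with all
`X ⊗ ⋯ ⊗ X`. -/
theorem commute_of_symm {κ n : Type*} [Fintype κ] [DecidableEq κ] [Fintype n]
    {T E : Matrix (κ → n) (κ → n) ℂ}
    (hT : ∀ X : Matrix n n ℂ, Commute (tens fun _ => X) T)
    (hE : ∀ (σ : Equiv.Perm κ) a b, E (a ∘ σ) (b ∘ σ) = E a b) : Commute E T := by
  classical
  let e : (κ → n × n) ≃ (κ → n) × (κ → n) := Equiv.arrowProdEquivProdArrow κ (fun _ => n) fun _ => n
  have key : ∀ (F : Matrix (κ → n) (κ → n) ℂ) (a b : κ → n),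
      (F * T - T * F) a b = ∑ i, ((if (e i).1 = a then T (e i).2 b else 0) -
        if (e i).2 = b then T a (e i).1 else 0) * F (e i).1 (e i).2 := fun F a b => by
    rw [e.sum_comp fun p : (κ → n) × (κ → n) => ((if p.1 = a then T p.2 b else 0) -
        if p.2 = b then T a p.1 else 0) * F p.1 p.2]
    simp only [sub_mul, Finset.sum_sub_distrib, Matrix.sub_apply, Matrix.mul_apply]
    congr 1
    · rw [Fintype.sum_prod_type, Finset.sum_comm]
      simp [mul_comm]
    · rw [Fintype.sum_prod_type]
      simp
  refine sub_eq_zero.1 (Matrix.ext fun a b => ?_)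
  rw [key]
  refine sum_mul_symm_eq_zero (S := fun i => E (e i).1 (e i).2) (fun σ i => hE σ (fun k => (i k).1) fun k => (i k).2) fun x => ?_
  have := key (tens fun _ => Matrix.of fun u v => x (u, v)) a b
  rw [sub_eq_zero.2 (hT _)] at this
  exact this.symm

/-- A matrix on tensors commuting with all `X ⊗ ⋯ ⊗ X` is a combination of permutations. -/
theorem exists_eq_sum_perm {κ n : Type*} [Fintype κ] [DecidableEq κ] [Fintype n] [DecidableEq n]
    {T : Matrix (κ → n) (κ → n) ℂ} (hT : ∀ X : Matrix n n ℂ, Commute (tens fun _ => X) T) :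
    ∃ t : Equiv.Perm κ → ℂ, ∀ a b, T a b = ∑ σ : Equiv.Perm κ, if b = a ∘ σ then t σ else 0 := by
  let ρ := permRep κ n
  let T' : Module.End (Module.End (MonoidAlgebra ℂ (Equiv.Perm κ)) ρ.asModule) ρ.asModule :=
    { toFun := fun v => ρ.asModuleEquiv.symm (T.mulVec (ρ.asModuleEquiv v))
      map_add' := fun v w => by simp [Matrix.mulVec_add]
      map_smul' := fun F v => by
        let F' : ((κ → n) → ℂ) →ₗ[ℂ] ((κ → n) → ℂ) :=
          ρ.asModuleEquiv.toLinearMap ∘ₗ (F.restrictScalars ℂ) ∘ₗ ρ.asModuleEquiv.symm.toLinearMap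
        have hF' : ∀ v, F' v = (LinearMap.toMatrix' F').mulVec v := fun v => by
          rw [← Matrix.toLin'_apply, Matrix.toLin'_toMatrix']
        have hρ : ∀ σ v, F' (ρ σ v) = ρ σ (F' v) := fun σ v => by
          change ρ.asModuleEquiv (F (ρ.asModuleEquiv.symm (ρ σ v))) = _
          rw [Representation.asModuleEquiv_symm_map_rho, map_smul,
            Representation.asModuleEquiv_map_smul, Representation.asAlgebraHom_of]
          rfl
        have hs : ∀ (σ : Equiv.Perm κ) (b : κ → n),
            ρ σ (Pi.single (b ∘ σ) 1) = Pi.single b 1 := fun σ b => by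
          ext a
          have : a ∘ σ = b ∘ σ ↔ a = b := σ.surjective.injective_comp_right.eq_iff
          simp [ρ, permRep_apply, Pi.single_apply, this]
        have hc : Commute (LinearMap.toMatrix' F') T := commute_of_symm hT fun σ a b => by
          have hm : ∀ a b, LinearMap.toMatrix' F' a b = F' (Pi.single b 1) a := fun a b => by
            rw [hF', Matrix.mulVec_single_one]
            rfl
          rw [hm, hm]
          have := congrFun (hρ σ (Pi.single (b ∘ σ) 1)) a
          rw [hs] at this
          exact this.symm
        have h1 := hF' (T.mulVec (ρ.asModuleEquiv v))
        rw [Matrix.mulVec_mulVec, hc, ← Matrix.mulVec_mulVec, ← hF'] at h1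
        exact congrArg ρ.asModuleEquiv.symm h1.symm }
  classical
  obtain ⟨r, hr⟩ := jacobson_density T'
    (Finset.univ.image fun b : κ → n => ρ.asModuleEquiv.symm (Pi.single b 1))
  have hr' : ∀ r : MonoidAlgebra ℂ (Equiv.Perm κ), ∃ t : Equiv.Perm κ → ℂ, ∀ v a,
      ρ.asAlgebraHom r v a = ∑ σ, t σ * v (a ∘ σ) := fun r => by
    induction r using MonoidAlgebra.induction_on with
    | of σ =>
      refine ⟨Pi.single σ 1, fun v a => ?_⟩
      rw [Representation.asAlgebraHom_of]
      simp [ρ, permRep_apply, Pi.single_apply]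
    | add r s hr hs =>
      obtain ⟨t, ht⟩ := hr
      obtain ⟨u, hu⟩ := hs
      exact ⟨t + u, fun v a => by simp [ht, hu, add_mul, Finset.sum_add_distrib]⟩
    | smul c r hr =>
      obtain ⟨t, ht⟩ := hr
      exact ⟨c • t, fun v a => by simp [ht, Finset.mul_sum, mul_assoc]⟩
  obtain ⟨t, ht⟩ := hr' r
  refine ⟨t, fun a b => ?_⟩
  have h := congrFun (congrArg ρ.asModuleEquiv
    (hr _ (Finset.mem_image_of_mem _ (Finset.mem_univ b)))) a
  rw [Representation.asModuleEquiv_map_smul, LinearEquiv.apply_symm_apply, ht] at h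
  have h2 : T.mulVec (Pi.single b 1) a = T a b := by simp
  rw [← h2]
  refine h.trans (Finset.sum_congr rfl fun σ _ => ?_)
  simp [Pi.single_apply, eq_comm]

theorem tens_map {κ n R S : Type*} [Fintype κ] [CommRing R] [CommRing S] (f : R →+* S)
    (X : κ → Matrix n n R) (a b : κ → n) :
    f (tens X a b) = tens (fun k => (X k).map f) a b := by
  simp [tens]

theorem commute_tens_of_units {κ n : Type*} [Fintype κ] [DecidableEq κ] [Fintype n] [DecidableEq n]
    {T : Matrix (κ → n) (κ → n) ℂ}
    (hT : ∀ g : (Matrix n n ℂ)ˣ, Commute (tens fun _ => (g : Matrix n n ℂ)) T)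
    (X : Matrix n n ℂ) : Commute (tens fun _ => X) T := by
  refine sub_eq_zero.1 (Matrix.ext fun a b => ?_)
  let Y : Matrix n n (Polynomial ℂ) := X.map Polynomial.C + Matrix.scalar n Polynomial.X
  let p : Polynomial ℂ := ∑ c, (tens (fun _ => Y) a c * Polynomial.C (T c b) -
    Polynomial.C (T a c) * tens (fun _ => Y) c b)
  have hY : ∀ z, Y.map (Polynomial.evalRingHom z) = X + Matrix.scalar n z := fun z => by
    ext i j
    by_cases h : i = j <;> simp [Y, h]
  have hp : ∀ z, p.eval z = ((tens fun _ => X + Matrix.scalar n z) * T -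
      T * tens fun _ => X + Matrix.scalar n z : Matrix (κ → n) (κ → n) ℂ) a b := fun z => by
    rw [← Polynomial.coe_evalRingHom]
    simp only [p, map_sum, map_sub, map_mul, tens_map, hY]
    simp [Matrix.mul_apply]
  have h0 : p * (-X).charpoly = 0 := by
    refine Polynomial.funext fun z => ?_
    rw [Polynomial.eval_mul, Polynomial.eval_zero, hp, Matrix.eval_charpoly, sub_neg_eq_add,
      add_comm]
    by_cases hz : (Matrix.scalar n z + X).det = 0
    · rw [hz, mul_zero]
    · obtain ⟨g, hg⟩ := (Matrix.isUnit_iff_isUnit_det _).2 (Ne.isUnit hz)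
      have := hT g
      rw [hg] at this
      rw [sub_eq_zero.2 this, Matrix.zero_apply, zero_mul]
  have := hp 0
  rw [(mul_eq_zero.1 h0).resolve_right (Matrix.charpoly_monic _).ne_zero] at this
  simpa using this.symm

theorem sum_mul_prod_eq_sum_trace {β κ n R : Type*} [Fintype β] [Fintype κ] [DecidableEq κ]
    [Fintype n] [CommRing R] (T : (κ → β) → Matrix (κ → n) (κ → n) R) (X : β → Matrix n n R) :
    ∑ i : κ → β × n × n, T (fun k => (i k).1) (fun k => (i k).2.2) (fun k => (i k).2.1) *
      ∏ k, X (i k).1 (i k).2.1 (i k).2.2 = ∑ c, (T c * tens fun k => X (c k)).trace := by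
  let e : (κ → β × n × n) ≃ (κ → β) × (κ → n) × (κ → n) :=
    (Equiv.arrowProdEquivProdArrow κ (fun _ => β) fun _ => n × n).trans
      (Equiv.prodCongr (Equiv.refl _) (Equiv.arrowProdEquivProdArrow κ (fun _ => n) fun _ => n))
  refine (e.sum_comp fun p : (κ → β) × (κ → n) × (κ → n) => T p.1 p.2.2 p.2.1 *
    ∏ k, X (p.1 k) (p.2.1 k) (p.2.2 k)).trans ?_
  rw [Fintype.sum_prod_type]
  refine Finset.sum_congr rfl fun c _ => ?_
  rw [Fintype.sum_prod_type, Finset.sum_comm]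
  rfl

theorem conj_comp_perm {κ n : Type*} [Fintype κ] [DecidableEq κ] [Fintype n]
    {G T T' H : Matrix (κ → n) (κ → n) ℂ} (σ : Equiv.Perm κ)
    (hG : ∀ a b, G (a ∘ σ) (b ∘ σ) = G a b) (hT : ∀ a b, T' (a ∘ σ) (b ∘ σ) = T a b)
    (hH : ∀ a b, H (a ∘ σ) (b ∘ σ) = H a b) (a b : κ → n) :
    (G * T' * H) (a ∘ σ) (b ∘ σ) = (G * T * H) a b := by
  let e : (κ → n) ≃ (κ → n) := σ.symm.arrowCongr (Equiv.refl n)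
  have he : ∀ a, e a = a ∘ σ := fun a => rfl
  simp only [Matrix.mul_apply]
  rw [← e.sum_comp]
  refine Finset.sum_congr rfl fun x _ => ?_
  rw [← e.sum_comp]
  simp only [he, hG, hH, hT]

theorem eq_of_sum_trace_tens_eq {β κ n : Type*} [Fintype β] [Fintype κ]
    [DecidableEq κ] [Fintype n] {T U : (κ → β) → Matrix (κ → n) (κ → n) ℂ}
    (hT : ∀ (σ : Equiv.Perm κ) c a b, T (c ∘ σ) (a ∘ σ) (b ∘ σ) = T c a b)
    (hU : ∀ (σ : Equiv.Perm κ) c a b, U (c ∘ σ) (a ∘ σ) (b ∘ σ) = U c a b)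
    (h : ∀ X : β → Matrix n n ℂ, ∑ c, (T c * tens fun k => X (c k)).trace =
      ∑ c, (U c * tens fun k => X (c k)).trace) (c : κ → β) : T c = U c := by
  let D : (κ → β) → Matrix (κ → n) (κ → n) ℂ := fun c => T c - U c
  have hD : ∀ (σ : Equiv.Perm κ) c a b, D (c ∘ σ) (a ∘ σ) (b ∘ σ) = D c a b :=
    fun σ c a b => congrArg₂ (· - ·) (hT σ c a b) (hU σ c a b)
  have key : ∀ X : β → Matrix n n ℂ, ∑ c, (D c * tens fun k => X (c k)).trace = 0 := fun X => by
    simp only [D, sub_mul, Matrix.trace_sub, Finset.sum_sub_distrib]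
    exact sub_eq_zero.2 (h X)
  have hD0 : ∀ i : κ → β × n × n,
      D (fun k => (i k).1) (fun k => (i k).2.2) (fun k => (i k).2.1) = 0 :=
    symm_eq_zero (S := fun i : κ → β × n × n =>
        D (fun k => (i k).1) (fun k => (i k).2.2) (fun k => (i k).2.1))
      (fun σ i => hD σ (fun k => (i k).1) (fun k => (i k).2.2) (fun k => (i k).2.1)) fun x => by
        rw [← key fun β => Matrix.of fun a b => x (β, a, b)]
        exact sum_mul_prod_eq_sum_trace D fun β => Matrix.of fun a b => x (β, a, b)
  exact sub_eq_zero.1 (Matrix.ext fun b a => hD0 fun k => (c k, a k, b k))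

theorem commute_of_sum_trace_invariant {β κ n : Type*} [Fintype β] [Fintype κ]
    [DecidableEq κ] [Fintype n] [DecidableEq n] {T : (κ → β) → Matrix (κ → n) (κ → n) ℂ}
    (hT : ∀ (σ : Equiv.Perm κ) c a b, T (c ∘ σ) (a ∘ σ) (b ∘ σ) = T c a b)
    (hF : ∀ (g : (Matrix n n ℂ)ˣ) (X : β → Matrix n n ℂ),
      ∑ c, (T c * tens fun k => (g : Matrix n n ℂ) * X (c k) *
        ((g⁻¹ : (Matrix n n ℂ)ˣ) : Matrix n n ℂ)).trace =
      ∑ c, (T c * tens fun k => X (c k)).trace)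
    (c : κ → β) (X : Matrix n n ℂ) : Commute (tens fun _ => X) (T c) := by
  refine commute_tens_of_units (fun g => ?_) X
  let G : Matrix (κ → n) (κ → n) ℂ := tens fun _ => (g : Matrix n n ℂ)
  let G' : Matrix (κ → n) (κ → n) ℂ := tens fun _ => ((g⁻¹ : (Matrix n n ℂ)ˣ) : Matrix n n ℂ)
  have hG : G * G' = 1 := by
    rw [← tens_mul, ← tens_one]
    simp
  have hc : G' * T c * G = T c := eq_of_sum_trace_tens_eq (T := fun c => G' * T c * G)
    (fun σ c => conj_comp_perm σ (tens_comp_perm _ σ) (hT σ c) (tens_comp_perm _ σ)) hT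
    (fun X => by
      rw [← hF g X]
      refine Finset.sum_congr rfl fun c _ => ?_
      rw [tens_mul, tens_mul, mul_assoc, mul_assoc, Matrix.trace_mul_comm]
      simp only [mul_assoc, G, G']) c
  change G * T c = T c * G
  conv_lhs => rw [← hc]
  rw [← mul_assoc, ← mul_assoc, hG, one_mul]

/-- The first fundamental theorem for homogeneous invariants of several matrices: they are
linear combinations of the tensor permutations contracted with the matrices. -/
theorem exists_perm_sum_of_invariant {β κ n : Type*} [Fintype β] [Fintype κ]
    [DecidableEq κ] [Fintype n] [DecidableEq n] {S : (κ → β × n × n) → ℂ}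
    (hS : ∀ (σ : Equiv.Perm κ) i, S (i ∘ σ) = S i)
    (hF : ∀ (g : (Matrix n n ℂ)ˣ) (X : β → Matrix n n ℂ),
      ∑ i, S i * ∏ k, ((g : Matrix n n ℂ) * X (i k).1 *
        ((g⁻¹ : (Matrix n n ℂ)ˣ) : Matrix n n ℂ)) (i k).2.1 (i k).2.2 =
      ∑ i, S i * ∏ k, X (i k).1 (i k).2.1 (i k).2.2) :
    ∃ t : (κ → β) → Equiv.Perm κ → ℂ, ∀ X : β → Matrix n n ℂ,
      ∑ i, S i * ∏ k, X (i k).1 (i k).2.1 (i k).2.2 =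
        ∑ c, ∑ σ, t c σ * ∑ a : κ → n, ∏ k, X (c k) (a (σ k)) (a k) := by
  let T : (κ → β) → Matrix (κ → n) (κ → n) ℂ := fun c b a => S fun k => (c k, a k, b k)
  have hST : ∀ X : β → Matrix n n ℂ, ∑ i, S i * ∏ k, X (i k).1 (i k).2.1 (i k).2.2 =
    ∑ c, (T c * tens fun k => X (c k)).trace := sum_mul_prod_eq_sum_trace T
  have hT := commute_of_sum_trace_invariant (T := T)
    (fun σ c a b => hS σ fun k => (c k, b k, a k))
    fun g X => (hST fun β => (g : Matrix n n ℂ) * X β *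
      ((g⁻¹ : (Matrix n n ℂ)ˣ) : Matrix n n ℂ)).symm.trans ((hF g X).trans (hST X))
  choose t ht using fun c => exists_eq_sum_perm (hT c)
  refine ⟨t, fun X => (hST X).trans (Finset.sum_congr rfl fun c _ => ?_)⟩
  simp only [Matrix.trace, Matrix.diag_apply, Matrix.mul_apply, ht, Finset.sum_mul, ite_mul,
    zero_mul, Finset.mul_sum]
  rw [Finset.sum_comm (s := (Finset.univ : Finset (Equiv.Perm κ)))]
  refine Finset.sum_congr rfl fun b _ => ?_
  rw [Finset.sum_comm]
  refine Finset.sum_congr rfl fun σ _ => ?_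
  rw [Finset.sum_ite_eq' Finset.univ (b ∘ σ), if_pos (Finset.mem_univ _)]
  rfl

theorem sum_prod_perm_mem {κ n R : Type*} [Finite κ] [Fintype n] [DecidableEq n] [CommRing R]
    (A : Subring R) (W : Submonoid (Matrix n n R)) (hW : ∀ w ∈ W, w.trace ∈ A) :
    ∀ [Fintype κ] [DecidableEq κ] (X : κ → Matrix n n R) (_ : ∀ k, X k ∈ W) (σ : Equiv.Perm κ),
      ∑ a : κ → n, ∏ k, X k (a (σ k)) (a k) ∈ A := by
  induction κ using Finite.induction_empty_option with
  | of_equiv e ih =>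
    rename_i α β
    intro _ _ X hX σ
    classical
    let _ : Fintype α := Fintype.ofEquiv β e.symm
    have := ih (fun k => X (e k)) (fun k => hX _) ((e.trans σ).trans e.symm)
    rw [← (e.arrowCongr (Equiv.refl n)).sum_comp]
    convert this using 2 with a
    rw [← e.prod_comp]
    simp
  | h_empty =>
    intro _ _ X hX σ
    simp
  | h_option ih =>
    rename_i α _
    intro hα _ X hX σ
    classical
    obtain rfl : hα = instFintypeOption := Subsingleton.elim _ _
    have hsplit : ∑ a : Option α → n, ∏ k, X k (a (σ k)) (a k) =
        ∑ b : α → n, ∑ i, X none ((σ none).elim i b) i *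
          ∏ k, X (some k) ((σ (some k)).elim i b) (b k) := by
      let e : n × (α → n) ≃ (Option α → n) :=
        (Equiv.piOptionEquivProd (β := fun _ : Option α => n)).symm
      have he : ∀ i b o, e (i, b) o = o.elim i b := fun i b o => by cases o <;> rfl
      rw [← e.sum_comp, Fintype.sum_prod_type, Finset.sum_comm]
      simp only [Fintype.prod_option, he, Option.elim_none, Option.elim_some]
    rw [hsplit]
    obtain ⟨τ, hτ, hτ'⟩ : ∃ τ : Equiv.Perm α,
        (∀ k, (∃ l, σ (some k) = some l) → some (τ k) = σ (some k)) ∧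
        ∀ k, σ (some k) = none → some (τ k) = σ none :=
      ⟨Equiv.removeNone σ, fun _ => Equiv.removeNone_some σ, fun _ => Equiv.removeNone_none σ⟩
    rcases hs : σ none with _ | m
    · have h1 : ∀ k, σ (some k) = some (τ k) := fun k => by
        refine (hτ k (Option.ne_none_iff_exists'.1 fun h => ?_)).symm
        simpa using σ.injective (h.trans hs.symm)
      have : ∀ b : α → n, ∑ i, X none ((none : Option α).elim i b) i *
          ∏ k, X (some k) ((σ (some k)).elim i b) (b k) =
          (X none).trace * ∏ k, X (some k) (b (τ k)) (b k) := fun b => by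
        simp [h1, Matrix.trace, Finset.sum_mul]
      simp only [this, ← Finset.mul_sum]
      exact A.mul_mem (hW _ (hX _)) (ih _ (fun k => hX _) τ)
    · obtain ⟨l, hl⟩ : ∃ l, σ (some l) = none := by
        rcases h : σ.symm none with _ | l
        · rw [Equiv.symm_apply_eq, hs] at h
          cases h
        · exact ⟨l, by rw [← h, Equiv.apply_symm_apply]⟩
      have hlm : τ l = m := Option.some_injective _ ((hτ' l hl).trans hs)
      have h1 : ∀ k, k ≠ l → σ (some k) = some (τ k) := fun k hk => by
        refine (hτ k (Option.ne_none_iff_exists'.1 fun h => hk ?_)).symm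
        simpa using σ.injective (h.trans hl.symm)
      let Y := Function.update (fun k => X (some k)) l (X none * X (some l))
      have : ∀ b : α → n, ∑ i, X none ((some m).elim i b) i *
          ∏ k, X (some k) ((σ (some k)).elim i b) (b k) =
          ∏ k, Y k (b (τ k)) (b k) := fun b => by
        rw [← Finset.mul_prod_erase _ _ (Finset.mem_univ l)]
        have h2 : ∀ i, ∏ k, X (some k) ((σ (some k)).elim i b) (b k) =
            X (some l) i (b l) * ∏ k ∈ Finset.univ.erase l, X (some k) (b (τ k)) (b k) := by
          intro i
          rw [← Finset.mul_prod_erase _ _ (Finset.mem_univ l), hl]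
          congr 1
          refine Finset.prod_congr rfl fun k hk => ?_
          rw [h1 k (Finset.ne_of_mem_erase hk)]
          rfl
        have h3 : ∏ k ∈ Finset.univ.erase l, Y k (b (τ k)) (b k) =
            ∏ k ∈ Finset.univ.erase l, X (some k) (b (τ k)) (b k) :=
          Finset.prod_congr rfl fun k hk => by
            simp [Y, Finset.ne_of_mem_erase hk]
        simp only [h2, h3, Y, Function.update_self, Matrix.mul_apply, Finset.sum_mul, hlm,
          mul_assoc, Option.elim_some]
      simp only [this]
      refine ih Y (fun k => ?_) τ
      by_cases hk : k = l
      · subst hk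
        simpa [Y] using W.mul_mem (hX _) (hX _)
      · simpa [Y, hk] using hX _

/-- The product of the letters `Λ` (for `true`) and `Z` (for `false`) of a word. -/
def wordProd {n R : Type*} [Fintype n] [DecidableEq n] [CommRing R] (Z Λ : Matrix n n R)
    (w : List Bool) : Matrix n n R :=
  (w.map fun x => if x then Λ else Z).prod

section Words

variable {n R : Type*} [Fintype n] [DecidableEq n] [CommRing R] {Z Λ K : Matrix n n R}

theorem wordProd_append (u v : List Bool) :
    wordProd Z Λ (u ++ v) = wordProd Z Λ u * wordProd Z Λ v := by
  simp [wordProd]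

theorem wordProd_sorted (a b : ℕ) :
    wordProd Z Λ (List.replicate a true ++ List.replicate b false) = Λ ^ a * Z ^ b := by
  simp [wordProd]

theorem perm_sorted (w : List Bool) :
    w.Perm (List.replicate (w.count true) true ++ List.replicate (w.count false) false) := by
  rw [List.perm_iff_count]
  intro x
  cases x <;> simp [List.count_replicate]

theorem wordProd_swap (hK : K = 1 + Z * Λ - Λ * Z) (x y : Bool) :
    ∃ c : ℤ, wordProd Z Λ [x, y] = wordProd Z Λ [y, x] + c • (K - 1) := by
  subst hK
  cases x <;> cases y
  · exact ⟨0, by simp⟩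
  · exact ⟨1, by simp [wordProd]; abel⟩
  · exact ⟨-1, by simp [wordProd]; abel⟩
  · exact ⟨0, by simp⟩

variable [Algebra ℂ R] {A : Subalgebra ℂ R}

/-- Reordering a word does not change the class of its trace, once the corrections coming from
transpositions of neighbours are under control. -/
theorem trace_sub_mem_of_perm (hK : K = 1 + Z * Λ - Λ * Z) (Q : Matrix n n R) (m : ℕ)
    (hQ : ∀ l r : List Bool, l.length + r.length + 2 ≤ m →
      (wordProd Z Λ l * (K - 1) * wordProd Z Λ r * Q).trace ∈ A)
    {u v : List Bool} (huv : u.Perm v) :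
    ∀ l r : List Bool, l.length + u.length + r.length ≤ m →
      (wordProd Z Λ (l ++ u ++ r) * Q).trace - (wordProd Z Λ (l ++ v ++ r) * Q).trace ∈ A := by
  induction huv with
  | nil => intro l r _; simp
  | cons x h ih =>
    intro l r hm
    have := ih (l ++ [x]) r (by simp at hm ⊢; omega)
    simpa using this
  | swap x y w =>
    intro l r hm
    obtain ⟨c, hc⟩ := wordProd_swap hK y x
    have h := hQ l (w ++ r) (by simp at hm ⊢; omega)
    have e : ∀ p q : Bool, l ++ p :: q :: w ++ r = l ++ ([p, q] ++ (w ++ r)) := by simp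
    rw [e, e, wordProd_append, wordProd_append [y, x], wordProd_append l ([x, y] ++ _),
      wordProd_append [x, y], hc, ← Matrix.trace_sub]
    have : wordProd Z Λ l * ((wordProd Z Λ [x, y] + c • (K - 1)) * wordProd Z Λ (w ++ r)) * Q -
        wordProd Z Λ l * (wordProd Z Λ [x, y] * wordProd Z Λ (w ++ r)) * Q =
        c • (wordProd Z Λ l * (K - 1) * wordProd Z Λ (w ++ r) * Q) := by
      simp only [add_mul, mul_add, smul_mul_assoc, mul_smul_comm, mul_assoc, add_sub_cancel_left]
    rw [this, Matrix.trace_smul]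
    exact zsmul_mem h c
  | trans h₁ h₂ ih₁ ih₂ =>
    intro l r hm
    have := A.add_mem (ih₁ l r hm) (ih₂ l r (by rw [← h₁.length_eq]; exact hm))
    simpa using this

theorem trace_wordProd_mul_mem (hK : K = 1 + Z * Λ - Λ * Z)
    (hK1 : ∀ U : Matrix n n R, K * U * K = (U * K).trace • K)
    (ht : ∀ a b, (Λ ^ a * Z ^ b).trace ∈ A) (m : ℕ) :
    ∀ w : List Bool, w.length = m → (wordProd Z Λ w * K).trace ∈ A := by
  induction m using Nat.strong_induction_on with
  | _ m ih =>
    have hQ : ∀ l r : List Bool, l.length + r.length + 2 ≤ m →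
        (wordProd Z Λ l * (K - 1) * wordProd Z Λ r * K).trace ∈ A := fun l r hlr => by
      have h : wordProd Z Λ l * (K - 1) * wordProd Z Λ r * K =
          (wordProd Z Λ r * K).trace • (wordProd Z Λ l * K) - wordProd Z Λ (l ++ r) * K := by
        rw [← mul_smul_comm, ← hK1, wordProd_append]
        noncomm_ring
      rw [h, Matrix.trace_sub, Matrix.trace_smul]
      exact A.sub_mem (A.mul_mem (ih _ (by omega) r rfl) (ih _ (by omega) l rfl))
        (ih (l ++ r).length (by simp; omega) _ rfl)
    have hperm : ∀ u v : List Bool, u.Perm v → u.length = m →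
        (wordProd Z Λ u * K).trace - (wordProd Z Λ v * K).trace ∈ A := fun u v huv hu => by
      simpa using trace_sub_mem_of_perm hK K m hQ huv [] [] (by simp [hu])
    intro w hw
    suffices h : ∀ a b, a + b = m → (Λ ^ a * Z ^ b * K).trace ∈ A by
      have h1 := hperm w _ (perm_sorted w) hw
      rw [wordProd_sorted] at h1
      have h2 := h _ _ (by
        have := (perm_sorted w).length_eq
        rw [List.length_append, List.length_replicate, List.length_replicate, hw] at this
        exact this.symm)
      simpa using A.add_mem h1 h2
    intro a b hab
    have hs : ∀ i j, i + j = b →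
        (Λ ^ a * Z ^ i * Λ * Z ^ (j + 1)).trace - (i : R) * (Λ ^ a * Z ^ b * K).trace ∈ A := by
      intro i
      induction i with
      | zero =>
        intro j _
        simpa [← pow_succ] using ht (a + 1) (j + 1)
      | succ i hi =>
        intro j hj
        have h1 := hi (j + 1) (by omega)
        have h2 : (Z ^ (j + 1) * (Λ ^ a * Z ^ i) * K).trace - (Λ ^ a * Z ^ b * K).trace ∈ A := by
          have hp : (List.replicate (j + 1) false ++
              (List.replicate a true ++ List.replicate i false)).Perm
              (List.replicate a true ++ List.replicate b false) := by
            rw [List.perm_iff_count]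
            intro x
            cases x <;> simp [List.count_replicate]
            omega
          have := hperm _ _ hp (by simp; omega)
          rw [wordProd_sorted, wordProd_append, wordProd_sorted] at this
          simpa [wordProd] using this
        have h3 : Z * Λ = Λ * Z + (K - 1) := by rw [hK]; abel
        have h4 : (Λ ^ a * Z ^ (i + 1) * Λ * Z ^ (j + 1)).trace =
            (Λ ^ a * Z ^ i * Λ * Z ^ (j + 1 + 1)).trace +
            (Z ^ (j + 1) * (Λ ^ a * Z ^ i) * K).trace - (Λ ^ a * Z ^ b).trace := by
          have : Λ ^ a * Z ^ (i + 1) * Λ * Z ^ (j + 1) =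
            Λ ^ a * Z ^ i * Λ * Z ^ (j + 1 + 1) +
            (Λ ^ a * Z ^ i) * K * Z ^ (j + 1) - Λ ^ a * Z ^ b := by
            rw [pow_succ Z i, ← hj, add_assoc i, add_comm 1 j, pow_add Z i, pow_succ' Z (j + 1)]
            calc _ = Λ ^ a * Z ^ i * (Z * Λ) * Z ^ (j + 1) := by simp only [mul_assoc]
              _ = _ := by rw [h3]; noncomm_ring
          rw [this, Matrix.trace_sub, Matrix.trace_add, Matrix.trace_mul_cycle (Λ ^ a * Z ^ i) K]
        rw [h4]
        have := A.sub_mem (A.add_mem h1 h2) (ht a b)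
        convert this using 1
        push_cast
        ring
    have h0 := hs b 0 rfl
    have h1 : (Λ ^ a * Z ^ b * K).trace =
        (Λ ^ a * Z ^ b).trace + (Λ ^ (a + 1) * Z ^ (b + 1)).trace -
          (Λ ^ a * Z ^ b * Λ * Z ^ (0 + 1)).trace := by
      have : (Λ ^ (a + 1) * Z ^ (b + 1)).trace = (Λ ^ a * Z ^ b * Z * Λ).trace := by
        rw [Matrix.trace_mul_comm _ Λ, pow_succ' Λ, pow_succ]
        simp only [mul_assoc]
      rw [this, ← Matrix.trace_add, ← Matrix.trace_sub, hK, zero_add, pow_one]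
      congr 1
      noncomm_ring
    have h2 : (((b : ℂ) + 1)) • (Λ ^ a * Z ^ b * K).trace ∈ A := by
      have := A.sub_mem (A.add_mem (ht a b) (ht (a + 1) (b + 1))) h0
      convert this using 1
      rw [add_smul, one_smul, Algebra.smul_def, map_natCast]
      linear_combination h1
    have h3 := A.smul_mem h2 ((b : ℂ) + 1)⁻¹
    rwa [smul_smul, inv_mul_cancel₀ (Nat.cast_add_one_ne_zero b), one_smul] at h3

theorem trace_wordProd_mem (hK : K = 1 + Z * Λ - Λ * Z)
    (hK1 : ∀ U : Matrix n n R, K * U * K = (U * K).trace • K)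
    (ht : ∀ a b, (Λ ^ a * Z ^ b).trace ∈ A) (m : ℕ) :
    ∀ w : List Bool, w.length = m → (wordProd Z Λ w).trace ∈ A := by
  induction m using Nat.strong_induction_on with
  | _ m ih =>
    intro w hw
    have h := trace_sub_mem_of_perm (A := A) hK 1 m (fun l r hlr => by
      have : (wordProd Z Λ l * (K - 1) * wordProd Z Λ r * 1).trace =
          (wordProd Z Λ (r ++ l) * K).trace - (wordProd Z Λ (r ++ l)).trace := by
        rw [wordProd_append, mul_one, Matrix.trace_mul_cycle, ← Matrix.trace_sub]
        congr 1
        noncomm_ring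
      rw [this]
      exact A.sub_mem (trace_wordProd_mul_mem hK hK1 ht _ _ rfl)
        (ih (r ++ l).length (by simp; omega) _ rfl)) (perm_sorted w) [] [] (by simp [hw])
    have := A.add_mem h (ht (w.count true) (w.count false))
    rw [← wordProd_sorted] at this
    simpa using this

theorem sum_prod_perm_letters_mem {κ : Type*} [Fintype κ] [DecidableEq κ]
    (hK : ∀ U : Matrix n n R, (1 + Z * Λ - Λ * Z) * U * (1 + Z * Λ - Λ * Z) =
      (U * (1 + Z * Λ - Λ * Z)).trace • (1 + Z * Λ - Λ * Z))
    (ht : ∀ a b, (Λ ^ a * Z ^ b).trace ∈ A) (c : κ → Bool) (σ : Equiv.Perm κ) :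
    ∑ a : κ → n, ∏ k, (if c k then Λ else Z) (a (σ k)) (a k) ∈ A := by
  let W : Submonoid (Matrix n n R) :=
    { carrier := Set.range (wordProd Z Λ)
      one_mem' := ⟨[], rfl⟩
      mul_mem' := by
        rintro _ _ ⟨u, rfl⟩ ⟨v, rfl⟩
        exact ⟨u ++ v, wordProd_append u v⟩ }
  refine sum_prod_perm_mem A.toSubring W ?_ (fun k => if c k then Λ else Z) (fun k => ?_) σ
  · rintro _ ⟨w, rfl⟩
    exact trace_wordProd_mem rfl hK ht _ w rfl
  · exact ⟨[c k], by simp [wordProd]⟩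

end Words

theorem mul_mul_eq_trace_smul_of_rank_eq_one {n : Type*} [Fintype n] [DecidableEq n]
    {K : Matrix n n ℂ} (hK : K.rank = 1) (U : Matrix n n ℂ) : K * U * K = (U * K).trace • K := by
  obtain ⟨v, -, hv⟩ := finrank_eq_one_iff'.1 hK
  choose c hc using fun j => hv ⟨K.mulVecLin (Pi.single j 1), LinearMap.mem_range_self _ _⟩
  have hKv : K = Matrix.vecMulVec v.1 c := by
    ext i j
    have := congrFun (congrArg Subtype.val (hc j)) i
    rw [Matrix.vecMulVec_apply, mul_comm]
    simpa using this.symm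
  rw [hKv, mul_assoc, Matrix.mul_vecMulVec, Matrix.vecMulVec_mul_vecMulVec, Matrix.trace_vecMulVec,
    dotProduct_comm]
  ext i j
  simp [Matrix.vecMulVec_apply]
  ring

theorem sum_prod_perm_coord_mem {P n κ : Type*} [Fintype n] [DecidableEq n] [Fintype κ]
    [DecidableEq κ] {Z Λ : P → Matrix n n ℂ} (hr : ∀ p, (1 + Z p * Λ p - Λ p * Z p).rank = 1)
    {A : Subalgebra ℂ (P → ℂ)} (ht : ∀ a b, (fun p => (Λ p ^ a * Z p ^ b).trace) ∈ A)
    (c : κ → Bool) (σ : Equiv.Perm κ) :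
    (fun p => ∑ a : κ → n, ∏ k, (if c k then Λ p else Z p) (a (σ k)) (a k)) ∈ A := by
  obtain ⟨Z', hZ'⟩ : ∃ Z' : Matrix n n (P → ℂ), ∀ i j p, Z' i j p = Z p i j :=
    ⟨Matrix.of fun i j p => Z p i j, fun _ _ _ => rfl⟩
  obtain ⟨Λ', hΛ'⟩ : ∃ Λ' : Matrix n n (P → ℂ), ∀ i j p, Λ' i j p = Λ p i j :=
    ⟨Matrix.of fun i j p => Λ p i j, fun _ _ _ => rfl⟩
  let ev : P → Matrix n n (P → ℂ) →+* Matrix n n ℂ := fun p =>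
    (Pi.evalRingHom (fun _ => ℂ) p).mapMatrix
  have hev : ∀ p M i j, ev p M i j = M i j p := fun _ _ _ _ => rfl
  have hZ : ∀ p, ev p Z' = Z p := fun p => Matrix.ext fun i j => hZ' i j p
  have hΛ : ∀ p, ev p Λ' = Λ p := fun p => Matrix.ext fun i j => hΛ' i j p
  have htr : ∀ p M, (ev p M).trace = M.trace p := fun p M => by
    simp [Matrix.trace, hev]
  have h := sum_prod_perm_letters_mem (Z := Z') (Λ := Λ') (A := A) (fun U => ?_) (fun a b => ?_) c σ
  · convert h using 1
    funext p
    have hp : ∀ b i j, (if b = true then Λ' else Z') i j p =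
        (if b = true then Λ p else Z p) i j := fun b i j => by
      cases b <;> simp [hZ', hΛ']
    simp only [Finset.sum_apply, Finset.prod_apply, hp]
  · ext i j p
    have h := congrFun (congrFun (mul_mul_eq_trace_smul_of_rank_eq_one (hr p) (ev p U)) i) j
    have hp : 1 + Z p * Λ p - Λ p * Z p = ev p (1 + Z' * Λ' - Λ' * Z') := by
      simp only [map_sub, map_add, map_mul, map_one, hZ, hΛ]
    rw [hp, ← map_mul, ← map_mul, ← map_mul, Matrix.smul_apply, htr, hev, hev] at h
    exact h
  · convert ht a b using 1
    funext p
    rw [← htr, map_mul, map_pow, map_pow, hZ, hΛ]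

/-- An invariant polynomial function of several matrices is a linear combination of contractions
of tensor permutations with the matrices. -/
theorem exists_perm_sum_of_invariant_polynomial {β n : Type*} [Fintype β] [Fintype n]
    [DecidableEq n] (q : MvPolynomial (β × n × n) ℂ)
    (hq : ∀ (g : (Matrix n n ℂ)ˣ) (X : β → Matrix n n ℂ),
      MvPolynomial.eval (fun i => ((g : Matrix n n ℂ) * X i.1 *
        ((g⁻¹ : (Matrix n n ℂ)ˣ) : Matrix n n ℂ)) i.2.1 i.2.2) q =
      MvPolynomial.eval (fun i => X i.1 i.2.1 i.2.2) q) :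
    ∃ t : (d : ℕ) → (Fin d → β) → Equiv.Perm (Fin d) → ℂ, ∀ X : β → Matrix n n ℂ,
      MvPolynomial.eval (fun i => X i.1 i.2.1 i.2.2) q =
        ∑ d ∈ Finset.range (q.totalDegree + 1), ∑ c, ∑ σ, t d c σ *
          ∑ a : Fin d → n, ∏ k, X (c k) (a (σ k)) (a k) := by
  choose S hS hSq using fun d => exists_symm_of_isHomogeneous
    (MvPolynomial.homogeneousComponent_isHomogeneous d q)
  let F : ℕ → (β → Matrix n n ℂ) → ℂ := fun d X => ∑ i, S d i * ∏ k, X (i k).1 (i k).2.1 (i k).2.2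
  have hsum : ∀ X : β → Matrix n n ℂ, MvPolynomial.eval (fun i => X i.1 i.2.1 i.2.2) q =
      ∑ d ∈ Finset.range (q.totalDegree + 1), F d X := fun X => by
    conv_lhs => rw [← MvPolynomial.sum_homogeneousComponent q, map_sum]
    exact Finset.sum_congr rfl fun d _ => hSq d _
  have hsmul : ∀ d (z : ℂ) X, F d (fun b => z • X b) = F d X * z ^ d := fun d z X => by
    simp only [F, Finset.sum_mul]
    refine Finset.sum_congr rfl fun i _ => ?_
    simp [Finset.prod_mul_distrib]
    ring
  have hinv : ∀ d ∈ Finset.range (q.totalDegree + 1), ∀ (g : (Matrix n n ℂ)ˣ)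
      (X : β → Matrix n n ℂ), F d (fun b => (g : Matrix n n ℂ) * X b *
        ((g⁻¹ : (Matrix n n ℂ)ˣ) : Matrix n n ℂ)) = F d X := by
    intro d hd g X
    let Y : β → Matrix n n ℂ := fun b => (g : Matrix n n ℂ) * X b *
        ((g⁻¹ : (Matrix n n ℂ)ˣ) : Matrix n n ℂ)
    have hp : ∑ d ∈ Finset.range (q.totalDegree + 1),
        Polynomial.monomial d (F d Y - F d X) = 0 := by
      refine Polynomial.funext fun z => ?_
      have hY : ∀ b, (g : Matrix n n ℂ) * (z • X b) * ((g⁻¹ : (Matrix n n ℂ)ˣ) : Matrix n n ℂ) =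
          z • Y b := fun b => by rw [mul_smul_comm, smul_mul_assoc]
      have h : ∑ d ∈ Finset.range (q.totalDegree + 1), F d (fun b => z • Y b) =
          ∑ d ∈ Finset.range (q.totalDegree + 1), F d (fun b => z • X b) := by
        rw [← hsum fun b => z • Y b, ← hsum fun b => z • X b]
        simp only [← hY]
        exact hq g fun b => z • X b
      simp only [Polynomial.eval_finsetSum, Polynomial.eval_monomial, sub_mul, ← hsmul,
        Finset.sum_sub_distrib, Polynomial.eval_zero]
      exact sub_eq_zero.2 h
    have := congrArg (fun p => Polynomial.coeff p d) hp
    simp only [Polynomial.finsetSum_coeff, Polynomial.coeff_monomial, Finset.sum_ite_eq', if_pos hd,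
      Polynomial.coeff_zero] at this
    exact sub_eq_zero.1 this
  have hex : ∀ d, ∃ t : (Fin d → β) → Equiv.Perm (Fin d) → ℂ,
      d ∈ Finset.range (q.totalDegree + 1) → ∀ X : β → Matrix n n ℂ, F d X =
        ∑ c, ∑ σ, t c σ * ∑ a : Fin d → n, ∏ k, X (c k) (a (σ k)) (a k) := fun d => by
    by_cases hd : d ∈ Finset.range (q.totalDegree + 1)
    · obtain ⟨t, ht⟩ := exists_perm_sum_of_invariant (hS d) (hinv d hd)
      exact ⟨t, fun _ => ht⟩
    · exact ⟨0, fun h => absurd h hd⟩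
  choose t ht using hex
  exact ⟨t, fun X => (hsum X).trans (Finset.sum_congr rfl fun d hd => ht d hd X)⟩

set_option synthInstance.maxHeartbeats 1000000 in
/-- On `X_N`, every invariant polynomial function is a polynomial in the trace
functions `t_{a,b}(Z,Λ) = tr(Λ^a Z^b)`. -/
theorem stmt11 (N : ℕ) (hN : 0 < N) (f : Mat N × Mat N → ℂ) (hf : IsInvPoly N f) :
    (fun p : XN N => f p.val) ∈
      Algebra.adjoin ℂ
        {h : XN N → ℂ | ∃ a b : ℕ,
          h = fun p : XN N => ((p.val.2 ^ a) * (p.val.1 ^ b)).trace} := by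
  obtain ⟨⟨q, hq⟩, hinv⟩ := hf
  obtain ⟨r, hr⟩ : ∃ r : MvPolynomial (Bool × Fin N × Fin N) ℂ, ∀ X : Bool → Mat N,
      f (X false, X true) = MvPolynomial.eval (fun i => X i.1 i.2.1 i.2.2) r := by
    refine ⟨MvPolynomial.rename (Sum.elim (fun ij => (false, ij)) fun ij => (true, ij)) q,
      fun X => ?_⟩
    rw [hq, MvPolynomial.eval_rename]
    congr 2
    ext (ij | ij) <;> rfl
  obtain ⟨t, ht⟩ := exists_perm_sum_of_invariant_polynomial r fun g X => by
    rw [← hr X, ← hinv g]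
    exact (hr fun b => (g : Mat N) * X b * ((g⁻¹ : (Mat N)ˣ) : Mat N)).symm
  have hf : (fun p : XN N => f p.val) =
      ∑ d ∈ Finset.range (r.totalDegree + 1), ∑ c : Fin d → Bool, ∑ σ, t d c σ •
        fun p : XN N => ∑ a : Fin d → Fin N,
          ∏ k, (if c k then p.val.2 else p.val.1) (a (σ k)) (a k) := by
    funext p
    simp only [Finset.sum_apply, Pi.smul_apply, smul_eq_mul]
    have h := hr fun b => if b then p.val.2 else p.val.1
    rw [ht fun b => if b then p.val.2 else p.val.1] at h
    exact h
  rw [hf]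
  refine Subalgebra.sum_mem _ fun d _ => Subalgebra.sum_mem _ fun c _ =>
    Subalgebra.sum_mem _ fun σ _ => Subalgebra.smul_mem _ ?_ _
  refine sum_prod_perm_coord_mem (Z := fun p : XN N => p.val.1) (Λ := fun p : XN N => p.val.2)
    (fun p : XN N => p.2) (fun a b => ?_) c σ
  exact Algebra.subset_adjoin ⟨a, b, rfl⟩
end
end

section
/- For every invariant polynomial function f on pairs of N×N complex matrices, the restriction of f to X_N lies in the C-subalgebra of the algebra of C-valued functions on X_N generated by the restrictions of the (N+1)² functions m_ij, 0 ≤ i,j ≤ N. In particular, the coefficients m_ij of the Calogero–Moser universal polynomial generate the algebra of regular functions on the Calogero–Moser space C_N. -/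
noncomputable section

/-- The Calogero–Moser universal polynomial `det((v·1 − Λ)(u·1 − Z) − 1)` as an
element of `ℂ[v][u]` (outer variable `u`, inner variable `v`). -/
def cmPoly {N : ℕ} (Z Λ : Mat N) : Polynomial (Polynomial ℂ) :=
  Matrix.det
    (((Polynomial.C Polynomial.X : Polynomial (Polynomial ℂ)) • (1 : Matrix (Fin N) (Fin N) (Polynomial (Polynomial ℂ)))
        - Λ.map (fun c => Polynomial.C (Polynomial.C c))) *
      ((Polynomial.X : Polynomial (Polynomial ℂ)) • (1 : Matrix (Fin N) (Fin N) (Polynomial (Polynomial ℂ)))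
        - Z.map (fun c => Polynomial.C (Polynomial.C c))) - 1)

/-- `m_ij(Z,Λ)`: the coefficient of `u^{N−i} v^{N−j}` in the Calogero–Moser
universal polynomial. -/
def mcoeff (N : ℕ) (i j : Fin (N + 1)) (Z Λ : Mat N) : ℂ :=
  ((cmPoly Z Λ).coeff (N - (i : ℕ))).coeff (N - (j : ℕ))

open Matrix in
/-- A matrix of rank at most one over a field is an outer product. -/
theorem exists_eq_vecMulVec_of_rank_le_one {m n k : Type*} [Fintype m] [Fintype n] [Field k]
    (A : Matrix m n k) (h : A.rank ≤ 1) : ∃ (a : m → k) (b : n → k), A = vecMulVec a b := by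
  classical
  rw [Matrix.rank_eq_finrank_span_cols] at h
  obtain ⟨⟨a, _⟩, h⟩ := finrank_le_one_iff.mp h
  have hcol : ∀ j, ∃ c : k, c • a = A.col j := fun j => by
    obtain ⟨c, hc⟩ := h ⟨A.col j, Submodule.subset_span ⟨j, rfl⟩⟩
    exact ⟨c, congrArg Subtype.val hc⟩
  choose b hb using hcol
  refine ⟨a, b, ?_⟩
  ext i j
  have := congrFun (hb j) i
  simp only [Pi.smul_apply, smul_eq_mul, col_apply] at this
  rw [vecMulVec_apply, ← this, mul_comm]

open Matrix in
/-- The matrix determinant lemma, in terms of the adjugate. -/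
theorem det_sub_vecMulVec_of_det_ne_zero {n R : Type*} [Fintype n] [DecidableEq n] [CommRing R]
    [IsDomain R] (A : Matrix n n R) (hA : A.det ≠ 0) (a b : n → R) :
    (A - vecMulVec a b).det = A.det - (vecMulVec a b * A.adjugate).trace := by
  let φ := algebraMap R (FractionRing R)
  have hφ : Function.Injective φ := IsFractionRing.injective R (FractionRing R)
  apply hφ
  have hA' : IsUnit (φ.mapMatrix A).det := by
    rw [← RingHom.map_det]
    exact isUnit_iff_ne_zero.mpr (by simpa using hφ.ne hA)
  have hmap : φ.mapMatrix (A - vecMulVec a b) = φ.mapMatrix A +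
      replicateCol Unit (fun i => -φ (a i)) * replicateRow Unit (fun i => φ (b i)) := by
    ext i j
    simp [vecMulVec_apply, Matrix.mul_apply, sub_eq_add_neg]
  have hinv : (φ.mapMatrix A).det • (φ.mapMatrix A)⁻¹ = φ.mapMatrix A.adjugate := by
    rw [RingHom.map_adjugate, Matrix.inv_def, smul_smul, Ring.mul_inverse_cancel _ hA', one_smul]
  have hdet : ∀ (B C : Matrix Unit Unit (FractionRing R)), B = 1 + C → B.det = 1 + C () () := by
    rintro B C rfl
    rw [det_unique, Matrix.add_apply]
    simp
  have hent : (φ.mapMatrix A).det * (replicateRow Unit (fun i => φ (b i)) * (φ.mapMatrix A)⁻¹ *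
      replicateCol Unit (fun i => -φ (a i))) () () = (replicateRow Unit (fun i => φ (b i)) *
        φ.mapMatrix A.adjugate * replicateCol Unit (fun i => -φ (a i))) () () := by
    rw [← hinv, Matrix.mul_smul, Matrix.smul_mul, Matrix.smul_apply, smul_eq_mul]
  rw [RingHom.map_det, hmap, det_add_replicateCol_mul_replicateRow hA', map_sub, RingHom.map_det,
    vecMulVec_mul, trace_vecMulVec, hdet _ _ rfl, mul_add, mul_one, hent, sub_eq_add_neg]
  simp [Matrix.mul_apply, dotProduct, vecMul, mul_comm]

open Matrix in
/-- If an `r × r` minor of an array `H` is invertible and all minors bordering it vanish, then `H`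
is determined by the rows and columns of that minor. -/
theorem eq_sum_of_bordered_minors_eq_zero {I J k : Type*} [Field k] (H : I → J → k) {r : ℕ}
    (s : Fin r → I) (c : Fin r → J) (hG : (of fun i j => H (s i) (c j)).det ≠ 0)
    (hz : ∀ (s' : Fin (r + 1) → I) (c' : Fin (r + 1) → J),
      (of fun i j => H (s' i) (c' j)).det = 0) (x : I) (y : J) :
    H x y = (fun j => H x (c j)) ⬝ᵥ ((of fun i j => H (s i) (c j))⁻¹ *ᵥ fun i => H (s i) y) := by
  set G : Matrix (Fin r) (Fin r) k := of fun i j => H (s i) (c j) with hGdef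
  have hu : IsUnit G.det := isUnit_iff_ne_zero.mpr hG
  let _ := invertibleOfIsUnitDet G hu
  let e : Fin r ⊕ Unit ≃ Fin (r + 1) :=
    ((Equiv.refl _).sumCongr (Equiv.equivPUnit (Fin 1)).symm).trans finSumFinEquiv
  have h0 := hz (Sum.elim s (fun _ => x) ∘ e.symm) (Sum.elim c (fun _ => y) ∘ e.symm)
  rw [← det_submatrix_equiv_self e] at h0
  have hblk : (of fun i j => H ((Sum.elim s (fun _ => x) ∘ e.symm) i)
      ((Sum.elim c (fun _ => y) ∘ e.symm) j)).submatrix e e =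
      fromBlocks G (of fun i (_ : Unit) => H (s i) y) (of fun (_ : Unit) j => H x (c j))
        (of fun _ _ => H x y) := by
    ext (i | i) (j | j) <;> simp [hGdef]
  rw [hblk, det_fromBlocks₁₁, mul_eq_zero, or_iff_right hG, det_unique, Matrix.sub_apply,
    sub_eq_zero, Matrix.mul_assoc] at h0
  rw [of_apply] at h0
  rw [h0, invOf_eq_nonsing_inv]
  simp [Matrix.mul_apply, dotProduct, mulVec]

open Matrix in
/-- A trace-like functional `t` on words in two letters satisfying the Calogero–Moser commutation
relation over a field of characteristic zero has a nonvanishing minor of size `t []`. -/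
theorem exists_minor_ne_zero {k : Type*} [Field k] [CharZero k] (N : ℕ) (t : List Bool → k)
    (h1 : t [] = N)
    (hcomm : ∀ x y, t (x ++ [true, false] ++ y) - t (x ++ [false, true] ++ y) =
      t x * t y - t (x ++ y)) :
    ∃ s c : Fin N → List Bool, (of fun i j => t (s i ++ c j)).det ≠ 0 := by
  by_contra! hN
  let P : ℕ → Prop := fun r => ∀ s c : Fin r → List Bool, (of fun i j => t (s i ++ c j)).det = 0
  have hex : ∃ r, P r := ⟨N, hN⟩
  classical
  have hle : Nat.find hex ≤ N := Nat.find_min' hex hN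
  obtain ⟨r, hr⟩ : ∃ r, Nat.find hex = r + 1 := by
    refine Nat.exists_eq_succ_of_ne_zero fun h0 => ?_
    have := Nat.find_spec hex
    rw [h0] at this
    simpa using this Fin.elim0 Fin.elim0
  have hP : P (r + 1) := hr ▸ Nat.find_spec hex
  have hnP : ¬ P r := Nat.find_min hex (by omega)
  simp only [P, not_forall] at hnP
  obtain ⟨s, c, hG⟩ := hnP
  set G : Matrix (Fin r) (Fin r) k := of fun i j => t (s i ++ c j) with hGdef
  have hu : IsUnit G.det := isUnit_iff_ne_zero.mpr hG
  have dec : ∀ x y, t (x ++ y) = (fun j => t (x ++ c j)) ⬝ᵥ (G⁻¹ *ᵥ fun i => t (s i ++ y)) :=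
    fun x y => eq_sum_of_bordered_minors_eq_zero (fun x y => t (x ++ y)) s c hG hP x y
  let M : List Bool → Matrix (Fin r) (Fin r) k := fun x => of fun i j => t (s i ++ x ++ c j)
  have hM : ∀ x y, M (x ++ y) = M x * G⁻¹ * M y := fun x y => by
    ext i j
    have := dec (s i ++ x) (y ++ c j)
    simp only [M, of_apply, List.append_assoc] at this ⊢
    rw [this, Matrix.mul_assoc, Matrix.mul_apply, dotProduct]
    simp [Matrix.mul_apply, mulVec, dotProduct]
  have hdiff : M [true, false] - M [false, true] =
      vecMulVec (fun i => t (s i)) (fun j => t (c j)) - G := by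
    ext i j
    simpa [M, vecMulVec_apply, hGdef] using hcomm (s i) (c j)
  have htr : (G⁻¹ * M [true, false]).trace = (G⁻¹ * M [false, true]).trace := by
    have e1 := hM [true] [false]
    have e2 := hM [false] [true]
    simp only [List.cons_append, List.nil_append] at e1 e2
    rw [e1, e2, Matrix.mul_assoc, ← Matrix.mul_assoc, trace_mul_comm, Matrix.mul_assoc,
      Matrix.mul_assoc]
  have h0 := dec [] []
  simp only [List.nil_append, List.append_nil] at h0
  have key : (G⁻¹ * (M [true, false] - M [false, true])).trace = 0 := by
    rw [Matrix.mul_sub, trace_sub, htr, sub_self]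
  rw [hdiff, Matrix.mul_sub, trace_sub, nonsing_inv_mul _ hu, mul_vecMulVec, trace_vecMulVec,
    dotProduct_comm, ← h0, h1, trace_one, Fintype.card_fin, sub_eq_zero] at key
  have : N = r := Nat.cast_injective key
  omega

/-- The coefficients of the adjugate of the characteristic matrix, as a polynomial with matrix
coefficients. -/
def adjCoeff {N : ℕ} (W : Mat N) (k : ℕ) : Mat N :=
  (matPolyEquiv W.charmatrix.adjugate).coeff k

theorem adjCoeff_apply {N : ℕ} (W : Mat N) (k : ℕ) (i j : Fin N) :
    adjCoeff W k i j = (W.charmatrix.adjugate i j).coeff k :=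
  matPolyEquiv_coeff_apply _ _ _ _

theorem X_sub_C_mul_matPolyEquiv_adjugate {N : ℕ} (W : Mat N) :
    (Polynomial.X - Polynomial.C W) * matPolyEquiv W.charmatrix.adjugate =
      W.charpoly.map (algebraMap ℂ (Mat N)) := by
  rw [← Matrix.matPolyEquiv_charmatrix, ← map_mul, Matrix.mul_adjugate, matPolyEquiv_smul_one]
  rfl

theorem mul_adjCoeff_zero {N : ℕ} (W : Mat N) :
    W * adjCoeff W 0 = -(W.charpoly.coeff 0 • 1) := by
  have := congrArg (fun p => p.coeff 0) (X_sub_C_mul_matPolyEquiv_adjugate W)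
  simp only [sub_mul, Polynomial.coeff_sub, Polynomial.coeff_X_mul_zero, Polynomial.coeff_C_mul,
    Polynomial.coeff_map, Algebra.algebraMap_eq_smul_one, zero_sub] at this
  rw [← this, neg_neg, adjCoeff]

theorem mul_adjCoeff_succ {N : ℕ} (W : Mat N) (k : ℕ) :
    W * adjCoeff W (k + 1) = adjCoeff W k - W.charpoly.coeff (k + 1) • 1 := by
  have := congrArg (fun p => p.coeff (k + 1)) (X_sub_C_mul_matPolyEquiv_adjugate W)
  simp only [sub_mul, Polynomial.coeff_sub, Polynomial.coeff_X_mul, Polynomial.coeff_C_mul,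
    Polynomial.coeff_map, Algebra.algebraMap_eq_smul_one] at this
  rw [← this]
  simp only [adjCoeff, sub_sub_cancel]

theorem charpoly_coeff_eq_zero_of_lt {N : ℕ} (W : Mat N) {k : ℕ} (hk : N < k) :
    W.charpoly.coeff k = 0 :=
  Polynomial.coeff_eq_zero_of_natDegree_lt (by simpa using hk)

theorem charpoly_coeff_dim {N : ℕ} (W : Mat N) : W.charpoly.coeff N = 1 := by
  simpa using W.charpoly_monic.coeff_natDegree

theorem adjCoeff_eq_zero_of_le {N : ℕ} (W : Mat N) {k : ℕ} (hk : N ≤ k) : adjCoeff W k = 0 := by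
  suffices ∀ d k, N ≤ k → (matPolyEquiv W.charmatrix.adjugate).natDegree < k + d →
      adjCoeff W k = 0 from
    this ((matPolyEquiv W.charmatrix.adjugate).natDegree + 1) k hk (by omega)
  intro d
  induction d with
  | zero => exact fun k _ h => Polynomial.coeff_eq_zero_of_natDegree_lt h
  | succ d ih =>
    intro k hk h
    have := mul_adjCoeff_succ W k
    rwa [ih (k + 1) (by omega) (by omega), charpoly_coeff_eq_zero_of_lt W (by omega), mul_zero,
      zero_smul, sub_zero, eq_comm] at this

theorem adjCoeff_pred_dim {N : ℕ} (hN : 0 < N) (W : Mat N) : adjCoeff W (N - 1) = 1 := by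
  have := mul_adjCoeff_succ W (N - 1)
  rw [Nat.sub_add_cancel hN, adjCoeff_eq_zero_of_le W le_rfl, charpoly_coeff_dim, mul_zero,
    one_smul, eq_comm, sub_eq_zero] at this
  exact this

/-- The matrix `K(Z,Λ) = 1 + ZΛ − ΛZ`. -/
def cmK {N : ℕ} (p : Mat N × Mat N) : Mat N := 1 + p.1 * p.2 - p.2 * p.1

theorem exists_cmK_eq_vecMulVec {N : ℕ} (p : XN N) :
    ∃ a b : Fin N → ℂ, cmK p.1 = Matrix.vecMulVec a b :=
  exists_eq_vecMulVec_of_rank_le_one _ p.2.le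

open Polynomial Matrix in
theorem coeff_coeff_cmPoly {N : ℕ} (p : XN N) (k l : ℕ) :
    ((cmPoly p.1.1 p.1.2).coeff k).coeff l = p.1.1.charpoly.coeff k * p.1.2.charpoly.coeff l -
      (cmK p.1 * adjCoeff p.1.2 l * adjCoeff p.1.1 k).trace := by
  obtain ⟨a, b, hab⟩ := exists_cmK_eq_vecMulVec p
  obtain ⟨⟨Z, L⟩, hp⟩ := p
  simp only at hab ⊢
  let φ : ℂ →+* ℂ[X][X] := C.comp C
  let U : Matrix (Fin N) (Fin N) ℂ[X][X] := (mapRingHom C).mapMatrix Z.charmatrix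
  let V : Matrix (Fin N) (Fin N) ℂ[X][X] := C.mapMatrix L.charmatrix
  have hU : (X : ℂ[X][X]) • (1 : Matrix (Fin N) (Fin N) ℂ[X][X]) - Z.map (fun c => C (C c)) = U := by
    ext1 i j
    by_cases h : i = j <;> simp [U, h]
  have hV : (C X : ℂ[X][X]) • (1 : Matrix (Fin N) (Fin N) ℂ[X][X]) - L.map (fun c => C (C c)) = V := by
    ext1 i j
    by_cases h : i = j <;> simp [V, h]
  have hab' : vecMulVec (φ ∘ a) (φ ∘ b) = φ.mapMatrix (cmK (Z, L)) := by
    rw [hab]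
    ext1 i j
    simp [vecMulVec_apply]
  have hK : V * U - 1 = U * V - vecMulVec (φ ∘ a) (φ ∘ b) := by
    have hZ : Z.map (fun c => C (C c)) = φ.mapMatrix Z := rfl
    have hL : L.map (fun c => C (C c)) = φ.mapMatrix L := rfl
    rw [hab', ← hU, ← hV, cmK, hZ, hL]
    simp only [map_sub, map_add, map_mul, map_one, sub_mul, mul_sub, Matrix.smul_mul,
      Matrix.mul_smul, Matrix.one_mul, Matrix.mul_one, smul_smul]
    rw [mul_comm (X : ℂ[X][X]) (C X)]
    abel
  have hdet : (U * V).det = Z.charpoly.map C * C L.charpoly := by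
    rw [det_mul, ← RingHom.map_det, ← RingHom.map_det]
    rfl
  have hne : (U * V).det ≠ 0 := by
    rw [hdet]
    exact mul_ne_zero (Z.charpoly_monic.map C).ne_zero (C_ne_zero.mpr L.charpoly_monic.ne_zero)
  rw [cmPoly, hU, hV, hK, det_sub_vecMulVec_of_det_ne_zero _ hne, hdet, adjugate_mul_distrib,
    ← RingHom.map_adjugate, ← RingHom.map_adjugate, hab', coeff_sub, coeff_sub, coeff_mul_C,
    coeff_map, coeff_C_mul]
  congr 1
  simp only [trace, diag_apply, Matrix.mul_apply, finsetSum_coeff, RingHom.mapMatrix_apply,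
    Matrix.map_apply, adjCoeff_apply, Finset.mul_sum, φ, RingHom.comp_apply,
    coe_mapRingHom, coeff_C_mul, coeff_map, coeff_mul_C, mul_assoc]

/-- The algebra of functions on `X_N` generated by the `m_ij`. -/
def cmAlg (N : ℕ) : Subalgebra ℂ (XN N → ℂ) :=
  Algebra.adjoin ℂ {h : XN N → ℂ | ∃ i j : Fin (N + 1),
    h = fun p : XN N => mcoeff N i j p.val.1 p.val.2}

theorem coeff_coeff_cmPoly_mem_cmAlg {N k l : ℕ} (hk : k ≤ N) (hl : l ≤ N) :
    (fun p : XN N => ((cmPoly p.1.1 p.1.2).coeff k).coeff l) ∈ cmAlg N := by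
  refine Algebra.subset_adjoin ⟨⟨N - k, by omega⟩, ⟨N - l, by omega⟩, ?_⟩
  funext p
  simp only [mcoeff]
  rw [Nat.sub_sub_self hk, Nat.sub_sub_self hl]

theorem charpoly_fst_coeff_mem_cmAlg {N : ℕ} (k : ℕ) :
    (fun p : XN N => p.1.1.charpoly.coeff k) ∈ cmAlg N := by
  rcases lt_or_ge N k with hk | hk
  · simp only [charpoly_coeff_eq_zero_of_lt _ hk]
    exact (cmAlg N).zero_mem
  · simpa [coeff_coeff_cmPoly, adjCoeff_eq_zero_of_le, charpoly_coeff_dim] using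
      coeff_coeff_cmPoly_mem_cmAlg hk le_rfl

theorem charpoly_snd_coeff_mem_cmAlg {N : ℕ} (k : ℕ) :
    (fun p : XN N => p.1.2.charpoly.coeff k) ∈ cmAlg N := by
  rcases lt_or_ge N k with hk | hk
  · simp only [charpoly_coeff_eq_zero_of_lt _ hk]
    exact (cmAlg N).zero_mem
  · simpa [coeff_coeff_cmPoly, adjCoeff_eq_zero_of_le, charpoly_coeff_dim] using
      coeff_coeff_cmPoly_mem_cmAlg le_rfl hk

theorem trace_adjCoeff_mul_adjCoeff_mem_cmAlg {N : ℕ} (k l : ℕ) :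
    (fun p : XN N => (cmK p.1 * adjCoeff p.1.2 l * adjCoeff p.1.1 k).trace) ∈ cmAlg N := by
  rcases le_or_gt N k with hk | hk
  · simp only [adjCoeff_eq_zero_of_le _ hk, mul_zero, Matrix.trace_zero]
    exact (cmAlg N).zero_mem
  rcases le_or_gt N l with hl | hl
  · simp only [adjCoeff_eq_zero_of_le _ hl, mul_zero, zero_mul, Matrix.trace_zero]
    exact (cmAlg N).zero_mem
  have := (cmAlg N).sub_mem ((cmAlg N).mul_mem (charpoly_fst_coeff_mem_cmAlg k)
    (charpoly_snd_coeff_mem_cmAlg l)) (coeff_coeff_cmPoly_mem_cmAlg hk.le hl.le)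
  convert this using 1
  funext p
  simp [coeff_coeff_cmPoly]

/-- Traces against powers of a matrix can be expressed through traces against the coefficients of
the adjugate of its characteristic matrix and the coefficients of its characteristic polynomial. -/
theorem trace_mul_pow_mem_of_trace_mul_adjCoeff_mem {S : Type*} {N : ℕ} (hN : 0 < N)
    (A : Subalgebra ℂ (S → ℂ)) (W Y : S → Mat N)
    (hc : ∀ k, (fun p => (W p).charpoly.coeff k) ∈ A)
    (hY : ∀ k, (fun p => (Y p * adjCoeff (W p) k).trace) ∈ A) (j : ℕ) :
    (fun p => (Y p * W p ^ j).trace) ∈ A := by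
  suffices ∀ k, (fun p => (Y p * W p ^ j * adjCoeff (W p) k).trace) ∈ A by
    simpa [adjCoeff_pred_dim hN] using this (N - 1)
  induction j with
  | zero => simpa using hY
  | succ j ih =>
    have h1 : (fun p => (Y p * W p ^ j).trace) ∈ A := by
      simpa [adjCoeff_pred_dim hN] using ih (N - 1)
    rintro (- | k)
    · convert A.neg_mem (A.mul_mem (hc 0) h1) using 1
      funext p
      simp [pow_succ, mul_assoc, mul_adjCoeff_zero]
    · convert A.sub_mem (ih k) (A.mul_mem (hc (k + 1)) h1) using 1
      funext p
      simp [pow_succ, mul_assoc, mul_adjCoeff_succ, mul_sub]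

theorem trace_pow_mul_pow_mem_cmAlg {N : ℕ} (hN : 0 < N) (i j : ℕ) :
    (fun p : XN N => (cmK p.1 * p.1.2 ^ i * p.1.1 ^ j).trace) ∈ cmAlg N := by
  have h : ∀ l, (fun p : XN N => (cmK p.1 * adjCoeff p.1.2 l * p.1.1 ^ j).trace) ∈ cmAlg N :=
    fun l => trace_mul_pow_mem_of_trace_mul_adjCoeff_mem hN (cmAlg N) (fun p => p.1.1)
      (fun p => cmK p.1 * adjCoeff p.1.2 l) charpoly_fst_coeff_mem_cmAlg
      (fun k => trace_adjCoeff_mul_adjCoeff_mem_cmAlg k l) j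
  have := trace_mul_pow_mem_of_trace_mul_adjCoeff_mem hN (cmAlg N) (fun p => p.1.2)
    (fun p => p.1.1 ^ j * cmK p.1) charpoly_snd_coeff_mem_cmAlg
    (fun l => by simpa only [mul_assoc, Matrix.trace_mul_comm (_ ^ j)] using h l) i
  simpa only [mul_assoc, Matrix.trace_mul_comm (_ ^ j)] using this

/-- The value of a word in two letters at a pair of matrices; `true` stands for `Z` and `false`
for `Λ`. -/
def wordEval {N : ℕ} (p : Mat N × Mat N) (l : List Bool) : Mat N :=
  (l.map fun b => cond b p.1 p.2).prod

theorem wordEval_append {N : ℕ} (p : Mat N × Mat N) (x y : List Bool) :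
    wordEval p (x ++ y) = wordEval p x * wordEval p y := by
  simp [wordEval]

/-- The trace of `K(Z,Λ)` times a word in `Z` and `Λ`. -/
def wordTrace {N : ℕ} (p : Mat N × Mat N) (l : List Bool) : ℂ := (cmK p * wordEval p l).trace

theorem wordTrace_eq_dotProduct {N : ℕ} {p : Mat N × Mat N} {a b : Fin N → ℂ}
    (h : cmK p = Matrix.vecMulVec a b) (l : List Bool) :
    wordTrace p l = dotProduct b (Matrix.mulVec (wordEval p l) a) := by
  rw [wordTrace, h, Matrix.vecMulVec_mul, Matrix.trace_vecMulVec, dotProduct_comm,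
    Matrix.dotProduct_mulVec]

theorem wordTrace_nil {N : ℕ} (p : Mat N × Mat N) : wordTrace p [] = N := by
  simp [wordTrace, wordEval, cmK, Matrix.trace_mul_comm p.1 p.2]

theorem wordTrace_comm {N : ℕ} (p : XN N) (x y : List Bool) :
    wordTrace p.1 (x ++ [true, false] ++ y) - wordTrace p.1 (x ++ [false, true] ++ y) =
      wordTrace p.1 x * wordTrace p.1 y - wordTrace p.1 (x ++ y) := by
  obtain ⟨a, b, hab⟩ := exists_cmK_eq_vecMulVec p
  have h : wordEval p.1 [true, false] = wordEval p.1 [false, true] + Matrix.vecMulVec a b - 1 := by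
    rw [← hab, cmK]
    simp only [wordEval, List.map_cons, List.map_nil, cond_true, cond_false, List.prod_cons,
      List.prod_nil, mul_one]
    abel
  simp only [wordTrace_eq_dotProduct hab, wordEval_append, h, mul_add, add_mul, mul_sub, sub_mul,
    mul_one, Matrix.add_mulVec, Matrix.sub_mulVec, dotProduct_add, dotProduct_sub,
    Matrix.mul_vecMulVec, Matrix.vecMulVec_mul, Matrix.vecMulVec_mulVec, dotProduct_smul]
  simp only [← Matrix.dotProduct_mulVec, MulOpposite.smul_eq_mul_unop, MulOpposite.unop_op]
  ring

theorem wordTrace_mem_cmAlg {N : ℕ} (hN : 0 < N) (l : List Bool) :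
    (fun p : XN N => wordTrace p.1 l) ∈ cmAlg N := by
  induction hn : l.length using Nat.strong_induction_on generalizing l with
  | _ n ih =>
  subst hn
  have swap : ∀ x y : List Bool, x.length + y.length + 2 = l.length →
      ((fun p : XN N => wordTrace p.1 (x ++ [true, false] ++ y)) ∈ cmAlg N ↔
        (fun p : XN N => wordTrace p.1 (x ++ [false, true] ++ y)) ∈ cmAlg N) := by
    intro x y hxy
    have hd : (fun p : XN N => wordTrace p.1 (x ++ [true, false] ++ y)) -
        (fun p : XN N => wordTrace p.1 (x ++ [false, true] ++ y)) ∈ cmAlg N := by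
      convert (cmAlg N).sub_mem ((cmAlg N).mul_mem (ih _ (by omega) x rfl) (ih _ (by omega) y rfl))
        (ih _ (by simp; omega) (x ++ y) rfl) using 1
      funext p
      exact wordTrace_comm p x y
    constructor <;> intro h
    · simpa using (cmAlg N).sub_mem h hd
    · simpa using (cmAlg N).add_mem h hd
  have perm : ∀ {u v : List Bool}, u.Perm v → ∀ x : List Bool, x.length + u.length = l.length →
      ((fun p : XN N => wordTrace p.1 (x ++ u)) ∈ cmAlg N ↔
        (fun p : XN N => wordTrace p.1 (x ++ v)) ∈ cmAlg N) := by
    intro u v huv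
    induction huv with
    | nil => simp
    | cons b _ ih =>
      intro x hx
      simpa using ih (x ++ [b]) (by simp at hx ⊢; omega)
    | swap b c u =>
      intro x hx
      have := swap x u (by simp at hx; omega)
      cases b <;> cases c
      · rfl
      · simpa using this
      · simpa using this.symm
      · rfl
    | trans h1 _ ih1 ih2 =>
      intro x hx
      exact (ih1 x hx).trans (ih2 x (by rw [← h1.length_eq, hx]))
  have hl : l.Perm (List.replicate (l.count false) false ++ List.replicate (l.count true) true) := by
    rw [List.perm_iff_count]
    rintro (- | -) <;> simp [List.count_replicate]
  refine (perm hl [] (by simp)).mpr ?_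
  convert trace_pow_mul_pow_mem_cmAlg hN (l.count false) (l.count true) using 1
  funext p
  simp [wordTrace, wordEval, mul_assoc]

/-- Clearing denominators: substituting fractions with numerators in `A` and a common denominator
`D ∈ A` into a polynomial gives an element of `A` after multiplication by a power of `D`. -/
theorem exists_pow_mul_eval_div_mem {S σ : Type*} (A : Subalgebra ℂ (S → ℂ)) (D : S → ℂ)
    (hD : D ∈ A) (x : σ → S → ℂ) (hx : ∀ i, x i ∈ A) (q : MvPolynomial σ ℂ) :
    ∃ e : ℕ, ∃ h ∈ A, ∀ p, D p ≠ 0 →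
      D p ^ e * MvPolynomial.eval (fun i => (D p)⁻¹ * x i p) q = h p := by
  induction q using MvPolynomial.induction_on with
  | C c => exact ⟨0, _, A.algebraMap_mem c, fun p _ => by simp⟩
  | add q₁ q₂ h₁ h₂ =>
    obtain ⟨e₁, g₁, hg₁, h₁⟩ := h₁
    obtain ⟨e₂, g₂, hg₂, h₂⟩ := h₂
    refine ⟨e₁ + e₂, _, A.add_mem (A.mul_mem (A.pow_mem hD e₂) hg₁)
      (A.mul_mem (A.pow_mem hD e₁) hg₂), fun p hp => ?_⟩
    simp only [map_add, Pi.add_apply, Pi.mul_apply, Pi.pow_apply, ← h₁ p hp, ← h₂ p hp]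
    ring
  | mul_X q i h =>
    obtain ⟨e, g, hg, h⟩ := h
    refine ⟨e + 1, _, A.mul_mem hg (hx i), fun p hp => ?_⟩
    simp only [map_mul, MvPolynomial.eval_X, Pi.mul_apply, ← h p hp, pow_succ]
    field_simp

/-- The array of traces of `K` times the words `s i ++ x ++ c j`. -/
def wordGram {N : ℕ} (s c : Fin N → List Bool) (p : Mat N × Mat N) (x : List Bool) : Mat N :=
  Matrix.of fun i j => wordTrace p (s i ++ x ++ c j)

open Matrix in
/-- Where a Gram determinant does not vanish, a pair in `X_N` is conjugate to a pair whose entries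
are rational in the traces of `K` times words. -/
theorem eq_apply_of_det_wordGram_ne_zero {N : ℕ} {f : Mat N × Mat N → ℂ} (hf : IsInvPoly N f)
    (s c : Fin N → List Bool) (p : XN N) (hD : (wordGram s c p.1 []).det ≠ 0) :
    f p.1 = f
      ((wordGram s c p.1 []).det⁻¹ • ((wordGram s c p.1 []).adjugate * wordGram s c p.1 [true]),
        (wordGram s c p.1 []).det⁻¹ •
          ((wordGram s c p.1 []).adjugate * wordGram s c p.1 [false])) := by
  obtain ⟨a, b, hab⟩ := exists_cmK_eq_vecMulVec p
  let Q : Mat N := of fun i => b ᵥ* wordEval p.1 (s i)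
  let P : Mat N := of fun i j => (wordEval p.1 (c j) *ᵥ a) i
  have hG : ∀ x, wordGram s c p.1 x = Q * wordEval p.1 x * P := fun x => by
    ext i j
    have : (Q * wordEval p.1 x * P) i j =
        (b ᵥ* wordEval p.1 (s i) ᵥ* wordEval p.1 x) ⬝ᵥ (wordEval p.1 (c j) *ᵥ a) := rfl
    rw [this, wordGram, of_apply, wordTrace_eq_dotProduct hab, wordEval_append, wordEval_append,
      ← mulVec_mulVec, dotProduct_mulVec, vecMul_vecMul]
  have hG0 : wordGram s c p.1 [] = Q * P := by
    rw [hG, wordEval, List.map_nil, List.prod_nil, mul_one]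
  have hGx : ∀ x, (wordGram s c p.1 []).det⁻¹ •
      ((wordGram s c p.1 []).adjugate * wordGram s c p.1 x) = P⁻¹ * wordEval p.1 x * P := fun x => by
    have hdet : Q.det * P.det ≠ 0 := by rwa [hG0, det_mul] at hD
    have hQ : IsUnit Q.det := isUnit_iff_ne_zero.mpr (left_ne_zero_of_mul hdet)
    rw [← Matrix.smul_mul, ← Ring.inverse_eq_inv', ← Matrix.inv_def, hG0, Matrix.mul_inv_rev, hG,
      mul_assoc, mul_assoc Q, nonsing_inv_mul_cancel_left _ _ hQ, mul_assoc]
  have hP : IsUnit P.det :=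
    isUnit_iff_ne_zero.mpr (right_ne_zero_of_mul (by rwa [hG0, det_mul] at hD))
  let g : (Mat N)ˣ := ⟨P⁻¹, P, nonsing_inv_mul _ hP, mul_nonsing_inv _ hP⟩
  rw [hGx, hGx]
  have := hf.2 g p.1.1 p.1.2
  simpa [wordEval, g] using this.symm

set_option synthInstance.maxHeartbeats 1000000 in
/-- Over every point of the spectrum of `cmAlg N` some Gram determinant does not vanish. -/
theorem exists_det_wordGram_notMem {N : ℕ} (hN : 0 < N) (m : Ideal (cmAlg N)) (hm : m.IsMaximal) :
    ∃ s c : Fin N → List Bool, ∀ d : cmAlg N,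
      (∀ p : XN N, d.1 p = (wordGram s c p.1 []).det) → d ∉ m := by
  let _ : Field (cmAlg N ⧸ m) := Ideal.Quotient.field m
  have : CharZero (cmAlg N ⧸ m) := algebraRat.charZero _
  let t : List Bool → cmAlg N := fun l => ⟨_, wordTrace_mem_cmAlg hN l⟩
  obtain ⟨s, c, h⟩ := exists_minor_ne_zero N (fun l => Ideal.Quotient.mk m (t l))
    (by
      rw [← map_natCast (Ideal.Quotient.mk m)]
      congr 1
      ext p
      simpa [t] using wordTrace_nil p.1)
    (fun x y => by
      rw [← map_sub, ← map_mul, ← map_sub]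
      congr 1
      ext p
      exact wordTrace_comm p x y)
  refine ⟨s, c, fun d hd hdm => h ?_⟩
  have hd' : d = (Matrix.of fun i j => t (s i ++ c j)).det := by
    ext p
    let ev : cmAlg N →+* ℂ := (Pi.evalRingHom _ p).comp (cmAlg N).val.toRingHom
    have : ev (Matrix.of fun i j => t (s i ++ c j)).det = (wordGram s c p.1 []).det := by
      rw [RingHom.map_det]
      congr 1
      ext i j
      simp [wordGram, t, ev]
    rw [hd p, ← this]
    rfl
  rw [← Ideal.Quotient.eq_zero_iff_mem.mpr hdm, hd', RingHom.map_det]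
  rfl

theorem det_mem_of_forall_mem {S n : Type*} [Fintype n] [DecidableEq n] (A : Subalgebra ℂ (S → ℂ))
    (M : S → Matrix n n ℂ) (hM : ∀ i j, (fun p => M p i j) ∈ A) : (fun p => (M p).det) ∈ A := by
  have : (fun p => (M p).det) =
      ∑ σ : Equiv.Perm n, Equiv.Perm.sign σ • ∏ i, fun p => M p (σ i) i := by
    funext p
    simp [Matrix.det_apply]
  rw [this]
  exact A.sum_mem fun σ _ => A.zsmul_mem (A.prod_mem fun i _ => hM _ _) _

theorem adjugate_mul_mem_of_forall_mem {S n : Type*} [Fintype n] [DecidableEq n]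
    (A : Subalgebra ℂ (S → ℂ)) (M M' : S → Matrix n n ℂ) (hM : ∀ i j, (fun p => M p i j) ∈ A)
    (hM' : ∀ i j, (fun p => M' p i j) ∈ A) (i j : n) :
    (fun p => ((M p).adjugate * M' p) i j) ∈ A := by
  have : (fun p => ((M p).adjugate * M' p) i j) =
      ∑ k, (fun p => (M p).adjugate i k) * fun p => M' p k j := by
    funext p
    simp [Matrix.mul_apply]
  rw [this]
  refine A.sum_mem fun k _ => A.mul_mem ?_ (hM' k j)
  simp only [Matrix.adjugate_apply]
  refine det_mem_of_forall_mem A _ fun a b => ?_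
  by_cases h : a = k
  · subst h
    simp only [Matrix.updateRow_self]
    exact A.algebraMap_mem (Pi.single (M := fun _ => ℂ) i 1 b)
  · simpa only [Matrix.updateRow_ne h] using hM a b

/-- A power of a Gram determinant multiplies an invariant polynomial function into `cmAlg N`. -/
theorem exists_det_wordGram_pow_mul_mem {N : ℕ} (hN : 0 < N) {f : Mat N × Mat N → ℂ}
    (hf : IsInvPoly N f) (s c : Fin N → List Bool) :
    ∃ e : ℕ, (fun p : XN N => (wordGram s c p.1 []).det ^ e * f p.1) ∈ cmAlg N := by
  obtain ⟨q, hq⟩ := hf.1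
  have hgram : ∀ x i j, (fun p : XN N => wordGram s c p.1 x i j) ∈ cmAlg N :=
    fun x i j => wordTrace_mem_cmAlg hN _
  let D : XN N → ℂ := fun p => (wordGram s c p.1 []).det
  have hD : D ∈ cmAlg N := det_mem_of_forall_mem _ _ (hgram [])
  let e (b : Bool) (ij : Fin N × Fin N) : XN N → ℂ := fun p =>
    ((wordGram s c p.1 []).adjugate * wordGram s c p.1 [b]) ij.1 ij.2
  have he : ∀ b ij, e b ij ∈ cmAlg N := fun b ij =>
    adjugate_mul_mem_of_forall_mem _ _ _ (hgram []) (hgram [b]) _ _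
  obtain ⟨n, h, hh, hn⟩ := exists_pow_mul_eval_div_mem (cmAlg N) D hD (Sum.elim (e true) (e false))
    (by rintro (i | i) <;> exact he _ _) q
  refine ⟨n + 1, ?_⟩
  convert (cmAlg N).mul_mem hD hh using 1
  funext p
  by_cases hp : D p = 0
  · simp only [D] at hp
    simp [hp, D]
  · rw [Pi.mul_apply, ← hn p hp, eq_apply_of_det_wordGram_ne_zero hf s c p hp, hq, pow_succ',
      mul_assoc]
    congr 4
    funext i
    rcases i with i | i <;> rfl

set_option synthInstance.maxHeartbeats 1000000 in
/-- On `X_N`, every invariant polynomial function is a polynomial in the `(N+1)²`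
functions `m_ij`: the `m_ij` generate the algebra of regular functions on the
Calogero–Moser space `C_N`. -/
theorem stmt13 (N : ℕ) (hN : 0 < N) (f : Mat N × Mat N → ℂ) (hf : IsInvPoly N f) :
    (fun p : XN N => f p.val) ∈
      Algebra.adjoin ℂ
        {h : XN N → ℂ | ∃ i j : Fin (N + 1),
          h = fun p : XN N => mcoeff N i j p.val.1 p.val.2} := by
  let I : Ideal (cmAlg N) :=
    { carrier := {d | d.1 * (fun p : XN N => f p.1) ∈ cmAlg N}
      add_mem' := fun {a b} ha hb => by
        have := (cmAlg N).add_mem ha hb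
        rwa [← add_mul] at this
      zero_mem' := by
        have := (cmAlg N).zero_mem
        rwa [← zero_mul (fun p : XN N => f p.1)] at this
      smul_mem' := fun a b hb => by
        have := (cmAlg N).mul_mem a.2 hb
        rwa [← mul_assoc] at this }
  suffices h : I = ⊤ by
    have h1 : (1 : cmAlg N) ∈ I := h ▸ Submodule.mem_top
    have h2 : (1 : XN N → ℂ) * (fun p : XN N => f p.1) ∈ cmAlg N := h1
    rwa [one_mul] at h2
  by_contra hI
  obtain ⟨m, hm, hIm⟩ := Ideal.exists_le_maximal I hI
  obtain ⟨s, c, hsc⟩ := exists_det_wordGram_notMem hN m hm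
  obtain ⟨e, he⟩ := exists_det_wordGram_pow_mul_mem hN hf s c
  let d : cmAlg N := ⟨fun p => (wordGram s c p.1 []).det,
    det_mem_of_forall_mem _ _ fun i j => wordTrace_mem_cmAlg hN _⟩
  have hd : d ^ e ∈ I := he
  exact hsc d (fun p => rfl) (hm.isPrime.mem_of_pow_mem e (hIm hd))
end
end

section
/- For every (a_1,…,a_N,b_1,…,b_N) ∈ C^{2N}, the quotient of P_N by the ideal of P_N generated by the 2N elements e_i(z_1,…,z_N) − a_i and e_i(λ_1,…,λ_N) − b_i (1 ≤ i ≤ N), where e_i denotes the i-th elementary symmetric polynomial, is a C-vector space of dimension N!. -/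
open MvPolynomial

noncomputable section

/-- The algebra of multi-symmetric polynomials `P_N`. -/
def PN (N : ℕ) : Subalgebra ℂ (Rzl N) :=
  ⨅ σ : Equiv.Perm (Fin N), AlgHom.equalizer (permHat N σ).toAlgHom (AlgHom.id ℂ (Rzl N))

/-- If `g` spans `C` over `B` and `h` spans `R` over `C`, the products span `R` over `B`. -/
theorem span_range_smul_eq_top {B C R ι κ : Type*} [CommRing B] [CommRing C] [CommRing R]
    [Algebra B C] [Algebra C R] [Algebra B R] [IsScalarTower B C R] {g : ι → C} {h : κ → R}
    (hg : Submodule.span B (Set.range g) = ⊤) (hh : Submodule.span C (Set.range h) = ⊤) :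
    Submodule.span B (Set.range fun p : ι × κ => g p.1 • h p.2) = ⊤ := by
  have := Submodule.span_smul_of_span_eq_top (R := B) (S := C) (A := R) hg (Set.range h)
  rw [hh, Submodule.restrictScalars_top] at this
  rw [← this]
  congr 1
  ext x
  simp [Set.mem_smul]

theorem adjoin_eq_top_of_tower {A C R : Type*} [CommRing A] [CommRing C] [CommRing R]
    [Algebra A C] [Algebra C R] [Algebra A R] [IsScalarTower A C R] {s t : Set R}
    (hs : Algebra.adjoin A s = ⊤) (hst : s ⊆ Set.range (algebraMap C R) ∪ t) :
    Algebra.adjoin C t = ⊤ := by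
  refine Algebra.eq_top_iff.2 fun x => ?_
  have hx : x ∈ Algebra.adjoin A s := hs ▸ Algebra.mem_top
  have hle : Algebra.adjoin A s ≤ (Algebra.adjoin C t).restrictScalars A := by
    refine Algebra.adjoin_le fun y hy => ?_
    obtain ⟨c, rfl⟩ | hy := hst hy
    · exact Subalgebra.algebraMap_mem (Algebra.adjoin C t) c
    · exact show y ∈ Algebra.adjoin C t from Algebra.subset_adjoin hy
  exact hle hx

/-- If `R` is generated over `A` by the roots of a monic polynomial of degree `n` that splits
in `R`, then `R` is spanned over `A` by `n!` elements. -/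
theorem exists_span_range_eq_top_of_adjoin_roots {R : Type*} [CommRing R] (n : ℕ) :
    ∀ {A : Type _} [CommRing A] [Algebra A R] (f : Polynomial A) (z : Fin n → R),
      f.Monic → f.map (algebraMap A R) = ∏ i, (Polynomial.X - Polynomial.C (z i)) →
      Algebra.adjoin A (Set.range z) = ⊤ →
      ∃ v : Fin n.factorial → R, Submodule.span A (Set.range v) = ⊤ := by
  induction n with
  | zero =>
    intro A _ _ f z _ _ hz
    refine ⟨fun _ => 1, ?_⟩
    rw [Set.range_eq_empty, Algebra.adjoin_empty] at hz
    have : Nonempty (Fin (Nat.factorial 0)) := ⟨⟨0, Nat.factorial_pos 0⟩⟩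
    rw [Set.range_const, ← Submodule.one_eq_span, ← Algebra.toSubmodule_bot, hz,
      Algebra.top_toSubmodule]
  | succ n ih =>
    intro A _ _ f z hf hfz hz
    nontriviality R
    have : Nontrivial A := (algebraMap A R).domain_nontrivial
    have hdeg : f.natDegree = n + 1 := by
      rw [← hf.natDegree_map (algebraMap A R), hfz, Polynomial.natDegree_prod_of_monic _ _
        fun i _ => Polynomial.monic_X_sub_C _]
      simp
    have hroot : f.eval₂ (algebraMap A R) (z 0) = 0 := by
      rw [← Polynomial.eval_map, hfz, Polynomial.eval_prod]
      exact Finset.prod_eq_zero (Finset.mem_univ 0) (by simp)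
    let φ : AdjoinRoot f →ₐ[A] R := AdjoinRoot.liftAlgHom f (Algebra.ofId A R) (z 0) hroot
    have hφ : φ (AdjoinRoot.root f) = z 0 :=
      AdjoinRoot.liftAlgHom_root f (Algebra.ofId A R) (z 0) hroot
    let := φ.toRingHom.toAlgebra
    have : IsScalarTower A (AdjoinRoot f) R := IsScalarTower.of_algHom φ
    have hφ' : algebraMap (AdjoinRoot f) R (AdjoinRoot.root f) = z 0 := hφ
    obtain ⟨q, hq⟩ : (Polynomial.X - Polynomial.C (AdjoinRoot.root f)) ∣
        f.map (algebraMap A (AdjoinRoot f)) :=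
      Polynomial.dvd_iff_isRoot.2 (AdjoinRoot.isRoot_root f)
    have hqm : q.Monic := (Polynomial.monic_X_sub_C _).of_mul_monic_left (hq ▸ hf.map _)
    have hqz : q.map (algebraMap (AdjoinRoot f) R) =
        ∏ i : Fin n, (Polynomial.X - Polynomial.C (z i.succ)) := by
      refine (Polynomial.monic_X_sub_C (z 0)).isRegular.left ?_
      change _ * _ = _ * _
      rw [← Fin.prod_univ_succ (fun i => Polynomial.X - Polynomial.C (z i)), ← hfz,
        IsScalarTower.algebraMap_eq A (AdjoinRoot f) R, ← Polynomial.map_map, hq]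
      simp [hφ']
    have htop : Algebra.adjoin (AdjoinRoot f) (Set.range fun i : Fin n => z i.succ) = ⊤ := by
      refine adjoin_eq_top_of_tower hz ?_
      rintro _ ⟨i, rfl⟩
      refine Fin.cases (Or.inl ⟨_, hφ'⟩) (fun j => Or.inr ⟨j, rfl⟩) i
    obtain ⟨v, hv⟩ := ih q (fun i => z i.succ) hqm hqz htop
    let pb := AdjoinRoot.powerBasis' hf
    have hspan := span_range_smul_eq_top pb.basis.span_eq hv
    have hdim : pb.dim = n + 1 := hdeg
    let e : Fin (n + 1).factorial ≃ Fin pb.dim × Fin n.factorial :=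
      Fintype.equivOfCardEq (by
        rw [Fintype.card_prod, Fintype.card_fin, Fintype.card_fin, Fintype.card_fin, hdim,
          Nat.factorial_succ])
    refine ⟨(fun p => pb.basis p.1 • v p.2) ∘ e, ?_⟩
    rw [e.surjective.range_comp, hspan]

/-- A spanning family of `R` over `B` whose cardinality is the number of elements of a family of
distinct `B`-algebra endomorphisms of the domain `R` is linearly independent. -/
theorem linearIndependent_of_span_of_algHom {B R ι G : Type*} [CommRing B] [CommRing R]
    [IsDomain R] [Algebra B R] [FaithfulSMul B R] [Fintype ι] [Fintype G]
    (φ : G → R →ₐ[B] R) (hφ : Function.Injective φ) (v : ι → R)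
    (hv : Submodule.span B (Set.range v) = ⊤) (hcard : Fintype.card ι = Fintype.card G) :
    LinearIndependent B v := by
  classical
  let e : ι ≃ G := Fintype.equivOfCardEq hcard
  let M : Matrix ι ι R := Matrix.of fun i j => φ (e i) (v j)
  have hdet : M.det ≠ 0 := by
    intro h
    obtain ⟨c, hc, hc0⟩ := Matrix.exists_vecMul_eq_zero_iff.2 h
    have key : ∀ x : R, ∑ i, c i * φ (e i) x = 0 := by
      intro x
      have hx : x ∈ Submodule.span B (Set.range v) := hv ▸ Submodule.mem_top
      induction hx using Submodule.span_induction with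
      | mem x hx =>
        obtain ⟨j, rfl⟩ := hx
        exact congrFun hc0 j
      | zero => simp
      | add x y _ _ hx hy => simp [mul_add, Finset.sum_add_distrib, hx, hy]
      | smul b x _ hx => simp [← Finset.smul_sum, hx]
    have hli := linearIndependent_monoidHom R R
    have hinj : Function.Injective fun i => ((φ (e i) : R →ₐ[B] R) : R →* R) := by
      intro i j hij
      exact e.injective (hφ (AlgHom.ext fun x => DFunLike.congr_fun hij x))
    have := Fintype.linearIndependent_iff.1 (hli.comp _ hinj) c (by
      ext x
      simpa using key x)
    exact hc (funext this)
  rw [Fintype.linearIndependent_iff]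
  intro b hb
  have : (fun j => algebraMap B R (b j)) = 0 := by
    refine Matrix.eq_zero_of_mulVec_eq_zero hdet (funext fun i => ?_)
    have := congrArg (φ (e i)) hb
    simpa [M, Matrix.mulVec, dotProduct, Algebra.smul_def, mul_comm] using this
  intro i
  exact FaithfulSMul.algebraMap_injective B R (by simpa using congrFun this i)

/-- An algebra endomorphism `φ` has trace zero as soon as some multiple of some `φ x - x` is a
nonzero scalar. -/
theorem trace_algHom_eq_zero {B R : Type*} [CommRing B] [IsDomain B] [CommRing R] [Algebra B R]
    (φ : R →ₐ[B] R) (x w : R) (D : B) (hD : D ≠ 0) (h : w * (φ x - x) = algebraMap B R D) :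
    LinearMap.trace B R φ.toLinearMap = 0 := by
  have h1 : LinearMap.mulLeft B w * φ.toLinearMap * LinearMap.mulLeft B x -
      LinearMap.mulLeft B x * (LinearMap.mulLeft B w * φ.toLinearMap) = D • φ.toLinearMap := by
    ext y
    simp only [LinearMap.sub_apply, Module.End.mul_apply, LinearMap.mulLeft_apply,
      AlgHom.toLinearMap_apply, map_mul, LinearMap.smul_apply]
    rw [Algebra.smul_def, ← h]
    ring
  have h2 := congrArg (LinearMap.trace B R) h1
  rw [map_sub, LinearMap.trace_mul_comm, sub_self, map_smul, smul_eq_mul] at h2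
  exact (mul_eq_zero.1 h2.symm).resolve_left hD

theorem finrank_quotient_eq_trace {K B R ι : Type*} [Field K] [CharZero K] [CommRing B]
    [CommRing R] [Algebra K B] [Algebra K R] [Algebra B R] [IsScalarTower K B R] [Finite ι]
    (m : Module.Basis ι B R) (χ : B →ₐ[K] K) (π : R →ₗ[B] R) (P : Subalgebra K R)
    (hπ : ∀ x, π x ∈ P) (hP : ∀ x ∈ P, π x = x) (I : Ideal P)
    (hI : ∀ b : B, χ b = 0 → ∃ y ∈ I, (y : R) = algebraMap B R b)
    (hI' : I ≤ Ideal.span {y : P | ∃ b : B, χ b = 0 ∧ (y : R) = algebraMap B R b}) :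
    (Module.finrank K (P ⧸ I) : K) = χ (LinearMap.trace B R π) := by
  classical
  have := Fintype.ofFinite ι
  let Q : R →ₗ[K] ι → K :=
    { toFun := fun x i => χ (m.repr x i)
      map_add' := fun x y => by ext; simp
      map_smul' := fun c x => by
        ext
        rw [← algebraMap_smul B c x, map_smul]
        simp }
  have hQsmul (b : B) (x : R) : Q (b • x) = χ b • Q x := by ext; simp [Q]
  let M := LinearMap.toMatrix m m π
  let T : (ι → K) →ₗ[K] (ι → K) := Matrix.toLin' (M.map χ)
  have hQπ (x : R) : Q (π x) = T (Q x) := by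
    ext i
    simp only [T, Q, LinearMap.coe_mk, AddHom.coe_mk, Matrix.toLin'_apply]
    rw [← LinearMap.toMatrix_mulVec_repr m m π x]
    simp [Matrix.mulVec, dotProduct, M]
  have hQsurj : Function.Surjective Q := by
    intro y
    refine ⟨∑ i, algebraMap K B (y i) • m i, ?_⟩
    ext j
    simp [Q, Finsupp.single_apply]
  have hQmul (r x : R) (hx : Q x = 0) : Q (r * x) = 0 := by
    rw [← m.sum_repr x, Finset.mul_sum, map_sum]
    refine Finset.sum_eq_zero fun i _ => ?_
    rw [mul_smul_comm, hQsmul, show χ (m.repr x i) = 0 from congrFun hx i, zero_smul]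
  let ψ : P →ₗ[K] ι → K := Q ∘ₗ P.val.toLinearMap
  have hker : LinearMap.ker ψ = I.restrictScalars K := by
    ext x
    constructor
    · intro hx
      have hx' : ∀ i, χ (m.repr x i) = 0 := fun i => congrFun hx i
      choose y hyI hy using fun i => hI _ (hx' i)
      have : x = ∑ i, y i * ⟨π (m i), hπ _⟩ := by
        apply Subtype.ext
        rw [← hP x x.2]
        nth_rw 1 [← m.sum_repr (x : R)]
        simp [hy, ← Algebra.smul_def, -Module.Basis.sum_repr]
      rw [this]
      exact Submodule.sum_mem _ fun i _ => I.mul_mem_right _ (hyI i)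
    · intro hx
      change Q x = 0
      have hx' := hI' hx
      clear hx
      induction hx' using Submodule.span_induction with
      | mem x hx =>
        obtain ⟨b, hb, h⟩ := hx
        rw [h, Algebra.algebraMap_eq_smul_one, hQsmul, hb, zero_smul]
      | zero => simp
      | add x y _ _ hx hy => simp [hx, hy]
      | smul a x _ hx => exact hQmul _ _ hx
  have hrange : LinearMap.range ψ = LinearMap.range T := by
    apply le_antisymm
    · rintro _ ⟨x, rfl⟩
      exact ⟨Q x, by rw [← hQπ, hP x x.2]; rfl⟩
    · rintro _ ⟨y, rfl⟩
      obtain ⟨x, rfl⟩ := hQsurj y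
      exact ⟨⟨π x, hπ x⟩, hQπ x⟩
  have hT : LinearMap.IsProj (LinearMap.range T) T := by
    rw [LinearMap.isProj_range_iff_isIdempotentElem]
    refine LinearMap.ext fun y => ?_
    obtain ⟨x, rfl⟩ := hQsurj y
    rw [Module.End.mul_apply, ← hQπ, ← hQπ, hP _ (hπ x)]
  have e : (P ⧸ I) ≃ₗ[K] LinearMap.range T :=
    (Submodule.Quotient.restrictScalarsEquiv K I).symm ≪≫ₗ
      Submodule.quotEquivOfEq _ _ hker.symm ≪≫ₗ ψ.quotKerEquivRange ≪≫ₗ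
      LinearEquiv.ofEq _ _ hrange
  rw [e.finrank_eq, ← hT.trace, Matrix.trace_toLin'_eq, LinearMap.trace_eq_matrix_trace B m]
  simp [Matrix.trace, M]

/-- If the elementary symmetric polynomials of `z` are scalars, so are the coefficients of the
polynomial with roots `z`. -/
theorem exists_monic_map_eq_prod_X_sub_C {K A T : Type*} [CommRing K] [CommRing A] [CommRing T]
    [Algebra K T] [Algebra A T] {n : ℕ} (z : Fin n → T)
    (hz : ∀ k : Fin n, aeval z (esymm (Fin n) K (k + 1)) ∈ Set.range (algebraMap A T)) :
    ∃ f : Polynomial A, f.Monic ∧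
      f.map (algebraMap A T) = ∏ i, (Polynomial.X - Polynomial.C (z i)) := by
  have hesymm (k : ℕ) (hk : k ≤ n) :
      (Finset.univ.val.map z).esymm k ∈ (algebraMap A T).range := by
    cases k with
    | zero => simp [Multiset.esymm]
    | succ k =>
      rw [← aeval_esymm_eq_multiset_esymm (Fin n) K]
      exact hz ⟨k, hk⟩
  have hlift : ∏ i, (Polynomial.X - Polynomial.C (z i)) ∈ Polynomial.lifts (algebraMap A T) := by
    have h : ∏ i, (Polynomial.X - Polynomial.C (z i)) =
        ((Finset.univ.val.map z).map fun t => Polynomial.X - Polynomial.C t).prod := by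
      rw [Multiset.map_map]
      rfl
    rw [h, Multiset.prod_X_sub_X_eq_sum_esymm]
    refine Subsemiring.sum_mem _ fun j hj => ?_
    have hj' : j ≤ n := by
      simpa [Nat.lt_succ_iff] using hj
    refine Subsemiring.mul_mem _ (Subsemiring.pow_mem _ ?_ _) (Subsemiring.mul_mem _
      (Polynomial.C'_mem_lifts (hesymm j hj')) (Polynomial.X_pow_mem_lifts _ _))
    exact ⟨-1, by simp⟩
  obtain ⟨f, hf, -, hm⟩ := Polynomial.lifts_and_natDegree_eq_and_monic hlift
    (Polynomial.monic_prod_of_monic _ _ fun i _ => Polynomial.monic_X_sub_C _)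
  exact ⟨f, hm, hf⟩

/-- If `T` is generated over `A` by two families of lengths `n` and `k` whose elementary symmetric
polynomials are scalars, then `T` is spanned over `A` by `n! * k!` elements. -/
theorem exists_span_range_eq_top_of_esymm {K A T : Type*} [CommRing K] [CommRing A] [CommRing T]
    [Algebra K A] [Algebra K T] [Algebra A T] [IsScalarTower K A T] {n k : ℕ}
    (x : Fin n → T) (y : Fin k → T)
    (hx : ∀ i : Fin n, aeval x (esymm (Fin n) K (i + 1)) ∈ Set.range (algebraMap A T))
    (hy : ∀ i : Fin k, aeval y (esymm (Fin k) K (i + 1)) ∈ Set.range (algebraMap A T))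
    (htop : Algebra.adjoin A (Set.range x ∪ Set.range y) = ⊤) :
    ∃ v : Fin n.factorial × Fin k.factorial → T, Submodule.span A (Set.range v) = ⊤ := by
  let S : Subalgebra A T := Algebra.adjoin A (Set.range x)
  let z : Fin n → S := fun i => ⟨x i, Algebra.subset_adjoin ⟨i, rfl⟩⟩
  obtain ⟨f, hf, hfz⟩ := exists_monic_map_eq_prod_X_sub_C (K := K) (A := A) z
    (by
      intro i
      obtain ⟨c, hc⟩ := hx i
      refine ⟨c, Subtype.ext (hc.trans ?_)⟩
      exact (comp_aeval_apply z (S.val.restrictScalars K) _).symm)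
  obtain ⟨v, hv⟩ := exists_span_range_eq_top_of_adjoin_roots n f z hf hfz (by
    convert! Algebra.adjoin_adjoin_coe_preimage (R := A) (s := Set.range x)
    ext x
    simp [z, Subtype.ext_iff])
  obtain ⟨g, hg, hgz⟩ := exists_monic_map_eq_prod_X_sub_C (K := K) (A := S) y (by
    intro i
    obtain ⟨c, hc⟩ := hy i
    exact ⟨algebraMap A S c, hc⟩)
  obtain ⟨w, hw⟩ := exists_span_range_eq_top_of_adjoin_roots k g y hg hgz
    (adjoin_eq_top_of_tower htop (by
      rintro _ (⟨i, rfl⟩ | h)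
      · exact Or.inl ⟨z i, rfl⟩
      · exact Or.inr h))
  exact ⟨_, span_range_smul_eq_top hv hw⟩

/-- Over an algebraically closed field the elementary symmetric polynomials take any prescribed
values. -/
theorem exists_aeval_esymm_eq {K : Type*} [Field K] [IsAlgClosed K] {n : ℕ} (c : Fin n → K) :
    ∃ z : Fin n → K, ∀ i : Fin n, aeval z (esymm (Fin n) K (i + 1)) = c i := by
  let d : Fin n → K := fun j => (-1) ^ (n - (j : ℕ)) * c j.rev
  let p : Polynomial K := (Polynomial.freeMonic K n).map (eval d)
  have hp : p.Monic := (Polynomial.monic_freeMonic K n).map _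
  have hdeg : p.natDegree = n := by
    rw [(Polynomial.monic_freeMonic K n).natDegree_map, Polynomial.natDegree_freeMonic]
  have hcard : p.roots.card = n := by
    rw [Polynomial.splits_iff_card_roots.1 (IsAlgClosed.splits p), hdeg]
  obtain ⟨z, hz⟩ : ∃ z : Fin n → K, Finset.univ.val.map z = p.roots := by
    generalize p.roots = s at hcard
    obtain ⟨l, rfl⟩ := Quot.exists_rep s
    subst hcard
    exact ⟨l.get, (Fin.univ_val_map _).trans (congrArg _ (List.ofFn_get l))⟩
  refine ⟨z, fun i => ?_⟩
  have hi : n - (n - 1 - (i : ℕ)) = i + 1 := by omega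
  have h := Polynomial.coeff_eq_esymm_roots_of_splits (IsAlgClosed.splits p)
    (k := n - 1 - i) (by omega)
  have hrev : (⟨n - 1 - i, by omega⟩ : Fin n).rev = i := Fin.ext (by simp; omega)
  rw [hp.leadingCoeff, one_mul, hdeg, hi, ← hz, Polynomial.coeff_map, Polynomial.coeff_freeMonic,
    dif_pos (by omega)] at h
  have h' : d ⟨n - 1 - i, by omega⟩ = (-1) ^ ((i : ℕ) + 1) * c i := by
    simp only [d, hrev, hi]
  rw [aeval_esymm_eq_multiset_esymm]
  refine mul_left_cancel₀ (pow_ne_zero ((i : ℕ) + 1) (neg_ne_zero.2 (one_ne_zero (α := K)))) ?_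
  rw [← h, ← h']
  exact eval_X _

/-- The subalgebra generated by the elementary symmetric polynomials in each of the two blocks
of variables. -/
def blockSymmetric (N : ℕ) : Subalgebra ℂ (Rzl N) :=
  Algebra.adjoin ℂ
    (Set.range (fun i : Fin N => rename Sum.inl (esymm (Fin N) ℂ ((i : ℕ) + 1))) ∪
      Set.range (fun i : Fin N => rename Sum.inr (esymm (Fin N) ℂ ((i : ℕ) + 1))))

theorem rename_inl_esymm_mem (N : ℕ) (i : Fin N) :
    rename Sum.inl (esymm (Fin N) ℂ ((i : ℕ) + 1)) ∈ blockSymmetric N :=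
  Algebra.subset_adjoin (Or.inl ⟨i, rfl⟩)

theorem rename_inr_esymm_mem (N : ℕ) (i : Fin N) :
    rename Sum.inr (esymm (Fin N) ℂ ((i : ℕ) + 1)) ∈ blockSymmetric N :=
  Algebra.subset_adjoin (Or.inr ⟨i, rfl⟩)

theorem rename_mem_blockSymmetric {N : ℕ} {p : MvPolynomial (Fin N) ℂ} (hp : p.IsSymmetric)
    (f : Fin N → Fin N ⊕ Fin N)
    (hf : ∀ i : Fin N, rename f (esymm (Fin N) ℂ ((i : ℕ) + 1)) ∈ blockSymmetric N) :
    rename f p ∈ blockSymmetric N := by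
  obtain ⟨q, hq⟩ := esymmAlgHom_surjective (σ := Fin N) (n := N) ℂ (by simp) ⟨p, hp⟩
  have hq' : aeval (fun i : Fin N ↦ esymm (Fin N) ℂ (i + 1)) q = p := by
    rw [← esymmAlgHom_apply, hq]
  have : rename f p = aeval (fun i : Fin N => (⟨_, hf i⟩ : blockSymmetric N)) q := by
    rw [← hq']
    refine (comp_aeval_apply _ (rename f) q).trans ?_
    exact (comp_aeval_apply (fun i : Fin N => (⟨_, hf i⟩ : blockSymmetric N))
      (blockSymmetric N).val q).symm
  rw [this]
  exact Subtype.coe_prop _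

/-- Permutations of the two blocks of variables act by automorphisms over `blockSymmetric N`. -/
def blockPerm (N : ℕ) (g : Equiv.Perm (Fin N) × Equiv.Perm (Fin N)) :
    Rzl N →ₐ[blockSymmetric N] Rzl N :=
  { (rename (Sum.map g.1 g.2) : Rzl N →ₐ[ℂ] Rzl N) with
    commutes' := by
      intro b
      have h : blockSymmetric N ≤
          AlgHom.equalizer (rename (Sum.map g.1 g.2)) (AlgHom.id ℂ (Rzl N)) := by
        refine Algebra.adjoin_le ?_
        rintro _ (⟨i, rfl⟩ | ⟨i, rfl⟩)
        · change rename _ (rename _ _) = rename _ _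
          rw [rename_rename, show Sum.map g.1 g.2 ∘ Sum.inl = Sum.inl ∘ _ from rfl,
            ← rename_rename, rename_esymm]
        · change rename _ (rename _ _) = rename _ _
          rw [rename_rename, show Sum.map g.1 g.2 ∘ Sum.inr = Sum.inr ∘ _ from rfl,
            ← rename_rename, rename_esymm]
      exact h b.2 }

theorem blockPerm_apply {N : ℕ} (g : Equiv.Perm (Fin N) × Equiv.Perm (Fin N)) (x : Rzl N) :
    blockPerm N g x = rename (Sum.map g.1 g.2) x := rfl

theorem blockPerm_injective (N : ℕ) : Function.Injective (blockPerm N) := by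
  intro g h hgh
  have key (j : Fin N ⊕ Fin N) : Sum.map g.1 g.2 j = Sum.map h.1 h.2 j := by
    have := DFunLike.congr_fun hgh (X j)
    rw [blockPerm_apply, blockPerm_apply, rename_X, rename_X] at this
    exact X_injective this
  refine Prod.ext (Equiv.ext fun i => ?_) (Equiv.ext fun i => ?_)
  · simpa using key (Sum.inl i)
  · simpa using key (Sum.inr i)

theorem exists_span_blockSymmetric (N : ℕ) :
    ∃ v : Fin N.factorial × Fin N.factorial → Rzl N,
      Submodule.span (blockSymmetric N) (Set.range v) = ⊤ := by
  refine exists_span_range_eq_top_of_esymm (K := ℂ) (fun i : Fin N => (X (Sum.inl i) : Rzl N))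
    (fun i : Fin N => (X (Sum.inr i) : Rzl N))
    (fun i => ⟨⟨_, rename_inl_esymm_mem N i⟩,
      DFunLike.congr_fun (show (rename Sum.inl : MvPolynomial (Fin N) ℂ →ₐ[ℂ] Rzl N) =
        aeval (fun i => X (Sum.inl i)) from algHom_ext fun i => by simp) _⟩)
    (fun i => ⟨⟨_, rename_inr_esymm_mem N i⟩,
      DFunLike.congr_fun (show (rename Sum.inr : MvPolynomial (Fin N) ℂ →ₐ[ℂ] Rzl N) =
        aeval (fun i => X (Sum.inr i)) from algHom_ext fun i => by simp) _⟩) ?_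
  refine adjoin_eq_top_of_tower (A := ℂ) (adjoin_range_X (σ := Fin N ⊕ Fin N)) ?_
  rintro _ ⟨i | i, rfl⟩
  · exact Or.inr (Or.inl ⟨i, rfl⟩)
  · exact Or.inr (Or.inr ⟨i, rfl⟩)

/-- The product of all differences of distinct variables is symmetric. -/
theorem isSymmetric_prod_offDiag_X_sub_X (N : ℕ) :
    (∏ p ∈ (Finset.univ : Finset (Fin N)).offDiag,
      (X p.1 - X p.2 : MvPolynomial (Fin N) ℂ)).IsSymmetric := by
  intro e
  rw [map_prod]
  refine Finset.prod_equiv (e.prodCongr e) (by simp) (by simp)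

theorem trace_blockPerm_eq_zero {N : ℕ} (σ : Equiv.Perm (Fin N)) (hσ : σ ≠ 1) :
    LinearMap.trace (blockSymmetric N) (Rzl N) (blockPerm N (σ, σ)).toLinearMap = 0 := by
  obtain ⟨i, hi⟩ : ∃ i, σ i ≠ i := by
    by_contra! h
    exact hσ (Equiv.ext h)
  let s := (Finset.univ : Finset (Fin N)).offDiag
  let D : MvPolynomial (Fin N) ℂ := ∏ p ∈ s, (X p.1 - X p.2)
  have hD : D ≠ 0 := by
    refine Finset.prod_ne_zero_iff.2 fun p hp => sub_ne_zero.2 fun h => ?_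
    exact (Finset.mem_offDiag.1 hp).2.2 (X_injective h)
  have hDB : rename Sum.inl D ∈ blockSymmetric N :=
    rename_mem_blockSymmetric (isSymmetric_prod_offDiag_X_sub_X N) _ (rename_inl_esymm_mem N)
  refine trace_algHom_eq_zero _ (X (Sum.inl i))
    (rename Sum.inl (∏ p ∈ s.erase (σ i, i), (X p.1 - X p.2))) ⟨_, hDB⟩ ?_ ?_
  · intro h
    refine hD (rename_injective (Sum.inl : _ → Fin N ⊕ Fin N) Sum.inl_injective ?_)
    simpa using congrArg Subtype.val h
  · change _ = rename Sum.inl D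
    rw [show D = _ from (Finset.prod_erase_mul s _
      (show (σ i, i) ∈ s by simpa [s] using hi)).symm, map_mul, blockPerm_apply]
    simp

theorem mem_PN {N : ℕ} {x : Rzl N} :
    x ∈ PN N ↔ ∀ σ : Equiv.Perm (Fin N), blockPerm N (σ, σ) x = x := by
  simp only [PN, Algebra.mem_iInf, AlgHom.mem_equalizer]
  rfl

theorem blockSymmetric_le_PN (N : ℕ) : blockSymmetric N ≤ PN N :=
  fun x hx => mem_PN.2 fun σ => (blockPerm N (σ, σ)).commutes ⟨x, hx⟩

/-- The Reynolds operator of the diagonal action. -/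
def reynolds (N : ℕ) : Rzl N →ₗ[blockSymmetric N] Rzl N :=
  algebraMap ℂ (blockSymmetric N) (N.factorial : ℂ)⁻¹ •
    ∑ σ : Equiv.Perm (Fin N), (blockPerm N (σ, σ)).toLinearMap

theorem reynolds_apply {N : ℕ} (x : Rzl N) :
    reynolds N x = (N.factorial : ℂ)⁻¹ • ∑ σ : Equiv.Perm (Fin N), blockPerm N (σ, σ) x := by
  rw [reynolds, LinearMap.smul_apply, algebraMap_smul]
  simp

theorem reynolds_mem_PN {N : ℕ} (x : Rzl N) : reynolds N x ∈ PN N := by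
  rw [mem_PN]
  intro τ
  rw [reynolds_apply, blockPerm_apply, map_smul, map_sum]
  congr 1
  refine Fintype.sum_equiv (Equiv.mulLeft τ) _ _ fun σ => ?_
  rw [blockPerm_apply, blockPerm_apply, rename_rename, Sum.map_comp_map]
  rfl

theorem reynolds_eq_self {N : ℕ} {x : Rzl N} (hx : x ∈ PN N) : reynolds N x = x := by
  rw [reynolds_apply, Finset.sum_congr rfl fun σ _ => mem_PN.1 hx σ, Finset.sum_const,
    Finset.card_univ, Fintype.card_perm, Fintype.card_fin, ← Nat.cast_smul_eq_nsmul ℂ, smul_smul,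
    inv_mul_cancel₀ (Nat.cast_ne_zero.2 N.factorial_ne_zero), one_smul]

theorem exists_basis_blockSymmetric (N : ℕ) :
    Nonempty (Module.Basis (Fin N.factorial × Fin N.factorial) (blockSymmetric N) (Rzl N)) := by
  obtain ⟨v, hv⟩ := exists_span_blockSymmetric N
  have hli := linearIndependent_of_span_of_algHom (blockPerm N) (blockPerm_injective N) v hv
    (by simp [Fintype.card_perm])
  exact ⟨.mk hli hv.ge⟩

theorem trace_reynolds (N : ℕ) :
    LinearMap.trace (blockSymmetric N) (Rzl N) (reynolds N) = (N.factorial : blockSymmetric N) := by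
  obtain ⟨m⟩ := exists_basis_blockSymmetric N
  have := Module.Free.of_basis m
  have := Module.Finite.of_basis m
  have h1 : (blockPerm N (1, 1)).toLinearMap = LinearMap.id := by
    refine LinearMap.ext fun x => ?_
    change rename (Sum.map id id) x = x
    rw [Sum.map_id_id, rename_id_apply]
  rw [reynolds, map_smul, map_sum, Finset.sum_eq_single 1
    (fun σ _ hσ => trace_blockPerm_eq_zero σ hσ) (by simp), h1, LinearMap.trace_id,
    Module.finrank_eq_card_basis m, Fintype.card_prod, Fintype.card_fin, Nat.cast_mul, smul_eq_mul,
    ← mul_assoc, ← map_natCast (algebraMap ℂ (blockSymmetric N)), ← map_mul,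
    inv_mul_cancel₀ (Nat.cast_ne_zero.2 N.factorial_ne_zero), map_one, one_mul]

set_option synthInstance.maxHeartbeats 1000000 in
/-- For every `(a,b) ∈ ℂ^N × ℂ^N`, the quotient of `P_N` by the ideal generated by
the elements `e_i(z) − a_i` and `e_i(λ) − b_i`, `1 ≤ i ≤ N`, is a complex vector
space of dimension `N!`. -/
theorem stmt16 (N : ℕ) (hN : 0 < N) (a b : Fin N → ℂ) :
    Module.finrank ℂ
      ((PN N) ⧸ Ideal.span {x : PN N | ∃ i : Fin N,
        ((x : Rzl N) = rename Sum.inl (esymm (Fin N) ℂ ((i : ℕ) + 1)) - C (a i) ∨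
         (x : Rzl N) = rename Sum.inr (esymm (Fin N) ℂ ((i : ℕ) + 1)) - C (b i))}) =
      Nat.factorial N := by
  let I := Ideal.span {x : PN N | ∃ i : Fin N,
        ((x : Rzl N) = rename Sum.inl (esymm (Fin N) ℂ ((i : ℕ) + 1)) - C (a i) ∨
         (x : Rzl N) = rename Sum.inr (esymm (Fin N) ℂ ((i : ℕ) + 1)) - C (b i))}
  obtain ⟨z, hz⟩ := exists_aeval_esymm_eq a
  obtain ⟨w, hw⟩ := exists_aeval_esymm_eq b
  let ev : Rzl N →ₐ[ℂ] ℂ := aeval (Sum.elim z w)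
  let χ : blockSymmetric N →ₐ[ℂ] ℂ := ev.comp (blockSymmetric N).val
  have hevz (i : Fin N) : ev (rename Sum.inl (esymm (Fin N) ℂ ((i : ℕ) + 1))) = a i := by
    rw [← hz, aeval_rename, Sum.elim_comp_inl]
  have hevw (i : Fin N) : ev (rename Sum.inr (esymm (Fin N) ℂ ((i : ℕ) + 1))) = b i := by
    rw [← hw, aeval_rename, Sum.elim_comp_inr]
  have hev (c : ℂ) : ev (C c) = c := aeval_C _ _
  have hC (c : ℂ) : C c ∈ blockSymmetric N := Subalgebra.algebraMap_mem _ c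
  have hle := blockSymmetric_le_PN N
  have hsub (x : Rzl N) (hx : x ∈ blockSymmetric N) : ∃ y ∈ I, (y : Rzl N) = x - C (ev x) := by
    induction hx using Algebra.adjoin_induction with
    | mem x hx =>
      obtain ⟨i, rfl⟩ | ⟨i, rfl⟩ := hx
      · refine ⟨⟨_, sub_mem (hle (rename_inl_esymm_mem N i)) (hle (hC (a i)))⟩,
          Ideal.subset_span ⟨i, Or.inl rfl⟩, ?_⟩
        rw [hevz]
      · refine ⟨⟨_, sub_mem (hle (rename_inr_esymm_mem N i)) (hle (hC (b i)))⟩,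
          Ideal.subset_span ⟨i, Or.inr rfl⟩, ?_⟩
        rw [hevw]
    | algebraMap c => exact ⟨0, I.zero_mem, by simp [algebraMap_eq, hev]⟩
    | add x y _ _ hx hy =>
      obtain ⟨u, hu, hu'⟩ := hx
      obtain ⟨v, hv, hv'⟩ := hy
      refine ⟨u + v, I.add_mem hu hv, ?_⟩
      rw [Subalgebra.coe_add, hu', hv', map_add, map_add]
      ring
    | mul x y _ hyB hx hy =>
      obtain ⟨u, hu, hu'⟩ := hx
      obtain ⟨v, hv, hv'⟩ := hy
      refine ⟨u * ⟨y, hle hyB⟩ + ⟨_, hle (hC (ev x))⟩ * v,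
        I.add_mem (I.mul_mem_right _ hu) (I.mul_mem_left _ hv), ?_⟩
      rw [Subalgebra.coe_add, Subalgebra.coe_mul, Subalgebra.coe_mul, hu', hv', map_mul, map_mul]
      ring
  obtain ⟨m⟩ := exists_basis_blockSymmetric N
  have key := finrank_quotient_eq_trace m χ (reynolds N) (PN N) reynolds_mem_PN
    (fun x hx => reynolds_eq_self hx) I
    (fun c hc => by
      obtain ⟨y, hy, hyc⟩ := hsub c c.2
      refine ⟨y, hy, ?_⟩
      rw [hyc, show ev c = 0 from hc, map_zero, sub_zero]
      rfl)
    (by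
      refine Ideal.span_mono ?_
      rintro x ⟨i, hx | hx⟩
      · refine ⟨⟨x, hx ▸ sub_mem (rename_inl_esymm_mem N i) (hC (a i))⟩, ?_, rfl⟩
        change ev x = 0
        rw [hx, map_sub, hevz, hev, sub_self]
      · refine ⟨⟨x, hx ▸ sub_mem (rename_inr_esymm_mem N i) (hC (b i))⟩, ?_, rfl⟩
        change ev x = 0
        rw [hx, map_sub, hevw, hev, sub_self])
  rw [trace_reynolds, map_natCast] at key
  exact_mod_cast key
end
end
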